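/- arXiv:2210.15423 — 2 statements merged into one kernel-verified Lean document; each statement's English description precedes it below -/
import Mathlib

section
/- Let d ≥ 1, n ≥ 1, and set N = d + n + 2. Let Σ be a collection of subsets of [N] = {1, …, N} that is closed under taking subsets (a simplicial complex on [N]), and suppose the complement 2^{[N]} \ Σ can be partitioned into n families F_1, …, F_n, each of which is pairwise intersecting. Let |Σ| = {x ∈ Δ_{N−1} : supp(x) ∈ Σ}, where Δ_{N−1} = {x ∈ ℝ^N : x_i ≥ 0, ∑_i x_i = 1} and supp(x) = {i : x_i > 0}. Then for any continuous map f : |Σ| → ℝ^d there exist disjoint sets σ, τ ∈ Σ such that f(Δ_σ ∩ |Σ|) ∩ f(Δ_τ ∩ |Σ|) ≠ ∅, where Δ_σ = {x ∈ Δ_{N−1} : x_i = 0 for all i ∉ σ}. -/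
/-- The face `Δ_σ` of the standard simplex on `Fin N` spanned by the vertices in `σ`. -/
def simplexFaceSet (N : ℕ) (σ : Set (Fin N)) : Set (Fin N → ℝ) :=
  {x | x ∈ stdSimplex ℝ (Fin N) ∧ ∀ i, i ∉ σ → x i = 0}

/-- The geometric realization `|Σ|` of a simplicial complex `Σ` on `Fin N` inside the
standard simplex: the points of the simplex whose support is a face of `Σ`. -/
def realization (N : ℕ) (S : Set (Set (Fin N))) : Set (Fin N → ℝ) :=
  {x | x ∈ stdSimplex ℝ (Fin N) ∧ {i | x i ≠ 0} ∈ S}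

namespace BU

open Finset

variable {E : Type*}

/-- Mod 2 chains on ordered tuples of points (augmented: the empty tuple is allowed). -/
abbrev Ch (E : Type*) := List E →₀ ZMod 2

/-- Cone over a chain with apex `b`. -/
noncomputable def cone (b : E) : Ch E →ₗ[ZMod 2] Ch E := Finsupp.lmapDomain _ _ (List.cons b)

/-- Boundary of a tuple. -/
noncomputable def bdL : List E → Ch E
  | [] => 0
  | v :: l => Finsupp.single l 1 + cone v (bdL l)

/-- Boundary. -/
noncomputable def bd : Ch E →ₗ[ZMod 2] Ch E := Finsupp.linearCombination (ZMod 2) bdL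

/-- Evaluation of a cochain. -/
noncomputable def ev (F : List E → ZMod 2) : Ch E →ₗ[ZMod 2] ZMod 2 :=
  Finsupp.linearCombination (ZMod 2) F

theorem cone_single (b : E) (l : List E) :
    cone b (Finsupp.single l 1) = Finsupp.single (b :: l) 1 := by
  simp [cone, Finsupp.mapDomain_single]

theorem bd_single (l : List E) : bd (Finsupp.single l 1) = bdL l := by simp [bd]

theorem ev_single (F : List E → ZMod 2) (l : List E) : ev F (Finsupp.single l 1) = F l := by
  simp [ev]

theorem two_zero (c : Ch E) : c + c = 0 := by
  ext l; simp only [Finsupp.coe_add, Pi.add_apply, Finsupp.coe_zero, Pi.zero_apply]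
  exact CharTwo.add_self_eq_zero _

theorem lin_ext {M : Type*} [AddCommMonoid M] [Module (ZMod 2) M] {f g : Ch E →ₗ[ZMod 2] M}
    (h : ∀ l, f (Finsupp.single l 1) = g (Finsupp.single l 1)) : f = g := by
  apply Finsupp.lhom_ext'
  intro l
  apply LinearMap.ext_ring
  simpa using h l

theorem bd_cone (b : E) (c : Ch E) : bd (cone b c) = c + cone b (bd c) := by
  have : bd ∘ₗ cone b = LinearMap.id + cone b ∘ₗ bd := by
    apply lin_ext
    intro l
    simp [cone_single, bd_single, bdL]
  exact LinearMap.congr_fun this c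

theorem bd_bdL (l : List E) : bd (bdL l) = 0 := by
  induction l with
  | nil => simp [bdL]
  | cons v l ih => rw [bdL, map_add, bd_single, bd_cone, ih, map_zero, add_zero, two_zero]

theorem bd_bd (c : Ch E) : bd (bd c) = 0 := by
  have : (bd ∘ₗ bd : Ch E →ₗ[ZMod 2] Ch E) = 0 := by
    apply lin_ext
    intro l
    simp [bd_single, bd_bdL]
  exact LinearMap.congr_fun this c

/-- Antipode. -/
noncomputable def anti [Neg E] : Ch E →ₗ[ZMod 2] Ch E :=
  Finsupp.lmapDomain _ _ (List.map (fun x => -x))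

theorem anti_single [Neg E] (l : List E) :
    anti (Finsupp.single l 1) = Finsupp.single (l.map (fun x => -x)) 1 := by
  simp [anti, Finsupp.mapDomain_single]

theorem anti_cone [Neg E] (b : E) (c : Ch E) : anti (cone b c) = cone (-b) (anti c) := by
  have : anti ∘ₗ cone b = cone (-b) ∘ₗ anti := by
    apply lin_ext
    intro l
    simp [cone_single, anti_single]
  exact LinearMap.congr_fun this c

theorem anti_bd [Neg E] (c : Ch E) : anti (bd c) = bd (anti c) := by
  have : (anti ∘ₗ bd : Ch E →ₗ[ZMod 2] Ch E) = bd ∘ₗ anti := by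
    apply lin_ext
    intro l
    simp only [LinearMap.comp_apply, bd_single, anti_single]
    induction l with
    | nil => simp [bdL]
    | cons v l ih => rw [bdL, map_add, anti_single, anti_cone, ih, List.map_cons, bdL]
  exact LinearMap.congr_fun this c

section cochains

variable (θ : ℕ → E → ZMod 2)

/-- The cup product of the coboundaries of the first `k` zero-cochains. -/
def W : ℕ → List E → ZMod 2
  | 0, [_] => 1
  | 0, _ => 0
  | k + 1, v :: w :: l => (θ k v + θ k w) * W k (w :: l)
  | _ + 1, _ => 0

/-- The product of a zero-cochain and `W`. -/
def al (k : ℕ) : List E → ZMod 2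
  | [] => 0
  | v :: l => θ k v * W θ k (v :: l)

theorem W_nil (k : ℕ) : W θ k [] = 0 := by cases k <;> rfl

theorem ev_cone (F : List E → ZMod 2) (v : E) (c : Ch E) :
    ev F (cone v c) = ev (fun l => F (v :: l)) c := by
  have : ev F ∘ₗ cone v = ev (fun l => F (v :: l)) := by
    apply lin_ext
    intro l
    simp [cone_single, ev_single]
  exact LinearMap.congr_fun this c

theorem ev_mul (a : ZMod 2) (F : List E → ZMod 2) (c : Ch E) :
    ev (fun l => a * F l) c = a * ev F c := by
  have : ev (fun l => a * F l) = a • ev F := by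
    apply lin_ext
    intro l
    simp [ev_single]
  simpa using LinearMap.congr_fun this c

theorem W_coc (k : ℕ) (l : List E) : ev (W θ k) (bdL l) = 0 := by
  induction k generalizing l with
  | zero =>
    match l with
    | [] => simp [bdL]
    | [v] => simp [bdL, ev_single, W]
    | [v, w] =>
      simp only [bdL, map_add, ev_single, cone_single, map_zero, add_zero, W]; decide
    | v :: w :: u :: l =>
      simp only [bdL, map_add, ev_single, cone_single, W, ev_cone, zero_add]
      have : (fun l : List E => (0 : ZMod 2)) = fun l => 0 * (0 : ZMod 2) := by simp
      rw [this, ev_mul]; simp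
  | succ k ih =>
    match l with
    | [] => simp [bdL]
    | [v] => simp [bdL, ev_single, W]
    | [v, w] =>
      simp only [bdL, map_add, ev_single, cone_single, map_zero, add_zero, W]
    | v :: w :: u :: l =>
      have h := ih (w :: u :: l)
      rw [bdL, map_add, ev_single, ev_cone] at h
      rw [bdL, bdL, map_add, map_add, map_add, ev_single, cone_single, ev_single, ev_cone, ev_cone]
      simp only [W]
      rw [ev_mul]
      have h2 : ev (fun l => W θ k (w :: l)) (bdL (u :: l)) = W θ k (u :: l) := by
        rw [← CharTwo.add_eq_zero, add_comm]; exact h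
      rw [h2]
      generalize W θ k (u :: l) = z
      generalize θ k v = a
      generalize θ k w = b
      generalize θ k u = c
      revert z a b c; decide

theorem al_cob (k : ℕ) (l : List E) : ev (al θ k) (bdL l) = W θ (k + 1) l := by
  match l with
  | [] => simp [bdL, W]
  | [v] => simp [bdL, ev_single, al, W]
  | v :: w :: l =>
    have h := W_coc θ k (v :: w :: l)
    rw [bdL, map_add, ev_single, ev_cone] at h
    rw [bdL, map_add, ev_single, ev_cone]
    simp only [al, W]
    rw [ev_mul]
    have h2 : ev (fun l => W θ k (v :: l)) (bdL (w :: l)) = W θ k (w :: l) := by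
      rw [← CharTwo.add_eq_zero, add_comm]; exact h
    rw [h2]; ring

theorem al_bd (k : ℕ) (c : Ch E) : ev (al θ k) (bd c) = ev (W θ (k + 1)) c := by
  have : ev (al θ k) ∘ₗ bd = ev (W θ (k + 1)) := by
    apply lin_ext
    intro l
    simp [bd_single, ev_single, al_cob]
  exact LinearMap.congr_fun this c

/-- Where `W` is nonzero, each of the zero-cochains takes two values. -/
theorem W_ne (k : ℕ) (l : List E) (h : W θ k l ≠ 0) :
    ∀ j < k, ∃ v ∈ l, ∃ w ∈ l, θ j v ≠ θ j w := by
  induction k generalizing l with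
  | zero => intro j hj; omega
  | succ k ih =>
    match l with
    | [] => simp [W] at h
    | [v] => simp [W] at h
    | v :: w :: l =>
      rw [W] at h
      intro j hj
      rcases Nat.lt_succ_iff_lt_or_eq.1 hj with hj | rfl
      · obtain ⟨a, ha, b, hb, hab⟩ := ih _ (right_ne_zero_of_mul h) j hj
        exact ⟨a, List.mem_cons_of_mem _ ha, b, List.mem_cons_of_mem _ hb, hab⟩
      · refine ⟨v, by simp, w, by simp, fun e => left_ne_zero_of_mul h ?_⟩
        rw [e]; exact CharTwo.add_self_eq_zero _

variable [Neg E]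

theorem W_anti (P : Set E) (hθ : ∀ k, ∀ v ∈ P, θ k (-v) = θ k v + 1) (k : ℕ) (l : List E)
    (hl : ∀ v ∈ l, v ∈ P) : W θ k (l.map (fun x => -x)) = W θ k l := by
  induction k generalizing l with
  | zero =>
    match l with
    | [] => rfl
    | [v] => rfl
    | v :: w :: l => rfl
  | succ k ih =>
    match l with
    | [] => rfl
    | [v] => rfl
    | v :: w :: l =>
      have := ih (w :: l) (fun v hv => hl v (List.mem_cons_of_mem _ hv))
      simp only [List.map_cons] at this
      simp only [List.map_cons, W]
      rw [this, hθ k v (hl v (by simp)), hθ k w (hl w (by simp))]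
      congr 1
      generalize θ k v = a
      generalize θ k w = b
      revert a b; decide

theorem al_anti (P : Set E) (hθ : ∀ k, ∀ v ∈ P, θ k (-v) = θ k v + 1) (k : ℕ) (l : List E)
    (hl : ∀ v ∈ l, v ∈ P) : al θ k l + al θ k (l.map (fun x => -x)) = W θ k l := by
  match l with
  | [] => simp [al, W_nil]
  | v :: l =>
    have := W_anti θ P hθ k _ hl
    simp only [List.map_cons] at this
    simp only [List.map_cons, al]
    rw [this, hθ k v (hl v (by simp))]
    generalize θ k v = a
    generalize W θ k (v :: l) = b
    revert a b; decide

theorem ev_al_anti (P : Set E) (hθ : ∀ k, ∀ v ∈ P, θ k (-v) = θ k v + 1) (k : ℕ) (c : Ch E)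
    (hc : c ∈ Finsupp.supported (ZMod 2) (ZMod 2) {l : List E | ∀ v ∈ l, v ∈ P}) :
    ev (al θ k) (c + anti c) = ev (W θ k) c := by
  rw [map_add]
  rw [Finsupp.supported_eq_span_single] at hc
  induction hc using Submodule.span_induction with
  | mem x h =>
    obtain ⟨l, hl, rfl⟩ := h
    rw [anti_single, ev_single, ev_single, ev_single, al_anti θ P hθ k l hl]
  | zero => simp
  | add x y _ _ hx hy => simp only [map_add]; rw [← hx, ← hy]; ring
  | smul a x _ hx => simp only [map_smul]; rw [← hx, smul_add]

end cochains

/-- The parity argument: an antipodal system of hemispheres has odd `W`. -/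
theorem parity [Neg E] (θ : ℕ → E → ZMod 2) (P : Set E)
    (hθ : ∀ k, ∀ v ∈ P, θ k (-v) = θ k v + 1) (H Z : ℕ → Ch E)
    (hZ0 : Z 0 = Finsupp.single [] 1) (hbd : ∀ k, bd (H k) = Z k)
    (hZ : ∀ k, Z (k + 1) = H k + anti (H k))
    (m : ℕ) (hP : ∀ k < m, H k ∈ Finsupp.supported (ZMod 2) (ZMod 2)
      {l : List E | ∀ v ∈ l, v ∈ P}) (k : ℕ) (hk : k ≤ m) :
    ev (W θ k) (H k) = 1 := by
  induction k with
  | zero =>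
    have h1 : ev (fun l : List E => if l.length = 0 then (1 : ZMod 2) else 0) ∘ₗ bd
        = ev (W θ 0) := by
      apply lin_ext
      intro l
      rw [LinearMap.comp_apply, bd_single, ev_single]
      match l with
      | [] => simp [bdL, W]
      | [v] => simp [bdL, W, ev_single]
      | v :: w :: l =>
        rw [bdL, map_add, ev_cone, ev_single]
        have h0 : ev (fun l : List E => if (v :: l).length = 0 then (1 : ZMod 2) else 0)
            = ev (fun l => 0 * 0) := by simp
        rw [h0, ev_mul]; simp [W]
    rw [← h1, LinearMap.comp_apply, hbd, hZ0, ev_single]; simp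
  | succ k ih =>
    rw [← al_bd, hbd, hZ, ev_al_anti θ P hθ k _ (hP k (by omega)), ih (by omega)]

theorem sup_map {α β : Type*} {s : Set α} {t : Set β}
    (f : (α →₀ ZMod 2) →ₗ[ZMod 2] (β →₀ ZMod 2))
    (h : ∀ a ∈ s, f (Finsupp.single a 1) ∈ Finsupp.supported (ZMod 2) (ZMod 2) t)
    (c : α →₀ ZMod 2) (hc : c ∈ Finsupp.supported (ZMod 2) (ZMod 2) s) :
    f c ∈ Finsupp.supported (ZMod 2) (ZMod 2) t := by
  rw [Finsupp.supported_eq_span_single] at hc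
  induction hc using Submodule.span_induction with
  | mem x h' => obtain ⟨l, hl, rfl⟩ := h'; exact h l hl
  | zero => simp
  | add x y _ _ hx hy => rw [map_add]; exact Submodule.add_mem _ hx hy
  | smul a x _ hx => rw [map_smul]; exact Submodule.smul_mem _ _ hx

theorem bdL_sup (l : List E) : bdL l ∈ Finsupp.supported (ZMod 2) (ZMod 2)
    {l' : List E | l'.length + 1 = l.length ∧ ∀ v ∈ l', v ∈ l} := by
  induction l with
  | nil => simp [bdL]
  | cons v l ih =>
    rw [bdL]
    refine Submodule.add_mem _ (Finsupp.single_mem_supported _ _ ?_) ?_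
    · exact ⟨rfl, fun w hw => List.mem_cons_of_mem _ hw⟩
    · refine sup_map (cone v) ?_ _ ih
      intro a ha
      rw [cone_single]
      refine Finsupp.single_mem_supported _ _ ⟨by simp [ha.1], ?_⟩
      intro w hw
      rcases List.mem_cons.1 hw with rfl | hw
      · simp
      · exact List.mem_cons_of_mem _ (ha.2 w hw)

section subdivision

variable [NormedAddCommGroup E] [NormedSpace ℝ E]

/-- Barycenter of a tuple. -/
noncomputable def bary (l : List E) : E := (l.length : ℝ)⁻¹ • l.sum

/-- Barycentric subdivision of tuples of length `k`. -/
noncomputable def sd : ℕ → (Ch E →ₗ[ZMod 2] Ch E)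
  | 0 => LinearMap.id
  | k + 1 => Finsupp.linearCombination (ZMod 2) (fun l => cone (bary l) (sd k (bdL l)))

theorem sd_single (k : ℕ) (l : List E) :
    sd (k + 1) (Finsupp.single l 1) = cone (bary l) (sd k (bdL l)) := by
  simp [sd]

theorem bd_sd (k : ℕ) (c : Ch E) : bd (sd (k + 1) c) = sd k (bd c) := by
  have : (bd ∘ₗ sd (k + 1) : Ch E →ₗ[ZMod 2] Ch E) = sd k ∘ₗ bd := by
    induction k with
    | zero =>
      apply lin_ext
      intro l
      simp only [LinearMap.comp_apply, sd_single, bd_cone, bd_single]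
      simp [sd, bd_bdL]
    | succ k ih =>
      apply lin_ext
      intro l
      simp only [LinearMap.comp_apply, sd_single k.succ, bd_cone, bd_single]
      have := LinearMap.congr_fun ih (bdL l)
      simp only [LinearMap.comp_apply, bd_bdL, map_zero] at this
      rw [this, map_zero, add_zero]
  exact LinearMap.congr_fun this c

theorem bary_neg (l : List E) : bary (l.map (fun x => -x)) = - bary l := by
  have : (l.map (fun x => -x)).sum = - l.sum := by
    induction l with
    | nil => simp
    | cons v l ih => rw [List.map_cons, List.sum_cons, ih, List.sum_cons, neg_add]
  rw [bary, bary, this]; simp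

theorem sd_anti (k : ℕ) (c : Ch E) : sd k (anti c) = anti (sd k c) := by
  have : (sd k ∘ₗ anti : Ch E →ₗ[ZMod 2] Ch E) = anti ∘ₗ sd k := by
    induction k with
    | zero => simp [sd]
    | succ k ih =>
      apply lin_ext
      intro l
      simp only [LinearMap.comp_apply, sd_single, anti_single, anti_cone, bary_neg]
      have := LinearMap.congr_fun ih (bdL l)
      simp only [LinearMap.comp_apply] at this
      rw [← this, ← bd_single, ← bd_single, anti_bd, anti_single]
  exact LinearMap.congr_fun this c

theorem bary_mem (l : List E) (hl : l ≠ []) : bary l ∈ convexHull ℝ {v | v ∈ l} := by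
  have h1 : bary l = ∑ i : Fin l.length, (l.length : ℝ)⁻¹ • l.get i := by
    rw [bary, ← Finset.smul_sum]
    congr 1
    simp
  rw [h1]
  have h0 : (l.length : ℝ) ≠ 0 := by
    simpa using hl
  apply (convex_convexHull ℝ _).sum_mem
  · intro i _; positivity
  · simp [h0]
  · intro i _
    exact subset_convexHull ℝ _ (List.get_mem l i)

theorem bary_dist (l : List E) (δ : ℝ) (hδ : ∀ v ∈ l, ∀ w ∈ l, ‖v - w‖ ≤ δ) (w : E) (hw : w ∈ l) :
    ‖w - bary l‖ ≤ (1 - (l.length : ℝ)⁻¹) * δ := by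
  classical
  have hl : l ≠ [] := List.ne_nil_of_mem hw
  have h0 : (0 : ℝ) < l.length := by
    have := List.length_pos_iff.2 hl
    exact_mod_cast this
  have key : ∀ l' : List E, (∀ v ∈ l', v ∈ l) →
      ‖(l'.length : ℝ) • w - l'.sum‖ ≤ l'.length * δ := by
    intro l' 
    induction l' with
    | nil => intro _; simp
    | cons v l' ih =>
      intro h
      have h2 := ih (fun v hv => h v (List.mem_cons_of_mem _ hv))
      have h3 := hδ w hw v (h v (by simp))
      have : ((v :: l').length : ℝ) • w - (v :: l').sum
          = (w - v) + ((l'.length : ℝ) • w - l'.sum) := by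
        simp only [List.length_cons, List.sum_cons, Nat.cast_add, Nat.cast_one, add_smul, one_smul]
        abel
      rw [this]
      refine (norm_add_le _ _).trans ?_
      simp only [List.length_cons, Nat.cast_add, Nat.cast_one]
      linarith
  have h4 := key (l.erase w) (fun v hv => List.mem_of_mem_erase hv)
  have hp := List.perm_cons_erase hw
  have h5 : l.length = (l.erase w).length + 1 := by simpa using hp.length_eq
  have h6 : l.sum = w + (l.erase w).sum := by simpa using hp.sum_eq
  have h7 : w - bary l = (l.length : ℝ)⁻¹ • (((l.erase w).length : ℝ) • w - (l.erase w).sum) := by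
    have h8 : (((l.erase w).length : ℝ)) = l.length - 1 := by rw [h5]; simp
    rw [h8, bary, h6, smul_sub, smul_add, sub_smul, one_smul, smul_sub, smul_smul,
      inv_mul_cancel₀ h0.ne', one_smul]
    abel
  rw [h7, norm_smul, Real.norm_of_nonneg (by positivity)]
  have h8 : (((l.erase w).length : ℝ)) = l.length - 1 := by rw [h5]; simp
  rw [h8] at h4
  calc _ ≤ (l.length : ℝ)⁻¹ * ((l.length - 1) * δ) := by
        rw [h8]; gcongr
    _ = _ := by field_simp

theorem sd_sup (M : ℕ) (k : ℕ) (hk : k ≤ M) (l : List E) (hlk : l.length = k) (δ : ℝ) (h0 : 0 ≤ δ)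
    (hδ : ∀ v ∈ l, ∀ w ∈ l, ‖v - w‖ ≤ δ) :
    sd k (Finsupp.single l 1) ∈ Finsupp.supported (ZMod 2) (ZMod 2)
      {l' : List E | l'.length = k ∧ (∀ v ∈ l', v ∈ convexHull ℝ {v | v ∈ l}) ∧
        ∀ v ∈ l', ∀ w ∈ l', ‖v - w‖ ≤ (1 - (M : ℝ)⁻¹) * δ} := by
  induction k generalizing l with
  | zero =>
    have : l = [] := by simpa using hlk
    subst this
    exact Finsupp.single_mem_supported _ _ (by simp)
  | succ k ih =>
    have hl : l ≠ [] := by rintro rfl; simp at hlk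
    rw [sd_single]
    refine sup_map (s := {l' : List E | l'.length = k ∧ (∀ v ∈ l', v ∈ convexHull ℝ {v | v ∈ l}) ∧
        ∀ v ∈ l', ∀ w ∈ l', ‖v - w‖ ≤ (1 - (M : ℝ)⁻¹) * δ}) _ ?_ _ ?_
    · rintro a ⟨ha1, ha2, ha3⟩
      rw [cone_single]
      have hM1 : (0 : ℝ) < l.length := by rw [hlk]; positivity
      have hM2 : (l.length : ℝ) ≤ M := by rw [hlk]; exact_mod_cast hk
      have hM : (1 - (l.length : ℝ)⁻¹) * δ ≤ (1 - (M : ℝ)⁻¹) * δ := by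
        gcongr
      have hM0 : (0 : ℝ) ≤ (1 - (M : ℝ)⁻¹) * δ := by
        apply mul_nonneg _ h0
        have : (M : ℝ)⁻¹ ≤ 1 := inv_le_one_of_one_le₀ (by
          have : 1 ≤ M := by omega
          exact_mod_cast this)
        linarith
      have hb : ∀ v ∈ convexHull ℝ {v | v ∈ l}, ‖v - bary l‖ ≤ (1 - (M : ℝ)⁻¹) * δ := by
        intro v hv
        have : convexHull ℝ {v | v ∈ l} ⊆ Metric.closedBall (bary l) ((1 - (M : ℝ)⁻¹) * δ) := by
          apply convexHull_min _ (convex_closedBall _ _)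
          intro w hw
          rw [mem_closedBall_iff_norm]
          exact (bary_dist l δ hδ w hw).trans hM
        have := this hv
        rwa [mem_closedBall_iff_norm] at this
      refine Finsupp.single_mem_supported _ _ ⟨by simp [ha1], ?_, ?_⟩
      · intro v hv
        rcases List.mem_cons.1 hv with rfl | hv
        · exact bary_mem l hl
        · exact ha2 v hv
      · intro v hv w hw
        rcases List.mem_cons.1 hv with rfl | hv <;> rcases List.mem_cons.1 hw with rfl | hw
        · simpa using hM0
        · rw [norm_sub_rev]; exact hb w (ha2 w hw)
        · exact hb v (ha2 v hv)
        · exact ha3 v hv w hw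
    · refine sup_map (sd k) ?_ _ (bdL_sup l)
      rintro a ⟨ha1, ha2⟩
      refine Finsupp.supported_mono ?_
        (ih (by omega) a (by omega) (fun v hv w hw => hδ v (ha2 v hv) w (ha2 w hw)))
      rintro l' ⟨h1, h2, h3⟩
      exact ⟨h1, fun v hv => convexHull_mono (fun w hw => ha2 w hw) (h2 v hv), h3⟩

theorem sd_iter_sup (𝒦 : Set (Set E)) (h𝒦 : ∀ K ∈ 𝒦, Convex ℝ K) (M k : ℕ) (hM : 1 ≤ M)
    (hk : k ≤ M) (δ : ℝ) (h0 : 0 ≤ δ) (c : Ch E)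
    (hc : c ∈ Finsupp.supported (ZMod 2) (ZMod 2)
      {l : List E | l.length = k ∧ (∃ K ∈ 𝒦, ∀ v ∈ l, v ∈ K) ∧ ∀ v ∈ l, ∀ w ∈ l, ‖v - w‖ ≤ δ})
    (m : ℕ) :
    (sd k)^[m] c ∈ Finsupp.supported (ZMod 2) (ZMod 2)
      {l : List E | l.length = k ∧ (∃ K ∈ 𝒦, ∀ v ∈ l, v ∈ K) ∧
        ∀ v ∈ l, ∀ w ∈ l, ‖v - w‖ ≤ (1 - (M : ℝ)⁻¹) ^ m * δ} := by
  have hM0 : (0 : ℝ) ≤ (1 - (M : ℝ)⁻¹) := by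
    have : (M : ℝ)⁻¹ ≤ 1 := inv_le_one_of_one_le₀ (by exact_mod_cast hM)
    linarith
  induction m with
  | zero => simpa using hc
  | succ m ih =>
    rw [Function.iterate_succ_apply']
    refine sup_map (sd k) ?_ _ ih
    rintro a ⟨ha1, ⟨K, hK, ha2⟩, ha3⟩
    refine Finsupp.supported_mono ?_
      (sd_sup M k hk a ha1 ((1 - (M : ℝ)⁻¹) ^ m * δ) (by positivity) ha3)
    rintro l' ⟨h1, h2, h3⟩
    refine ⟨h1, ⟨K, hK, fun v hv => convexHull_min ha2 (h𝒦 K hK) (h2 v hv)⟩, ?_⟩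
    rw [pow_succ', mul_assoc]; exact h3

end subdivision

section octahedron

variable (n : ℕ)

/-- The coordinate vectors. -/
noncomputable def e (k : ℕ) : Fin (n + 1) → ℝ := Pi.single (Fin.ofNat (n + 1) k) 1

/-- The coarse spheres. -/
noncomputable def z : ℕ → Ch (Fin (n + 1) → ℝ)
  | 0 => Finsupp.single [] 1
  | k + 1 => cone (e n k) (z k) + anti (cone (e n k) (z k))

theorem anti_anti {E : Type*} [AddCommGroup E] (c : Ch E) : anti (anti c) = c := by
  have : (anti ∘ₗ anti : Ch E →ₗ[ZMod 2] Ch E) = LinearMap.id := by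
    apply lin_ext
    intro l
    simp [anti_single]
  exact LinearMap.congr_fun this c

theorem bd_z (k : ℕ) : bd (z n k) = 0 := by
  induction k with
  | zero => simp [z, bd_single, bdL]
  | succ k ih =>
    rw [z, map_add, ← anti_bd, bd_cone, ih, map_zero, add_zero]
    cases k with
    | zero => simp only [z, anti_single, List.map_nil]; exact two_zero _
    | succ k => 
      rw [z, map_add, anti_anti, add_comm (anti _), two_zero]

theorem bd_h (k : ℕ) : bd (cone (e n k) (z n k)) = z n k := by
  rw [bd_cone, bd_z, map_zero, add_zero]

/-- Tuples of signed coordinate vectors. -/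
def QQ (k : ℕ) : Set (List (Fin (n + 1) → ℝ)) :=
  {l | l.length = k ∧ ∃ s : Fin (n + 1) → ℝ, (∀ i, |s i| = 1) ∧
    ∀ v ∈ l, ∃ i : Fin (n + 1), i.val < k ∧ v = Pi.single i (s i)}

theorem h_sup_aux (k : ℕ) (hk : k ≤ n)
    (h : z n k ∈ Finsupp.supported (ZMod 2) (ZMod 2) (QQ n k)) :
    cone (e n k) (z n k) ∈ Finsupp.supported (ZMod 2) (ZMod 2) (QQ n (k + 1)) := by
  refine sup_map _ ?_ _ h
  rintro l ⟨h1, s, hs, h2⟩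
  rw [cone_single]
  refine Finsupp.single_mem_supported _ _ ⟨by simp [h1],
    Function.update s ⟨k, by omega⟩ 1, ?_, ?_⟩
  · intro i
    by_cases hi : i = ⟨k, by omega⟩
    · subst hi; simp
    · rw [Function.update_of_ne hi]; exact hs i
  · intro v hv
    rcases List.mem_cons.1 hv with rfl | hv
    · refine ⟨⟨k, by omega⟩, by simp, ?_⟩
      rw [Function.update_self, e]
      congr 1
      ext
      simp; omega
    · obtain ⟨i, hi, rfl⟩ := h2 v hv
      refine ⟨i, by omega, ?_⟩
      rw [Function.update_of_ne]
      rintro rfl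
      simp at hi

theorem z_sup (k : ℕ) (hk : k ≤ n + 1) :
    z n k ∈ Finsupp.supported (ZMod 2) (ZMod 2) (QQ n k) := by
  induction k with
  | zero =>
    exact Finsupp.single_mem_supported _ _ ⟨rfl, fun _ => 1, by simp, by simp⟩
  | succ k ih =>
    have h := h_sup_aux n k (by omega) (ih (by omega))
    rw [z]
    refine Submodule.add_mem _ h ?_
    refine sup_map _ ?_ _ h
    rintro l ⟨h1, s, hs, h2⟩
    rw [anti_single]
    refine Finsupp.single_mem_supported _ _ ⟨by simp [h1], fun i => - s i, by simpa using hs, ?_⟩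
    intro v hv
    obtain ⟨w, hw, rfl⟩ := List.mem_map.1 hv
    obtain ⟨i, hi, rfl⟩ := h2 w hw
    exact ⟨i, hi, by rw [Pi.single_neg]⟩

/-- The `ℓ¹` sphere. -/
def Sph : Set (Fin (n + 1) → ℝ) := {x | ∑ i, |x i| = 1}

/-- A facet of the cross-polytope. -/
def Kset (s : Fin (n + 1) → ℝ) : Set (Fin (n + 1) → ℝ) :=
  {v | (∀ i, 0 ≤ s i * v i) ∧ ∑ i, s i * v i = 1}

theorem Kset_convex (s : Fin (n + 1) → ℝ) : Convex ℝ (Kset n s) := by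
  rintro x ⟨hx1, hx2⟩ y ⟨hy1, hy2⟩ a b ha hb hab
  refine ⟨fun i => ?_, ?_⟩
  · have h1 := mul_nonneg ha (hx1 i)
    have h2 := mul_nonneg hb (hy1 i)
    simp only [Pi.add_apply, Pi.smul_apply, smul_eq_mul]
    linarith
  · have : ∀ i, s i * (a • x + b • y) i = a * (s i * x i) + b * (s i * y i) := by
      intro i; simp only [Pi.add_apply, Pi.smul_apply, smul_eq_mul]; ring
    simp only [this, Finset.sum_add_distrib, ← Finset.mul_sum, hx2, hy2]
    linarith

theorem Kset_sub (s : Fin (n + 1) → ℝ) (hs : ∀ i, |s i| = 1) : Kset n s ⊆ Sph n := by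
  rintro x ⟨hx1, hx2⟩
  rw [Sph, Set.mem_ofPred_eq, ← hx2]
  refine Finset.sum_congr rfl fun i _ => ?_
  rw [← abs_of_nonneg (hx1 i), abs_mul, hs, one_mul]

theorem Sph_norm (x : Fin (n + 1) → ℝ) (hx : x ∈ Sph n) : ‖x‖ ≤ 1 := by
  rw [pi_norm_le_iff_of_nonneg zero_le_one]
  intro i
  rw [Real.norm_eq_abs]
  have hx' : ∑ i, |x i| = 1 := hx
  rw [← hx']
  exact Finset.single_le_sum (f := fun i => |x i|) (fun i _ => abs_nonneg _) (Finset.mem_univ i)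

theorem Sph_compact : IsCompact (Sph n) := by
  refine (isCompact_closedBall (0 : Fin (n + 1) → ℝ) 1).of_isClosed_subset ?_ ?_
  · exact isClosed_eq (by fun_prop) continuous_const
  · intro x hx
    simpa using Sph_norm n x hx

theorem Sph_ne (x : Fin (n + 1) → ℝ) (hx : x ∈ Sph n) : x ≠ 0 := by
  rintro rfl
  simp [Sph] at hx

theorem Sph_neg (x : Fin (n + 1) → ℝ) (hx : x ∈ Sph n) : -x ∈ Sph n := by
  simpa [Sph] using hx

open Classical in
/-- Sign cochain with tie-breaking. -/
noncomputable def sg (g : (Fin (n + 1) → ℝ) → ℝ) (v : Fin (n + 1) → ℝ) : ZMod 2 :=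
  if 0 < g v ∨ (g v = 0 ∧ 0 < toLex v) then 1 else 0

theorem sg_neg (g : (Fin (n + 1) → ℝ) → ℝ) (hg : ∀ v ∈ Sph n, g (-v) = - g v)
    (v : Fin (n + 1) → ℝ) (hv : v ∈ Sph n) : sg n g (-v) = sg n g v + 1 := by
  have h0 : toLex v ≠ 0 := fun h => Sph_ne n v hv h
  have h1 : (0 < g (-v) ∨ (g (-v) = 0 ∧ 0 < toLex (-v))) ↔
      ¬ (0 < g v ∨ (g v = 0 ∧ 0 < toLex v)) := by
    rw [hg v hv, toLex_neg, Left.neg_pos_iff, Left.neg_pos_iff, neg_eq_zero]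
    rcases lt_trichotomy (g v) 0 with h | h | h
    · simp [h, h.ne, h.le]
    · rw [h]
      rcases lt_or_gt_of_ne h0 with h2 | h2
      · simp only [lt_self_iff_false, true_and, false_or]
        exact iff_of_true h2 (lt_asymm h2)
      · simp only [lt_self_iff_false, true_and, false_or]
        exact iff_of_false (lt_asymm h2) (not_not.2 h2)
    · simp [h, h.ne', h.le]
  unfold sg
  by_cases h : (0 < g v ∨ (g v = 0 ∧ 0 < toLex v))
  · rw [if_neg (by rw [h1]; exact not_not.2 h), if_pos h]; decide
  · rw [if_pos (h1.2 h), if_neg h]; decide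

theorem sg_ne (g : (Fin (n + 1) → ℝ) → ℝ) (v w : Fin (n + 1) → ℝ) (h : sg n g v ≠ sg n g w) :
    |g v| ≤ |g v - g w| := by
  have h2 : (0 ≤ g v ∧ g w ≤ 0) ∨ (g v ≤ 0 ∧ 0 ≤ g w) := by
    by_contra hcon
    push Not at hcon
    apply h
    unfold sg
    rcases lt_trichotomy (g v) 0 with h1 | h1 | h1
    · have h3 := hcon.2 h1.le
      simp [h1.le.not_gt, h1.ne, h3.le.not_gt, h3.ne]
    · have h3 := hcon.1 h1.ge
      have h4 := hcon.2 h1.le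
      linarith
    · have h3 := hcon.1 h1.le
      simp [h1, h3]
  rcases h2 with ⟨h3, h4⟩ | ⟨h3, h4⟩
  · rw [abs_of_nonneg h3, abs_of_nonneg (by linarith)]; linarith
  · rw [abs_of_nonpos h3, abs_of_nonpos (by linarith)]; linarith

/-- Borsuk-Ulam, approximate form. -/
theorem bu_approx (g : (Fin (n + 1) → ℝ) → (Fin n → ℝ)) (hc : ContinuousOn g (Sph n))
    (hodd : ∀ x ∈ Sph n, g (-x) = - g x) (ε : ℝ) (hε : 0 < ε) :
    ∃ x ∈ Sph n, ‖g x‖ ≤ ε := by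
  have huc := (Sph_compact n).uniformContinuousOn_of_continuous hc
  rw [Metric.uniformContinuousOn_iff] at huc
  obtain ⟨δ, hδ, huc⟩ := huc (ε / 2) (by positivity)
  obtain ⟨m, hm⟩ : ∃ m : ℕ, (1 - ((n + 1 : ℕ) : ℝ)⁻¹) ^ m < δ / 2 := by
    apply exists_pow_lt_of_lt_one (by positivity)
    have : (0 : ℝ) < ((n + 1 : ℕ) : ℝ)⁻¹ := by positivity
    linarith
  let G : ℕ → (Fin (n + 1) → ℝ) → ℝ := fun j x => if h : j < n then g x ⟨j, h⟩ else 0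
  have hG : ∀ j, ∀ x ∈ Sph n, G j (-x) = - G j x := by
    intro j x hx
    simp only [G]
    split_ifs
    · rw [hodd x hx]; rfl
    · simp
  let 𝒦 : Set (Set (Fin (n + 1) → ℝ)) := {K | ∃ s, (∀ i, |s i| = 1) ∧ K = Kset n s}
  let H : ℕ → Ch (Fin (n + 1) → ℝ) := fun k => (sd (k + 1))^[m] (cone (e n k) (z n k))
  let Z : ℕ → Ch (Fin (n + 1) → ℝ) := fun k => (sd k)^[m] (z n k)
  have hH : ∀ k ≤ n, H k ∈ Finsupp.supported (ZMod 2) (ZMod 2)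
      {l : List (Fin (n + 1) → ℝ) | l.length = k + 1 ∧ (∃ K ∈ 𝒦, ∀ v ∈ l, v ∈ K) ∧
        ∀ v ∈ l, ∀ w ∈ l, ‖v - w‖ ≤ (1 - ((n + 1 : ℕ) : ℝ)⁻¹) ^ m * 2} := by
    intro k hk
    refine sd_iter_sup 𝒦 ?_ (n + 1) (k + 1) (by omega) (by omega) 2 (by norm_num) _ ?_ m
    · rintro _ ⟨s, _, rfl⟩; exact Kset_convex n s
    · refine Finsupp.supported_mono ?_ (h_sup_aux n k hk (z_sup n k (by omega)))
      rintro l ⟨h1, s, hs, h2⟩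
      have h3 : ∀ v ∈ l, v ∈ Kset n s := by
        intro v hv
        obtain ⟨i, -, rfl⟩ := h2 v hv
        have hss : ∀ j, s j * (Pi.single i (s i) : Fin (n + 1) → ℝ) j = if j = i then 1 else 0 := by
          intro j
          by_cases hj : j = i
          · subst hj; simp [← abs_mul_abs_self (s j), hs]
          · simp [hj]
        refine ⟨fun j => ?_, ?_⟩
        · rw [hss]; split_ifs <;> norm_num
        · simp [hss]
      refine ⟨h1, ⟨_, ⟨s, hs, rfl⟩, h3⟩, ?_⟩
      intro v hv w hw
      have h4 := Sph_norm n v (Kset_sub n s hs (h3 v hv))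
      have h5 := Sph_norm n w (Kset_sub n s hs (h3 w hw))
      have := norm_sub_le v w
      linarith
  have hpar := parity (fun j => sg n (G j)) (Sph n) (fun k v hv => sg_neg n (G k) (hG k) v hv) H Z
    (by
      simp only [Z, sd, z]
      have : (⇑(LinearMap.id : Ch (Fin (n + 1) → ℝ) →ₗ[ZMod 2] Ch (Fin (n + 1) → ℝ))) = id := rfl
      rw [this, Function.iterate_id]; rfl)
    (by
      intro k
      simp only [H, Z]
      have hs : Function.Semiconj (bd : Ch (Fin (n + 1) → ℝ) →ₗ[ZMod 2] Ch (Fin (n + 1) → ℝ))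
        (sd (k + 1)) (sd k) := fun c => bd_sd k c
      rw [(hs.iterate_right m).eq, bd_h])
    (by
      intro k
      simp only [H, Z]
      have hs : Function.Semiconj (anti : Ch (Fin (n + 1) → ℝ) →ₗ[ZMod 2] Ch (Fin (n + 1) → ℝ))
        (sd (k + 1)) (sd (k + 1)) := fun c => (sd_anti (k + 1) c).symm
      rw [(hs.iterate_right m).eq, z, iterate_map_add])
    n
    (by
      intro k hk
      refine Finsupp.supported_mono ?_ (hH k hk.le)
      rintro l ⟨_, ⟨_, ⟨s, hs, rfl⟩, h⟩, _⟩ v hv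
      exact Kset_sub n s hs (h v hv))
    n le_rfl
  have hex : ∃ l ∈ (H n).support, W (fun j => sg n (G j)) n l ≠ 0 := by
    by_contra hcon
    push Not at hcon
    rw [ev, Finsupp.linearCombination_apply, Finsupp.sum, Finset.sum_eq_zero] at hpar
    · exact zero_ne_one hpar
    · intro l hl
      rw [hcon l hl, smul_zero]
  obtain ⟨l, hl, hW⟩ := hex
  obtain ⟨hlen, ⟨_, ⟨s, hs, rfl⟩, hK⟩, hsm⟩ := (Finsupp.mem_supported _ _).1 (hH n le_rfl) hl
  have hS : ∀ v ∈ l, v ∈ Sph n := fun v hv => Kset_sub n s hs (hK v hv)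
  have hd : ∀ v ∈ l, ∀ w ∈ l, ∀ j, |g v j - g w j| ≤ ε / 2 := by
    intro v hv w hw j
    have h1 := huc v (hS v hv) w (hS w hw) (by
      rw [dist_eq_norm]
      have := hsm v hv w hw
      linarith)
    have h2 := dist_le_pi_dist (g v) (g w) j
    rw [Real.dist_eq] at h2
    linarith
  obtain ⟨x, hx⟩ : ∃ x, x ∈ l := List.exists_mem_of_length_pos (by omega)
  refine ⟨x, hS x hx, ?_⟩
  rw [pi_norm_le_iff_of_nonneg hε.le]
  intro j
  obtain ⟨v, hv, w, hw, hvw⟩ := W_ne _ n l hW j j.2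
  have h1 := sg_ne n _ v w hvw
  simp only [G, j.2, dite_true] at h1
  have h2 := hd v hv w hw j
  have h3 := hd x hx v hv j
  have h4 := abs_add_le (g x j - g v j) (g v j)
  rw [Real.norm_eq_abs]
  simp only [sub_add_cancel] at h4
  simp only [Fin.eta] at h1
  linarith

/-- Borsuk-Ulam. -/
theorem borsuk_ulam (g : (Fin (n + 1) → ℝ) → (Fin n → ℝ)) (hc : ContinuousOn g (Sph n))
    (hodd : ∀ x ∈ Sph n, g (-x) = - g x) : ∃ x ∈ Sph n, g x = 0 := by
  obtain ⟨x0, hx0, -⟩ := bu_approx n g hc hodd 1 one_pos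
  obtain ⟨x, hx, hmin⟩ := (Sph_compact n).exists_isMinOn ⟨x0, hx0⟩ hc.norm
  refine ⟨x, hx, ?_⟩
  by_contra h
  have hpos : 0 < ‖g x‖ := norm_pos_iff.2 h
  obtain ⟨y, hy, hy2⟩ := bu_approx n g hc hodd (‖g x‖ / 2) (by positivity)
  have : ‖g x‖ ≤ ‖g y‖ := hmin hy
  linarith

end octahedron

end BU

open Classical in
/-- The colour function: positive iff the support contains a non-face of colour `j`. -/
noncomputable def colFun {N n : ℕ} (S : Set (Set (Fin N))) (c : Set (Fin N) → Fin n) (j : Fin n)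
    (y : Fin N → ℝ) : ℝ :=
  ∑ σ : Set (Fin N), if σ ∉ S ∧ c σ = j then ∏ i, (if i ∈ σ then y i else 1) else 0

theorem colFun_cont {N n : ℕ} (S : Set (Set (Fin N))) (c : Set (Fin N) → Fin n) (j : Fin n) :
    Continuous (colFun S c j) := by
  classical
  unfold colFun
  refine continuous_finsetSum _ fun σ _ => ?_
  split_ifs
  · refine continuous_finsetProd _ fun i _ => ?_
    split_ifs <;> fun_prop
  · exact continuous_const

theorem colFun_pos {N n : ℕ} (S : Set (Set (Fin N))) (c : Set (Fin N) → Fin n) (j : Fin n)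
    (y : Fin N → ℝ) (hy : ∀ i, 0 ≤ y i) (σ : Set (Fin N)) (hσ : σ ∉ S) (hc : c σ = j)
    (hs : ∀ i ∈ σ, y i ≠ 0) : 0 < colFun S c j y := by
  classical
  unfold colFun
  apply Finset.sum_pos'
  · intro τ _
    split_ifs
    · refine Finset.prod_nonneg fun i _ => ?_
      split_ifs
      · exact hy i
      · norm_num
    · exact le_rfl
  · refine ⟨σ, Finset.mem_univ _, ?_⟩
    rw [if_pos ⟨hσ, hc⟩]
    refine Finset.prod_pos fun i _ => ?_
    split_ifs with h
    · exact lt_of_le_of_ne (hy i) (hs i h).symm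
    · norm_num

theorem colFun_ne {N n : ℕ} (S : Set (Set (Fin N))) (c : Set (Fin N) → Fin n) (j : Fin n)
    (y : Fin N → ℝ) (h : colFun S c j y ≠ 0) : ∃ σ ∉ S, c σ = j ∧ ∀ i ∈ σ, y i ≠ 0 := by
  classical
  obtain ⟨σ, -, hσ⟩ := Finset.exists_ne_zero_of_sum_ne_zero h
  split_ifs at hσ with h1
  · refine ⟨σ, h1.1, h1.2, fun i hi => ?_⟩
    have := Finset.prod_ne_zero_iff.1 hσ i (Finset.mem_univ i)
    rwa [if_pos hi] at this
  · exact absurd rfl hσ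

theorem realization_closed (N : ℕ) (S : Set (Set (Fin N)))
    (hdown : ∀ σ ∈ S, ∀ τ ⊆ σ, τ ∈ S) : IsClosed (realization N S) := by
  have h : realization N S = stdSimplex ℝ (Fin N) ∩
      ⋂ σ : Set (Fin N), ⋂ _ : σ ∉ S, ⋃ i : Fin N, ⋃ _ : i ∈ σ, {x | x i = 0} := by
    ext x
    simp only [realization, Set.mem_inter_iff, Set.mem_iInter, Set.mem_iUnion, Set.mem_ofPred_eq]
    refine and_congr_right fun _ => ⟨?_, ?_⟩
    · intro hx σ hσ
      by_contra hcon
      push Not at hcon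
      exact hσ (hdown _ hx σ fun i hi => hcon i hi)
    · intro hx
      by_contra hcon
      obtain ⟨i, hi, h0⟩ := hx _ hcon
      exact hi h0
  rw [h]
  refine (isClosed_stdSimplex ℝ (Fin N)).inter ?_
  refine isClosed_iInter fun σ => isClosed_iInter fun _ => ?_
  refine isClosed_iUnion_of_finite fun i => isClosed_iUnion_of_finite fun _ => ?_
  exact isClosed_eq (continuous_apply i) continuous_const

/-- **Sarkaria's theorem.** Let `Σ` be a simplicial complex on `[d+n+2]` such that the
family of non-faces can be partitioned into `n` pairwise intersecting families. Then any
continuous map `f : |Σ| → ℝ^d` identifies points of two disjoint faces of `Σ`. -/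
theorem sarkaria (d n N : ℕ) (hd : 1 ≤ d) (hn : 1 ≤ n) (hN : N = d + n + 2)
    (S : Set (Set (Fin N)))
    (hdown : ∀ σ ∈ S, ∀ τ ⊆ σ, τ ∈ S)
    (hpart : ∃ c : Set (Fin N) → Fin n,
      ∀ σ τ : Set (Fin N), σ ∉ S → τ ∉ S → c σ = c τ → (σ ∩ τ).Nonempty)
    (f : (Fin N → ℝ) → EuclideanSpace ℝ (Fin d))
    (hf : ContinuousOn f (realization N S)) :
    ∃ σ ∈ S, ∃ τ ∈ S, Disjoint σ τ ∧
      ∃ x ∈ simplexFaceSet N σ ∩ realization N S,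
        ∃ y ∈ simplexFaceSet N τ ∩ realization N S, f x = f y := by
  subst hN
  obtain ⟨c, hc⟩ := hpart
  obtain ⟨F, hF⟩ := ContinuousMap.exists_restrict_eq (realization_closed _ S hdown)
    ⟨(realization (d + n + 2) S).domRestrict f, hf.domRestrict⟩
  have hF' : ∀ x ∈ realization (d + n + 2) S, F x = f x := fun x hx =>
    congrArg (fun g => g ⟨x, hx⟩) hF
  -- positive and negative parts, doubled
  let p : (Fin (d + n + 2) → ℝ) → (Fin (d + n + 2) → ℝ) := fun x i => 2 * max (x i) 0
  have hp : Continuous p := by fun_prop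
  have hp0 : ∀ x i, 0 ≤ p x i := fun x i => by positivity
  let A : (Fin (d + n + 2) → ℝ) → (Unit ⊕ Fin n ⊕ Fin d) → ℝ := fun x =>
    Sum.elim (fun _ => ∑ i, x i) (Sum.elim (fun j => colFun S c j (p x) - colFun S c j (p (-x)))
      (fun k => F (p x) k - F (p (-x)) k))
  have hA : Continuous A := by
    refine continuous_pi fun t => ?_
    rcases t with _ | j | k
    · simp only [A, Sum.elim_inl]; fun_prop
    · simp only [A, Sum.elim_inl, Sum.elim_inr]
      exact ((colFun_cont S c j).comp hp).sub ((colFun_cont S c j).comp (hp.comp continuous_neg))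
    · simp only [A, Sum.elim_inr]
      fun_prop
  have hAodd : ∀ x, A (-x) = - A x := by
    intro x
    ext t
    rcases t with _ | j | k
    · simp [A]
    · simp [A]
    · simp [A]
  let eqv : Fin (d + n + 1) ≃ (Unit ⊕ Fin n ⊕ Fin d) :=
    (Fintype.equivFinOfCardEq (by simp; omega)).symm
  obtain ⟨x, hx, hx0⟩ := BU.borsuk_ulam (d + n + 1) (fun x i => A x (eqv i))
    (by refine Continuous.continuousOn ?_; fun_prop)
    (fun x _ => by ext i; simp only [hAodd]; rfl)
  have hz : ∀ t, A x t = 0 := fun t => by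
    have := congrFun hx0 (eqv.symm t)
    simpa using this
  have hx1 : ∑ i, |x i| = 1 := hx
  have hx2 : ∑ i, x i = 0 := hz (Sum.inl ())
  have hcol : ∀ j, colFun S c j (p x) = colFun S c j (p (-x)) := fun j =>
    sub_eq_zero.1 (hz (Sum.inr (Sum.inl j)))
  have hFF : F (p x) = F (p (-x)) := by
    ext k
    exact sub_eq_zero.1 (hz (Sum.inr (Sum.inr k)))
  have hdisj : ∀ i, p x i ≠ 0 → p (-x) i ≠ 0 → False := by
    intro i h1 h2
    rcases le_total (x i) 0 with h | h
    · exact h1 (by simp [p, h])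
    · exact h2 (by simp [p, h])
  have hcol0 : ∀ j, colFun S c j (p x) = 0 := by
    intro j
    by_contra h
    obtain ⟨σ, hσ, hσj, h1⟩ := colFun_ne S c j _ h
    obtain ⟨τ, hτ, hτj, h2⟩ := colFun_ne S c j _ ((hcol j) ▸ h)
    obtain ⟨i, hi1, hi2⟩ := hc σ τ hσ hτ (hσj.trans hτj.symm)
    exact hdisj i (h1 i hi1) (h2 i hi2)
  have hsupp : ∀ y, (∀ i, 0 ≤ y i) → (∀ j, colFun S c j y = 0) → {i | y i ≠ 0} ∈ S := by
    intro y hy h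
    by_contra hcon
    have := colFun_pos S c _ y hy _ hcon rfl (fun i hi => hi)
    rw [h] at this
    exact lt_irrefl _ this
  have hS1 := hsupp (p x) (hp0 x) hcol0
  have hS2 := hsupp (p (-x)) (hp0 (-x)) (fun j => (hcol j) ▸ hcol0 j)
  have hsum1 : ∑ i, p x i = 1 := by
    have : ∀ i, p x i = |x i| + x i := by
      intro i
      rcases le_total (x i) 0 with h | h
      · simp [p, h, abs_of_nonpos h]
      · simp [p, h, abs_of_nonneg h]; ring
    simp only [this, Finset.sum_add_distrib, hx1, hx2, add_zero]
  have hsum2 : ∑ i, p (-x) i = 1 := by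
    have : ∀ i, p (-x) i = |x i| - x i := by
      intro i
      rcases le_total (x i) 0 with h | h
      · simp [p, h, abs_of_nonpos h]; ring
      · simp [p, h, abs_of_nonneg h]
    simp only [this, Finset.sum_sub_distrib, hx1, hx2, sub_zero]
  have hr1 : p x ∈ realization (d + n + 2) S := ⟨⟨hp0 x, hsum1⟩, hS1⟩
  have hr2 : p (-x) ∈ realization (d + n + 2) S := ⟨⟨hp0 (-x), hsum2⟩, hS2⟩
  refine ⟨_, hS1, _, hS2, ?_, p x, ⟨⟨hr1.1, ?_⟩, hr1⟩, p (-x), ⟨⟨hr2.1, ?_⟩, hr2⟩, ?_⟩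
  · rw [Set.disjoint_left]
    intro i h1 h2
    exact hdisj i h1 h2
  · intro i hi
    by_contra h
    exact hi h
  · intro i hi
    by_contra h
    exact hi h
  · rw [← hF' _ hr1, ← hF' _ hr2, hFF]
end

section
/- Let m ≥ 1, k ≥ 1, and d ≥ 1 be integers, write m = 2^p + q with p ≥ 0 and 0 ≤ q < 2^p, and set U(m,k) = 2^{k+p−1} + q. Suppose n ≥ d + U(m,k) + 1. If F is a family of nonempty subsets of [n+1] with χ(KG^{2^k}(F)) ≤ m, then for any continuous map f : Δ_n → ℝ^d there exist k Radon pairs (σ_1⁺, σ_1⁻), …, (σ_k⁺, σ_k⁻) for f such that for every choice of signs ε ∈ {+,−}^k the intersection σ_1^{ε_1} ∩ ⋯ ∩ σ_k^{ε_k} contains no set from F. -/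
/-- The face `Δ_σ` of the standard simplex spanned by the vertices in `σ`. -/
def simplexFace {n : ℕ} (σ : Finset (Fin n)) : Set (Fin n → ℝ) :=
  {x | x ∈ stdSimplex ℝ (Fin n) ∧ ∀ i, i ∉ σ → x i = 0}

/-- `(σp, σm)` is a Radon pair for `f`: the faces are disjoint and their images intersect. -/
def IsRadonPair {n d : ℕ} (f : (Fin n → ℝ) → EuclideanSpace ℝ (Fin d))
    (σp σm : Finset (Fin n)) : Prop :=
  Disjoint σp σm ∧ (f '' simplexFace σp ∩ f '' simplexFace σm).Nonempty

/-- `χ(KG^r(F)) ≤ m`: `F` can be colored with `m` colors so that no color class contains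
`r` pairwise disjoint members. -/
def KneserChromaticLe {n : ℕ} (F : Finset (Finset (Fin n))) (r m : ℕ) : Prop :=
  ∃ c : Finset (Fin n) → Fin m, ∀ G ⊆ F,
    (∀ A ∈ G, ∀ B ∈ G, A ≠ B → Disjoint A B) →
    (∀ A ∈ G, ∀ B ∈ G, c A = c B) → G.card < r



/-! ### Section 1: the Dickson polynomial and its Moore determinant -/
namespace KRP
open MvPolynomial

/-- product of all nonempty subset sums -/
noncomputable def PP {A : Type*} [CommRing A] {k : ℕ} (v : Fin k → A) : A :=
  ∏ s : Finset (Fin k), if s = ∅ then 1 else ∑ j ∈ s, v j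

noncomputable def Mo {A : Type*} [CommRing A] {k : ℕ} (v : Fin k → A) : Matrix (Fin k) (Fin k) A :=
  Matrix.of fun i j => v j ^ (2 ^ (i : ℕ))

lemma prod_finset_succ {A : Type*} [CommMonoid A] {k : ℕ} (g : Finset (Fin (k+1)) → A) :
    ∏ s : Finset (Fin (k+1)), g s =
      (∏ s : Finset (Fin k), g (s.map (Fin.succEmb k))) *
      ∏ s : Finset (Fin k), g (insert 0 (s.map (Fin.succEmb k))) := by
  have h0 : (0 : Fin (k+1)) ∉ (Finset.univ : Finset (Fin k)).map (Fin.succEmb k) := by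
    simp
  have hU : (Finset.univ : Finset (Fin (k+1))) = insert 0 ((Finset.univ).map (Fin.succEmb k)) := by
    rw [Fin.univ_succ, Finset.cons_eq_insert]; rfl
  have h1 : (Finset.univ : Finset (Finset (Fin (k+1)))) = (Finset.univ : Finset (Fin (k+1))).powerset := by
    simp
  have h2 : ∀ G : Finset (Fin (k+1)) → A, ∏ t ∈ ((Finset.univ : Finset (Fin k)).map (Fin.succEmb k)).powerset, G t
      = ∏ s : Finset (Fin k), G (s.map (Fin.succEmb k)) := by
    intro G
    symm
    refine Finset.prod_bij (fun s _ => s.map (Fin.succEmb k)) ?_ ?_ ?_ ?_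
    · intro s _
      rw [Finset.mem_powerset]
      exact Finset.map_subset_map.2 (Finset.subset_univ _)
    · intro a _ b _ h
      exact Finset.map_injective _ h
    · intro b hb
      rw [Finset.mem_powerset] at hb
      obtain ⟨u, _, hu⟩ := Finset.subset_map_iff.1 hb
      exact ⟨u, Finset.mem_univ _, hu.symm⟩
    · intros; rfl
  rw [h1, hU, Finset.prod_powerset_insert h0, h2, h2]

lemma PP_cons {A : Type*} [CommRing A] {k : ℕ} (x : A) (v : Fin k → A) :
    PP (Fin.cons x v : Fin (k+1) → A) = PP v * ∏ s : Finset (Fin k), (x + ∑ j ∈ s, v j) := by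
  unfold PP
  rw [prod_finset_succ]
  congr 1
  · refine Finset.prod_congr rfl fun s _ => ?_
    simp
  · refine Finset.prod_congr rfl fun s _ => ?_
    rw [if_neg (Finset.insert_ne_empty _ _), Finset.sum_insert (by simp)]
    simp

abbrev AA (k : ℕ) := MvPolynomial (Fin k) (ZMod 2)

lemma sums_inj (k : ℕ) : Function.Injective
    (fun s : Finset (Fin k) => (∑ j ∈ s, X j : AA k)) := by
  intro s t h
  ext j
  have := congrArg (coeff (Finsupp.single j 1)) h
  simp only [coeff_sum, coeff_X, Finsupp.single_left_inj (one_ne_zero : (1:ℕ) ≠ 0)] at this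
  simp only [Finset.sum_ite_eq'] at this
  by_cases h1 : j ∈ s <;> by_cases h2 : j ∈ t <;> simp_all

lemma neg_one_pow_char2 {A : Type*} [CommRing A] [CharP A 2] (n : ℕ) : (-1 : A) ^ n = 1 := by
  rw [CharTwo.neg_eq, one_pow]

/-- Expansion of the Moore determinant along the last row. -/
lemma Mo_expand {A : Type*} [CommRing A] [CharP A 2] {k : ℕ} (x : A) (v : Fin k → A) :
    ∃ Q : Fin k → A, (Mo (Fin.cons x v : Fin (k+1) → A)).det =
      x ^ 2 ^ k * (Mo v).det + ∑ j, v j ^ 2 ^ k * Q j := by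
  refine ⟨fun j => ((Mo (Fin.cons x v : Fin (k+1) → A)).submatrix (Fin.last k).succAbove j.succ.succAbove).det, ?_⟩
  rw [Matrix.det_succ_row _ (Fin.last k), Fin.sum_univ_succ]
  simp only [neg_one_pow_char2, one_mul]
  congr 1
  · have : ((Mo (Fin.cons x v : Fin (k+1) → A)).submatrix (Fin.last k).succAbove (Fin.succAbove 0)) = Mo v := by
      ext i j
      simp [Mo]
    rw [this]
    simp [Mo]

lemma Mo_cons_poly (k : ℕ) :
    (Mo (Fin.cons Polynomial.X (fun j => Polynomial.C (X j)) : Fin (k+1) → Polynomial (AA k))).det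
      = Polynomial.C (Mo (X : Fin k → AA k)).det *
        ∏ s : Finset (Fin k), (Polynomial.X + ∑ j ∈ s, Polynomial.C (X j)) := by
  -- expansion along column 0
  set M := Mo (Fin.cons Polynomial.X (fun j => Polynomial.C (X j)) : Fin (k+1) → Polynomial (AA k)) with hM
  set D : Polynomial (AA k) := ∏ s : Finset (Fin k), (Polynomial.X + ∑ j ∈ s, Polynomial.C (X j)) with hD
  have hDm : D = ∏ s : Finset (Fin k), (Polynomial.X + Polynomial.C (∑ j ∈ s, X j)) := by
    simp [hD]
  have hmonic : D.Monic := by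
    rw [hDm]; exact Polynomial.monic_prod_of_monic _ _ fun s _ => Polynomial.monic_X_add_C _
  have hdeg : D.natDegree = 2 ^ k := by
    rw [hDm, Polynomial.natDegree_prod_of_monic _ _ fun s _ => Polynomial.monic_X_add_C _]
    simp only [Polynomial.natDegree_X_add_C]
    simp
  -- minors
  have hminor : ∀ i : Fin (k+1), ∃ c : AA k,
      (M.submatrix i.succAbove Fin.succ).det = Polynomial.C c := by
    intro i
    refine ⟨(Matrix.of fun (a : Fin k) (b : Fin k) => (X b : AA k) ^ 2 ^ ((i.succAbove a : Fin (k+1)) : ℕ)).det, ?_⟩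
    rw [RingHom.map_det]
    congr 1
    ext a b
    simp [hM, Mo]
  choose c hc using hminor
  have hexp : M.det = ∑ i : Fin (k+1), Polynomial.C (c i) * Polynomial.X ^ 2 ^ (i : ℕ) := by
    rw [Matrix.det_succ_column M 0]
    refine Finset.sum_congr rfl fun i _ => ?_
    rw [neg_one_pow_char2, one_mul]
    have : (0 : Fin (k+1)).succAbove = Fin.succ := by ext; simp
    rw [this, hc i, mul_comm]
    simp [hM, Mo]
  have hclast : c (Fin.last k) = (Mo (X : Fin k → AA k)).det := by
    have h1 := hc (Fin.last k)
    apply Polynomial.C_injective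
    rw [← h1, RingHom.map_det]
    congr 1
    ext a b
    simp [hM, Mo]
  -- the difference has degree < 2^k
  have hdiff : (M.det - Polynomial.C (Mo (X : Fin k → AA k)).det * D).degree < (2 ^ k : ℕ) := by
    have e1 : M.det - Polynomial.C (Mo (X : Fin k → AA k)).det * D =
        (∑ i : Fin k, Polynomial.C (c i.castSucc) * Polynomial.X ^ 2 ^ (i : ℕ)) +
        Polynomial.C (Mo (X : Fin k → AA k)).det * (Polynomial.X ^ 2 ^ k - D) := by
      rw [hexp, Fin.sum_univ_castSucc, hclast]
      simp only [Fin.val_castSucc, Fin.val_last]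
      ring
    rw [e1]
    refine lt_of_le_of_lt (Polynomial.degree_add_le _ _) (max_lt ?_ ?_)
    · refine lt_of_le_of_lt (Polynomial.degree_sum_le _ _) ?_
      rw [Finset.sup_lt_iff (by exact WithBot.bot_lt_coe _)]
      intro i _
      refine lt_of_le_of_lt (Polynomial.degree_C_mul_X_pow_le _ _) ?_
      exact_mod_cast Nat.pow_lt_pow_right (by norm_num) i.2
    · refine lt_of_le_of_lt (b := (Polynomial.X ^ 2 ^ k - D).degree) ?_ ?_
      · rw [← Polynomial.smul_eq_C_mul]; exact Polynomial.degree_smul_le _ _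
      have := Polynomial.degree_sub_lt_left (p := (Polynomial.X ^ 2 ^ k : Polynomial (AA k))) (q := D)
        (by rw [Polynomial.degree_X_pow, Polynomial.degree_eq_natDegree hmonic.ne_zero, hdeg])
        (by simp) (by rw [Polynomial.leadingCoeff_X_pow, hmonic.leadingCoeff])
      simpa using this
  have hz : M.det - Polynomial.C (Mo (X : Fin k → AA k)).det * D = 0 := by
    classical
    refine Polynomial.eq_zero_of_degree_lt_of_eval_index_eq_zero
      (s := (Finset.univ : Finset (Finset (Fin k)))) (v := fun s => ∑ j ∈ s, X j)
      ((sums_inj k).injOn) ?_ ?_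
    · simpa using hdiff
    · intro s _
      rw [Polynomial.eval_sub, Polynomial.eval_mul]
      have hD0 : Polynomial.eval (∑ j ∈ s, X j) D = 0 := by
        rw [hDm, Polynomial.eval_prod]
        refine Finset.prod_eq_zero (Finset.mem_univ s) ?_
        rw [Polynomial.eval_add, Polynomial.eval_X, Polynomial.eval_C, CharTwo.add_self_eq_zero]
      rw [hD0, mul_zero, sub_zero]
      have : Polynomial.eval (∑ j ∈ s, X j) M.det =
          (Mo (Fin.cons (∑ j ∈ s, X j) X : Fin (k+1) → AA k)).det := by
        rw [← Polynomial.coe_evalRingHom, RingHom.map_det]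
        congr 1
        ext a b : 2
        refine Fin.cases ?_ (fun b => ?_) b <;> simp [hM, Mo]
      rw [this]
      have hv : Matrix.mulVec (Mo (Fin.cons (∑ j ∈ s, X j) X : Fin (k+1) → AA k))
          (Fin.cons 1 (fun j => if j ∈ s then 1 else 0)) = 0 := by
        ext1 i
        simp only [Matrix.mulVec, dotProduct, Fin.sum_univ_succ, Mo, Matrix.of_apply, Fin.cons_zero,
          Fin.cons_succ, mul_one, mul_ite, mul_zero, Finset.sum_ite_mem, Finset.univ_inter, Pi.zero_apply]
        rw [sum_pow_char_pow, CharTwo.add_self_eq_zero]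
      by_contra hne
      have := Matrix.eq_zero_of_mulVec_eq_zero hne hv
      have := congrFun this 0
      simp at this
  exact sub_eq_zero.1 hz

lemma finSucc_PP (k : ℕ) : finSuccEquiv (ZMod 2) k (PP (X : Fin (k+1) → AA (k+1))) =
    PP (Fin.cons Polynomial.X (fun j => Polynomial.C (X j)) : Fin (k+1) → Polynomial (AA k)) := by
  unfold PP
  rw [map_prod]
  refine Finset.prod_congr rfl fun s _ => ?_
  split_ifs
  · simp
  · rw [map_sum]
    refine Finset.sum_congr rfl fun j _ => ?_
    refine Fin.cases ?_ (fun j => ?_) j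
    · simp [finSuccEquiv_X_zero]
    · simp [finSuccEquiv_X_succ]

lemma C_PP (k : ℕ) : PP (fun j => Polynomial.C (X j) : Fin k → Polynomial (AA k)) = Polynomial.C (PP X) := by
  unfold PP
  rw [map_prod]
  refine Finset.prod_congr rfl fun s _ => ?_
  split_ifs <;> simp

lemma PP_eq_Mo (k : ℕ) : PP (X : Fin k → AA k) = (Mo X).det := by
  induction k with
  | zero =>
    simp only [PP, Mo, Finset.univ_unique, Finset.prod_singleton, Matrix.det_isEmpty]
    rw [if_pos (Subsingleton.elim _ _)]
  | succ k ih =>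
    apply (finSuccEquiv (ZMod 2) k).injective
    rw [finSucc_PP, PP_cons, C_PP, ih, ← Mo_cons_poly]
    rw [AlgEquiv.map_det]
    congr 1
    ext a b : 2
    refine Fin.cases ?_ (fun b => ?_) b <;> simp [Mo, finSuccEquiv_X_zero, finSuccEquiv_X_succ]

lemma X_dvd_PP {k : ℕ} (j : Fin k) : (X j : AA k) ∣ PP X := by
  unfold PP
  have := Finset.dvd_prod_of_mem (fun s : Finset (Fin k) => if s = ∅ then (1 : AA k) else ∑ j ∈ s, X j) (Finset.mem_univ {j})
  simpa using this

/-- The key coefficient computation. -/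
lemma PP_coeff_mod (k p q : ℕ) :
    Polynomial.coeff (finSuccEquiv (ZMod 2) k (PP X ^ (2 ^ p + q))) (2 ^ (k + p) + q)
      - PP (X : Fin k → AA k) ^ (2 ^ p + 2 * q) ∈
      Ideal.span ((fun b => monomial b (1 : ZMod 2)) '' {b | ∃ j : Fin k, b = Finsupp.single j (2 ^ (k + p) + q)}) := by
  set I := Ideal.span ((fun b => monomial b (1 : ZMod 2)) '' {b | ∃ j : Fin k, b = Finsupp.single j (2 ^ (k + p) + q)}) with hI
  set v : Fin k → Polynomial (AA k) := fun j => Polynomial.C (X j) with hv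
  set B := PP (Fin.cons Polynomial.X v : Fin (k+1) → Polynomial (AA k)) with hB
  have hB1 : B = Polynomial.C (PP X) * ∏ s : Finset (Fin k), (Polynomial.X + ∑ j ∈ s, v j) := by
    rw [hB, PP_cons, C_PP]
  have hB2 : B = (Mo (Fin.cons Polynomial.X v : Fin (k+1) → Polynomial (AA k))).det := by
    rw [hB1, PP_eq_Mo, Mo_cons_poly]
  have hMoC : (Mo v).det = Polynomial.C (PP X) := by
    rw [PP_eq_Mo, RingHom.map_det]
    congr 1
    ext a b : 2
    simp [Mo, hv]
  obtain ⟨Q, hQ⟩ := Mo_expand (Polynomial.X : Polynomial (AA k)) v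
  rw [← hB2, hMoC] at hQ
  have hpow : B ^ 2 ^ p = Polynomial.X ^ 2 ^ (k + p) * Polynomial.C (PP X ^ 2 ^ p) +
      ∑ j, v j ^ 2 ^ (k + p) * Q j ^ 2 ^ p := by
    rw [hQ, add_pow_char_pow, sum_pow_char_pow, mul_pow, ← pow_mul, ← pow_add, map_pow]
    congr 1
    refine Finset.sum_congr rfl fun j _ => ?_
    rw [mul_pow, ← pow_mul, ← pow_add]
  have hdvd : ∀ j, ∃ Z, B ^ q = v j ^ q * Z := by
    intro j
    have h1 : v j ∣ B := by
      rw [hB1]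
      exact Dvd.dvd.mul_right (map_dvd Polynomial.C (X_dvd_PP j)) _
    exact pow_dvd_pow_of_dvd h1 q
  choose Z hZ using hdvd
  have hB3 : ∃ B', B = Polynomial.X * B' ∧ Polynomial.coeff B' 0 = PP X ^ 2 := by
    refine ⟨Polynomial.C (PP X) * ∏ s : Finset (Fin k), if s = ∅ then 1 else (Polynomial.X + ∑ j ∈ s, v j), ?_, ?_⟩
    · rw [hB1, ← Finset.mul_prod_erase _ _ (Finset.mem_univ (∅ : Finset (Fin k)))]
      rw [← Finset.mul_prod_erase _ (fun s => if s = ∅ then (1 : Polynomial (AA k)) else _) (Finset.mem_univ (∅ : Finset (Fin k)))]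
      have : ∏ x ∈ Finset.univ.erase (∅ : Finset (Fin k)), (Polynomial.X + ∑ j ∈ x, v j)
        = ∏ x ∈ Finset.univ.erase (∅ : Finset (Fin k)), (if x = ∅ then (1 : Polynomial (AA k)) else (Polynomial.X + ∑ j ∈ x, v j)) := by
        refine Finset.prod_congr rfl fun x hx => ?_
        rw [if_neg (Finset.ne_of_mem_erase hx)]
      rw [this]
      simp
      ring
    · rw [Polynomial.coeff_C_mul, sq, Polynomial.coeff_zero_eq_eval_zero, Polynomial.eval_prod]
      congr 1
      unfold PP
      refine Finset.prod_congr rfl fun s _ => ?_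
      split_ifs <;> simp [hv, Polynomial.eval_finsetSum]
  obtain ⟨B', hB', hB0⟩ := hB3
  have hvX : ∀ j, v j = Polynomial.C (X j) := fun j => rfl
  have hfin : B ^ (2 ^ p + q) = Polynomial.X ^ (2 ^ (k + p) + q) * (Polynomial.C (PP X ^ 2 ^ p) * B' ^ q) +
      ∑ j, Polynomial.C (X j ^ (2 ^ (k + p) + q)) * (Q j ^ 2 ^ p * Z j) := by
    rw [pow_add, hpow, add_mul, Finset.sum_mul]
    refine congrArg₂ (· + ·) ?_ ?_
    · rw [hB', mul_pow, pow_add _ (2 ^ (k + p)) q, mul_mul_mul_comm]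
    · refine Finset.sum_congr rfl fun j _ => ?_
      rw [hZ j, map_pow, pow_add _ (2 ^ (k + p)) q, hvX, mul_mul_mul_comm]
  rw [map_pow, finSucc_PP, ← hv, ← hB]
  clear_value B
  rw [hfin, Polynomial.coeff_add]
  have h1 : Polynomial.coeff (Polynomial.X ^ (2 ^ (k + p) + q) * (Polynomial.C (PP X ^ 2 ^ p) * B' ^ q)) (2 ^ (k + p) + q)
      = PP (X : Fin k → AA k) ^ (2 ^ p + 2 * q) := by
    have := Polynomial.coeff_X_pow_mul (Polynomial.C (PP (X : Fin k → AA k) ^ 2 ^ p) * B' ^ q) (2 ^ (k + p) + q) 0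
    rw [zero_add] at this
    rw [this, Polynomial.coeff_C_mul, Polynomial.coeff_zero_eq_eval_zero, Polynomial.eval_pow,
      ← Polynomial.coeff_zero_eq_eval_zero, hB0]
    ring
  rw [h1, add_sub_cancel_left, Polynomial.finsetSum_coeff]
  refine Ideal.sum_mem _ fun j _ => ?_
  rw [Polynomial.coeff_C_mul]
  refine Ideal.mul_mem_right _ _ (Ideal.subset_span ⟨Finsupp.single j (2 ^ (k + p) + q), ⟨j, rfl⟩, ?_⟩)
  simp [X_pow_eq_monomial]

theorem PP_monomial (k : ℕ) : ∀ p q : ℕ, q < 2 ^ p →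
    ∃ b : Fin (k+1) →₀ ℕ, (∀ j, b j ≤ 2 ^ (k + p) + q) ∧
      coeff b (PP (X : Fin (k+1) → AA (k+1)) ^ (2 ^ p + q)) ≠ 0 := by
  induction k with
  | zero =>
    intro p q hq
    have h1 : PP (X : Fin 1 → AA 1) = X 0 := by
      have : (X : Fin 1 → AA 1) = Fin.cons (X 0) Fin.elim0 := by
        ext1 j; fin_cases j; rfl
      rw [this, PP_cons]
      simp only [PP, Finset.univ_unique, Finset.prod_singleton]
      rw [if_pos (Subsingleton.elim _ _), Subsingleton.elim (default : Finset (Fin 0)) ∅]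
      simp
    refine ⟨Finsupp.single 0 (2 ^ p + q), ?_, ?_⟩
    · intro j; fin_cases j; simp
    · rw [h1, coeff_X_pow]; simp
  | succ k ih =>
    intro p q hq
    have key : ∃ b : Fin (k+1) →₀ ℕ, (∀ j, b j < 2 ^ (k + 1 + p) + q) ∧
      coeff b (PP (X : Fin (k+1) → AA (k+1)) ^ (2 ^ p + 2 * q)) ≠ 0 := by
      have e1 : 2 ^ (k + 1 + p) = 2 ^ k * 2 ^ p + 2 ^ k * 2 ^ p := by ring
      have e0 : 1 ≤ 2 ^ k := Nat.one_le_two_pow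
      have e2 : 2 ^ p ≤ 2 ^ k * 2 ^ p := Nat.le_mul_of_pos_left _ e0
      by_cases h : 2 * q < 2 ^ p
      · obtain ⟨b, hb, hc⟩ := ih p (2 * q) h
        refine ⟨b, fun j => lt_of_le_of_lt (hb j) ?_, hc⟩
        rw [e1, pow_add]
        omega
      · have e3 : 2 ^ (p + 1) = 2 ^ p + 2 ^ p := by ring
        obtain ⟨b, hb, hc⟩ := ih (p+1) (2 * q - 2 ^ p) (by omega)
        refine ⟨b, fun j => lt_of_le_of_lt (hb j) ?_, ?_⟩
        · have e4 : 2 ^ (k + (p + 1)) = 2 ^ (k + 1 + p) := by ring_nf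
          rw [e4]; omega
        · have : 2 ^ (p + 1) + (2 * q - 2 ^ p) = 2 ^ p + 2 * q := by omega
          rwa [this] at hc
    obtain ⟨b, hb, hc⟩ := key
    refine ⟨Finsupp.cons (2 ^ (k + 1 + p) + q) b, ?_, ?_⟩
    · intro j
      refine Fin.cases ?_ (fun j => ?_) j
      · simp
      · rw [Finsupp.cons_succ]; exact (hb j).le
    · rw [← finSuccEquiv_coeff_coeff]
      have hm := PP_coeff_mod (k+1) p q
      set c := Polynomial.coeff (finSuccEquiv (ZMod 2) (k+1) (PP X ^ (2 ^ p + q))) (2 ^ (k + 1 + p) + q)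
      rw [mem_ideal_span_monomial_image] at hm
      have h0 : coeff b (c - PP X ^ (2 ^ p + 2 * q)) = 0 := by
        by_contra hne
        obtain ⟨s, ⟨j, rfl⟩, hle⟩ := hm b (mem_support_iff.2 hne)
        have := hle j
        rw [Finsupp.single_eq_same] at this
        exact absurd (hb j) (not_lt.2 this)
      rw [coeff_sub, sub_eq_zero] at h0
      rw [h0]; exact hc

end KRP


/-! ### Section 2: multigraded Hilbert functions -/
namespace KRP
open MvPolynomial Module

section lin
variable {V V₁ V₂ : Type*} [AddCommGroup V] [Module ℝ V] [AddCommGroup V₁] [Module ℝ V₁]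
  [AddCommGroup V₂] [Module ℝ V₂]

lemma rank_null (U : Submodule ℝ V) [FiniteDimensional ℝ U] (φ : V →ₗ[ℝ] V₁) :
    finrank ℝ (U.map φ) + finrank ℝ (U ⊓ LinearMap.ker φ : Submodule ℝ V) = finrank ℝ U := by
  have h := LinearMap.finrank_range_add_finrank_ker (φ.domRestrict U)
  rw [LinearMap.range_domRestrict] at h
  rw [← h]
  congr 1
  rw [LinearMap.ker_domRestrict]
  have h2 := Submodule.finrank_map_subtype_eq U ((LinearMap.ker φ).comap U.subtype)
  rw [← Submodule.map_comap_subtype, h2]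

lemma ineq3 (U U' : Submodule ℝ V) [FiniteDimensional ℝ U] [FiniteDimensional ℝ U']
    (φ₁ : V →ₗ[ℝ] V₁) (φ₂ : V →ₗ[ℝ] V₂) (m : V →ₗ[ℝ] V)
    (h : ∀ u ∈ U, φ₂ u = 0 → ∃ u' ∈ U', φ₁ u = φ₁ (m u')) :
    finrank ℝ (U.map φ₁) ≤ finrank ℝ (U.map φ₂) + finrank ℝ (U'.map (φ₁ ∘ₗ m)) := by
  have h1 := rank_null U φ₁
  have h2 := rank_null U φ₂
  have : FiniteDimensional ℝ (U ⊓ LinearMap.ker φ₂ : Submodule ℝ V) :=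
    Submodule.finiteDimensional_of_le inf_le_left
  have : FiniteDimensional ℝ (U ⊓ LinearMap.ker φ₁ : Submodule ℝ V) :=
    Submodule.finiteDimensional_of_le inf_le_left
  have h3 := rank_null (U ⊓ LinearMap.ker φ₂) φ₁
  have h4 : finrank ℝ ((U ⊓ LinearMap.ker φ₂).map φ₁) ≤ finrank ℝ (U'.map (φ₁ ∘ₗ m)) := by
    refine Submodule.finrank_mono ?_
    rintro _ ⟨u, ⟨hu, hk⟩, rfl⟩
    obtain ⟨u', hu', e⟩ := h u hu hk
    exact ⟨u', hu', e.symm⟩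
  have h5 : finrank ℝ (U ⊓ LinearMap.ker φ₂ ⊓ LinearMap.ker φ₁ : Submodule ℝ V) ≤
      finrank ℝ (U ⊓ LinearMap.ker φ₁ : Submodule ℝ V) :=
    Submodule.finrank_mono (inf_le_inf_right _ inf_le_left)
  omega

lemma ineq2 (U : Submodule ℝ V) [FiniteDimensional ℝ U]
    (φ₁ : V →ₗ[ℝ] V₁) (φ₂ : V →ₗ[ℝ] V₂) (h : ∀ u ∈ U, φ₂ u = 0 → φ₁ u = 0) :
    finrank ℝ (U.map φ₁) ≤ finrank ℝ (U.map φ₂) := by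
  have h1 := rank_null U φ₁
  have h2 := rank_null U φ₂
  have : FiniteDimensional ℝ (U ⊓ LinearMap.ker φ₁ : Submodule ℝ V) :=
    Submodule.finiteDimensional_of_le inf_le_left
  have h5 : finrank ℝ (U ⊓ LinearMap.ker φ₂ : Submodule ℝ V) ≤
      finrank ℝ (U ⊓ LinearMap.ker φ₁ : Submodule ℝ V) :=
    Submodule.finrank_mono (fun u hu => ⟨hu.1, h u hu.1 hu.2⟩)
  omega

lemma linind_perturb {κ : Type*} [Finite κ] (x y : κ → V) (hx : LinearIndependent ℝ x) :
    {s : ℝ | ¬ LinearIndependent ℝ (fun i => x i + s • y i)}.Finite := by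
  classical
  have := Fintype.ofFinite κ
  obtain ⟨φ, hφ⟩ := LinearMap.exists_leftInverse_of_injective (Fintype.linearCombination ℝ x)
    (LinearMap.ker_eq_bot.2 (hx.fintypeLinearCombination_injective))
  have hφx : ∀ i, φ (x i) = Pi.single i 1 := by
    intro i
    have := LinearMap.congr_fun hφ (Pi.single i 1)
    simpa [Fintype.linearCombination_apply_single] using this
  let B : Matrix κ κ ℝ := Matrix.of fun i => φ (y i)
  let P : Polynomial ℝ := (1 + (Polynomial.X : Polynomial ℝ) • B.map Polynomial.C).det
  have hev : ∀ s : ℝ, P.eval s = (1 + s • B).det := by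
    intro s
    rw [← Polynomial.coe_evalRingHom, RingHom.map_det]
    congr 1
    ext i j
    by_cases hij : i = j <;> simp [Matrix.one_apply, hij] <;> exact mul_comm _ _
  have hP : P ≠ 0 := by
    intro h
    have := hev 0
    rw [h] at this
    simp at this
  refine (Polynomial.finite_setOfPred_isRoot hP).subset ?_
  intro s hs
  by_contra hr
  apply hs
  have hdet : (1 + s • B).det ≠ 0 := by rw [← hev]; exact hr
  have hli := Matrix.linearIndependent_rows_of_det_ne_zero hdet
  refine LinearIndependent.of_comp φ ?_
  have he : (φ ∘ fun i => x i + s • y i) = (1 + s • B).row := by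
    ext i j
    simp [hφx, B, Matrix.row, Matrix.one_apply, Pi.single_apply, eq_comm]
  rw [he]
  exact hli

end lin

abbrev Sg (k n : ℕ) := Fin k × Fin (n+1)
abbrev SS (k n : ℕ) := MvPolynomial (Sg k n) ℝ

variable {k n : ℕ}

def wt : Sg k n → (Fin k → ℤ) := fun p => Pi.single p.1 1

noncomputable def RR (e : Fin k → ℤ) : Submodule ℝ (SS k n) := weightedHomogeneousSubmodule ℝ wt e

lemma mem_RR {e : Fin k → ℤ} {f : SS k n} : f ∈ RR e ↔ IsWeightedHomogeneous wt f e := Iff.rfl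

lemma weight_apply' (d : Sg k n →₀ ℕ) (j : Fin k) :
    Finsupp.weight (wt (k := k) (n := n)) d j = ∑ i, (d (j, i) : ℤ) := by
  rw [Finsupp.weight_apply, Finsupp.sum_fintype _ _ (by simp), Finset.sum_apply, Fintype.sum_prod_type]
  rw [Finset.sum_eq_single j]
  · simp [wt]
  · intro b _ hb
    refine Finset.sum_eq_zero fun i _ => ?_
    simp [wt, Pi.single_eq_of_ne hb.symm]
  · simp

lemma finite_weight (e : Fin k → ℤ) : {d : Sg k n →₀ ℕ | Finsupp.weight wt d = e}.Finite := by
  refine (Set.finite_Iic (Finsupp.equivFunOnFinite.symm (fun p : Sg k n => (e p.1).toNat))).subset ?_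
  rintro d rfl p
  simp only [Finsupp.equivFunOnFinite_symm_apply_apply]
  rw [weight_apply']
  have : (d (p.1, p.2) : ℤ) ≤ ∑ i, (d (p.1, i) : ℤ) :=
    Finset.single_le_sum (f := fun i => (d (p.1, i) : ℤ)) (fun i _ => by positivity) (Finset.mem_univ p.2)
  have h2 : d (p.1, p.2) = d p := rfl
  omega

lemma RR_eq_span (e : Fin k → ℤ) : (RR e : Submodule ℝ (SS k n)) =
    Submodule.span ℝ ((fun d => monomial d (1:ℝ)) '' {d | Finsupp.weight wt d = e}) := by
  apply le_antisymm
  · intro f hf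
    rw [f.as_sum]
    refine Submodule.sum_mem _ fun d hd => ?_
    have : monomial d (coeff d f) = coeff d f • monomial d (1:ℝ) := by simp [smul_monomial]
    rw [this]
    exact Submodule.smul_mem _ _ (Submodule.subset_span ⟨d, hf (mem_support_iff.1 hd), rfl⟩)
  · rw [Submodule.span_le]
    rintro _ ⟨d, hd, rfl⟩
    exact isWeightedHomogeneous_monomial _ _ _ hd

instance (e : Fin k → ℤ) : FiniteDimensional ℝ (RR e : Submodule ℝ (SS k n)) := by
  rw [RR_eq_span]
  exact FiniteDimensional.span_of_finite ℝ ((finite_weight e).image _)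

noncomputable def mkl (J : Ideal (SS k n)) : SS k n →ₗ[ℝ] (SS k n ⧸ J) :=
  (Ideal.Quotient.mkₐ ℝ J).toLinearMap

lemma mkl_eq_zero {J : Ideal (SS k n)} {f : SS k n} : mkl J f = 0 ↔ f ∈ J :=
  Ideal.Quotient.eq_zero_iff_mem

noncomputable def HH (J : Ideal (SS k n)) (e : Fin k → ℤ) : ℕ := finrank ℝ ((RR e).map (mkl J))

noncomputable def cmp (e : Fin k → ℤ) : SS k n →ₗ[ℝ] SS k n := weightedHomogeneousComponent wt e

lemma cmp_mem (e : Fin k → ℤ) (f : SS k n) : cmp e f ∈ RR e :=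
  weightedHomogeneousComponent_isWeightedHomogeneous _ _

lemma cmp_self {e : Fin k → ℤ} {f : SS k n} (h : f ∈ RR e) : cmp e f = f :=
  weightedHomogeneousComponent_eq_self h

lemma cmp_mul {δ : Fin k → ℤ} {f : SS k n} (hf : f ∈ RR δ) (e : Fin k → ℤ) (g : SS k n) :
    cmp e (f * g) = f * cmp (e - δ) g := by
  classical
  letI := MvPolynomial.weightedGradedAlgebra ℝ (wt (k := k) (n := n))
  have := DirectSum.coe_decompose_mul_add_of_left_mem
    (𝒜 := weightedHomogeneousSubmodule ℝ (wt (k := k) (n := n))) (i := δ) (j := e - δ) (a := f) (b := g) hf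
  rw [add_sub_cancel] at this
  have h : ∀ (φ : SS k n) m, ((DirectSum.decompose (weightedHomogeneousSubmodule ℝ (wt (k := k) (n := n))) φ m :
      weightedHomogeneousSubmodule ℝ (wt (k := k) (n := n)) m) : SS k n) = weightedHomogeneousComponent wt m φ :=
    fun φ m => weightedDecomposition.decompose'_apply ℝ wt φ m
  rw [h, h] at this
  exact this

def HomI (J : Ideal (SS k n)) : Prop := ∀ r ∈ J, ∀ e, cmp e r ∈ J

lemma HomI_bot : HomI (⊥ : Ideal (SS k n)) := by
  intro r hr e
  rw [Ideal.mem_bot] at hr ⊢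
  rw [hr, map_zero]

lemma HomI.sup {J : Ideal (SS k n)} (hJ : HomI J) {δ : Fin k → ℤ} {f : SS k n} (hf : f ∈ RR δ) :
    HomI (J ⊔ Ideal.span {f}) := by
  intro r hr e
  obtain ⟨a, ha, b, hb, rfl⟩ := Submodule.mem_sup.1 hr
  obtain ⟨g, rfl⟩ := Ideal.mem_span_singleton'.1 hb
  rw [map_add, mul_comm, cmp_mul hf]
  exact Ideal.add_mem _ (Ideal.mem_sup_left (hJ a ha e))
    (Ideal.mem_sup_right (Ideal.mul_mem_right _ _ (Ideal.mem_span_singleton_self f)))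

lemma HomI.mem_sup {J : Ideal (SS k n)} (hJ : HomI J) {δ : Fin k → ℤ} {f : SS k n} (hf : f ∈ RR δ)
    {e : Fin k → ℤ} {u : SS k n} (hu : u ∈ RR e) (h : u ∈ J ⊔ Ideal.span {f}) :
    ∃ u' ∈ RR (e - δ), u - f * u' ∈ J := by
  obtain ⟨a, ha, b, hb, hab⟩ := Submodule.mem_sup.1 h
  obtain ⟨g, rfl⟩ := Ideal.mem_span_singleton'.1 hb
  refine ⟨cmp (e - δ) g, cmp_mem _ _, ?_⟩
  have h1 : u = cmp e a + f * cmp (e - δ) g := by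
    rw [← cmp_mul hf, ← map_add, mul_comm f g, hab, cmp_self hu]
  have h2 : u - f * cmp (e - δ) g = cmp e a := by rw [sub_eq_iff_eq_add]; exact h1
  rw [h2]
  exact hJ a ha e

lemma HH_step (J₁ J₂ J₃ : Ideal (SS k n)) (f : SS k n) (e e' : Fin k → ℤ)
    (h1 : ∀ u ∈ RR e, u ∈ J₂ → ∃ u' ∈ RR e', u - f * u' ∈ J₁)
    (h2 : ∀ u ∈ J₃, f * u ∈ J₁) : HH J₁ e ≤ HH J₂ e + HH J₃ e' := by
  unfold HH
  refine (ineq3 (RR e) (RR e') (mkl J₁) (mkl J₂) (LinearMap.mulLeft ℝ f) ?_).trans ?_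
  · intro u hu h
    obtain ⟨u', hu', h'⟩ := h1 u hu (mkl_eq_zero.1 h)
    refine ⟨u', hu', ?_⟩
    rw [← sub_eq_zero, ← map_sub, mkl_eq_zero]
    exact h'
  · refine Nat.add_le_add_left (ineq2 _ _ _ fun u _ h => ?_) _
    rw [LinearMap.comp_apply, mkl_eq_zero]
    exact h2 u (mkl_eq_zero.1 h)

lemma HH_lower {J : Ideal (SS k n)} (hJ : HomI J) {δ : Fin k → ℤ} {f : SS k n} (hf : f ∈ RR δ)
    (e : Fin k → ℤ) : HH J e ≤ HH (J ⊔ Ideal.span {f}) e + HH J (e - δ) :=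
  HH_step _ _ _ f _ _ (fun _ hu h => hJ.mem_sup hf hu h) (fun _ h => Ideal.mul_mem_left _ _ h)

lemma HH_upper {J : Ideal (SS k n)} (hJ : HomI J) {δ : Fin k → ℤ} {a : SS k n} (ha : a ∈ RR δ)
    (b : SS k n) (e : Fin k → ℤ) : HH (J ⊔ Ideal.span {a * b}) e ≤
      HH (J ⊔ Ideal.span {a}) e + HH (J ⊔ Ideal.span {b}) (e - δ) := by
  refine HH_step _ _ _ a _ _ (fun u hu h => ?_) (fun u h => ?_)
  · obtain ⟨u', hu', h'⟩ := hJ.mem_sup ha hu h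
    exact ⟨u', hu', Ideal.mem_sup_left h'⟩
  · obtain ⟨c, hc, d, hd, rfl⟩ := Submodule.mem_sup.1 h
    obtain ⟨g, rfl⟩ := Ideal.mem_span_singleton'.1 hd
    rw [mul_add]
    refine Ideal.add_mem _ (Ideal.mem_sup_left (Ideal.mul_mem_left _ _ hc)) (Ideal.mem_sup_right ?_)
    rw [Ideal.mem_span_singleton']
    exact ⟨g, by ring⟩

lemma HH_mono {J J' : Ideal (SS k n)} (h : J ≤ J') (e : Fin k → ℤ) : HH J' e ≤ HH J e :=
  ineq2 _ _ _ fun u _ hu => mkl_eq_zero.2 (h (mkl_eq_zero.1 hu))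

lemma HH_top (e : Fin k → ℤ) : HH (⊤ : Ideal (SS k n)) e = 0 := by
  unfold HH
  have : (RR e).map (mkl (⊤ : Ideal (SS k n))) = ⊥ := by
    rw [eq_bot_iff]
    rintro _ ⟨_, _, rfl⟩
    exact mkl_eq_zero.2 trivial
  rw [this, finrank_bot]

/-- the counting function -/
def DD (ν : Fin k → ℕ) (e : Fin k → ℤ) : Set (Sg k n →₀ ℕ) :=
  {d | Finsupp.weight wt d = e ∧ ∀ p : Sg k n, (p.2 : ℕ) < ν p.1 → d p = 0}

lemma DD_finite (ν : Fin k → ℕ) (e : Fin k → ℤ) : (DD ν e : Set (Sg k n →₀ ℕ)).Finite :=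
  (finite_weight e).subset fun _ h => h.1

variable (n) in
noncomputable def hh (ν : Fin k → ℕ) (e : Fin k → ℤ) : ℤ := (DD ν e : Set (Sg k n →₀ ℕ)).ncard

lemma DD_empty {ν : Fin k → ℕ} {e : Fin k → ℤ} {j : Fin k} (hν : n < ν j) (he : 1 ≤ e j) :
    (DD ν e : Set (Sg k n →₀ ℕ)) = ∅ := by
  rw [Set.eq_empty_iff_forall_notMem]
  rintro d ⟨h1, h2⟩
  have := weight_apply' d j
  rw [h1, Finset.sum_eq_zero] at this
  · omega
  · intro i _
    rw [h2 (j, i) (by simpa using lt_of_le_of_lt (Nat.lt_succ_iff.1 i.2) hν)]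
    rfl

lemma hh_zero {ν : Fin k → ℕ} {e : Fin k → ℤ} {j : Fin k} (hν : n < ν j) (he : 1 ≤ e j) :
    hh n ν e = 0 := by
  rw [hh, DD_empty hν he]; simp

lemma weight_single (p : Sg k n) : Finsupp.weight wt (Finsupp.single p 1) = (Pi.single p.1 1 : Fin k → ℤ) := by
  rw [Finsupp.weight_single]; simp [wt]

lemma hh_rec (ν : Fin k → ℕ) (e : Fin k → ℤ) (j : Fin k) (he : 2 ≤ e j) :
    hh n (ν + Pi.single j 1) e = hh n ν e - hh n ν (e - Pi.single j 1) := by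
  by_cases hν : n < ν j
  · rw [hh_zero (j := j) (by simp; omega) (by omega), hh_zero hν (by omega), hh_zero hν (by simp; omega)]
    rfl
  · push Not at hν
    let p : Sg k n := (j, ⟨ν j, by omega⟩)
    have key : (DD ν e : Set (Sg k n →₀ ℕ)) = DD (ν + Pi.single j 1) e ∪
        (fun d => d + Finsupp.single p 1) '' DD ν (e - Pi.single j 1) := by
      ext d
      constructor
      · rintro ⟨h1, h2⟩
        by_cases hp : d p = 0
        · left
          refine ⟨h1, fun x hx => ?_⟩
          by_cases hxj : x.1 = j
          · subst hxj
            by_cases hx2 : (x.2 : ℕ) < ν x.1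
            · exact h2 x hx2
            · have : x = p := by
                refine Prod.ext rfl (Fin.ext ?_)
                simp at hx
                simp only [p]
                omega
              rw [this]; exact hp
          · refine h2 x ?_
            simpa [Pi.single_eq_of_ne hxj] using hx
        · right
          have hle : Finsupp.single p 1 ≤ d := by
            rw [Finsupp.single_le_iff]; omega
          refine ⟨d - Finsupp.single p 1, ⟨?_, fun x hx => ?_⟩, tsub_add_cancel_of_le hle⟩
          · rw [← h1, eq_sub_iff_add_eq, ← weight_single p, ← map_add, tsub_add_cancel_of_le hle]
          · rw [Finsupp.tsub_apply, h2 x hx, zero_tsub]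
      · rintro (⟨h1, h2⟩ | ⟨d, ⟨h1, h2⟩, rfl⟩)
        · refine ⟨h1, fun x hx => h2 x ?_⟩
          simp only [Pi.add_apply]; omega
        · refine ⟨?_, fun x hx => ?_⟩
          · rw [map_add, h1, weight_single]; simp [p]
          · rw [Finsupp.add_apply, h2 x hx, zero_add, Finsupp.single_eq_of_ne]
            rintro rfl
            simp [p] at hx
    have hdisj : Disjoint (DD (ν + Pi.single j 1) e : Set (Sg k n →₀ ℕ))
        ((fun d => d + Finsupp.single p 1) '' DD ν (e - Pi.single j 1)) := by
      rw [Set.disjoint_left]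
      rintro _ ⟨_, h2⟩ ⟨d, _, rfl⟩
      have := h2 p (by simp [p])
      simp at this
    have hc : (DD ν e : Set (Sg k n →₀ ℕ)).ncard = (DD (ν + Pi.single j 1) e : Set (Sg k n →₀ ℕ)).ncard
        + (DD ν (e - Pi.single j 1) : Set (Sg k n →₀ ℕ)).ncard := by
      rw [key, Set.ncard_union_eq hdisj (DD_finite _ _) ((DD_finite _ _).image _),
        Set.ncard_image_of_injective _ (fun a b h => add_right_cancel h)]
    unfold hh
    omega

lemma hh_one {ν : Fin k → ℕ} {e : Fin k → ℤ} (hν : ∀ j, ν j = n) (he : ∀ j, 0 ≤ e j) :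
    hh n ν e = 1 := by
  unfold hh
  have : (DD ν e : Set (Sg k n →₀ ℕ)) =
      {Finsupp.equivFunOnFinite.symm (fun p => if p.2 = Fin.last n then (e p.1).toNat else 0)} := by
    ext d
    rw [Set.mem_singleton_iff]
    constructor
    · rintro ⟨h1, h2⟩
      have h3 : ∀ j i, i ≠ Fin.last n → d (j, i) = 0 := by
        intro j i hi
        refine h2 (j, i) ?_
        rw [hν]
        exact Fin.val_lt_last hi
      ext ⟨j, i⟩
      simp only [Finsupp.equivFunOnFinite_symm_apply_apply]
      split_ifs with hi
      · have := weight_apply' d j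
        rw [h1, Finset.sum_eq_single (Fin.last n)] at this
        · rw [hi, this]; simp
        · intro b _ hb; rw [h3 j b hb]; rfl
        · simp
      · exact h3 j i hi
    · rintro rfl
      refine ⟨?_, ?_⟩
      · ext j
        rw [weight_apply']
        simp [he j]
      · intro p hp
        simp only [Finsupp.equivFunOnFinite_symm_apply_apply]
        rw [if_neg]
        intro h
        rw [hν, h] at hp
        simp at hp
  rw [this]; simp

lemma HH_bot (e : Fin k → ℤ) : (HH (⊥ : Ideal (SS k n)) e : ℤ) = hh n 0 e := by
  unfold HH hh
  have h1 : finrank ℝ ((RR e).map (mkl (⊥ : Ideal (SS k n)))) = finrank ℝ (RR e : Submodule ℝ (SS k n)) := by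
    have h := rank_null (RR e) (mkl (⊥ : Ideal (SS k n)))
    have h0 : RR e ⊓ LinearMap.ker (mkl (⊥ : Ideal (SS k n))) = ⊥ := by
      rw [eq_bot_iff]
      rintro u ⟨_, hu⟩
      exact mkl_eq_zero.1 hu
    rw [h0, finrank_bot] at h
    exact h
  have h2 : finrank ℝ (RR e : Submodule ℝ (SS k n)) = (DD 0 e : Set (Sg k n →₀ ℕ)).ncard := by
    have : (DD 0 e : Set (Sg k n →₀ ℕ)) = {d | Finsupp.weight wt d = e} := by
      ext d; simp [DD]
    rw [this, RR_eq_span]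
    have := (finite_weight (n := n) e).fintype
    rw [Set.image_eq_range, finrank_span_eq_card, Set.ncard_eq_toFinset_card', Set.toFinset_card]
    exact (basisMonomials (Sg k n) ℝ).linearIndependent.comp _ Subtype.val_injective
  rw [h1, h2]

end KRP


/-! ### Section 3: special linear forms -/
namespace KRP
open MvPolynomial Module
variable {k n : ℕ}

variable (n) in
/-- moment-curve linear form -/
noncomputable def LF (x : Fin k × ℝ) : SS k n := ∑ i : Fin (n+1), C (x.2^(i:ℕ)) * X (x.1, i)

lemma X_mem (p : Sg k n) : (X p : SS k n) ∈ RR (Pi.single p.1 1) :=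
  isWeightedHomogeneous_X ℝ wt p

lemma LF_mem (x : Fin k × ℝ) : LF n x ∈ RR (Pi.single x.1 1) := by
  refine Submodule.sum_mem _ fun i _ => ?_
  rw [← smul_eq_C_mul]
  exact Submodule.smul_mem _ _ (X_mem (x.1, i))

noncomputable def LId : List (SS k n) → Ideal (SS k n)
  | [] => ⊥
  | f :: l => LId l ⊔ Ideal.span {f}

lemma mem_LId {f : SS k n} : ∀ {l : List (SS k n)}, f ∈ l → f ∈ LId l
  | g :: l, h => by
    rcases List.mem_cons.1 h with rfl | h
    · exact Ideal.mem_sup_right (Ideal.mem_span_singleton_self _)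
    · exact Ideal.mem_sup_left (mem_LId h)

def cnt (l : List (Fin k × ℝ)) (j : Fin k) : ℕ := (l.map Prod.fst).count j

lemma cnt_eq (l : List (Fin k × ℝ)) (h : (l.map Prod.snd).Nodup) (j : Fin k) :
    ∃ T : Finset ℝ, T.card = cnt l j ∧ ∀ u ∈ T, (j, u) ∈ l := by
  classical
  refine ⟨((l.filter (fun x => x.1 = j)).map Prod.snd).toFinset, ?_, ?_⟩
  · rw [List.toFinset_card_of_nodup, List.length_map, cnt, List.count, List.countP_map,
      ← List.countP_eq_length_filter]
    · congr 1
    · exact h.sublist ((List.filter_sublist).map _)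
  · intro u hu
    simp only [List.mem_toFinset, List.mem_map, List.mem_filter, decide_eq_true_eq] at hu
    obtain ⟨⟨a, b⟩, ⟨h1, rfl⟩, rfl⟩ := hu
    exact h1

lemma lagr (T : Finset ℝ) {i : ℕ} (_ : i < T.card) : ∃ c : ℝ → ℝ, ∀ i' < T.card,
    ∑ u ∈ T, c u * u^i' = if i = i' then 1 else 0 := by
  classical
  refine ⟨fun u => (Lagrange.basis T id u).coeff i, fun i' hi' => ?_⟩
  have h := Lagrange.eq_interpolate (s := T) (v := id) (f := (Polynomial.X : Polynomial ℝ)^i')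
    (Set.injOn_id _) (by rw [Polynomial.degree_X_pow]; exact_mod_cast hi')
  have h2 := congrArg (fun P => Polynomial.coeff P i) h
  simp only [Lagrange.interpolate_apply, Polynomial.coeff_X_pow, Polynomial.finsetSum_coeff,
    Polynomial.coeff_C_mul, Polynomial.eval_pow, Polynomial.eval_X, id] at h2
  rw [h2]
  exact Finset.sum_congr rfl fun u _ => mul_comm _ _

lemma bad_var (l : List (Fin k × ℝ)) (h : (l.map Prod.snd).Nodup) (j : Fin k) (i : Fin (n+1))
    (hi : (i : ℕ) < cnt l j) : ∃ c : Fin (n+1) → ℝ,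
    X (j, i) - ∑ i' ∈ (Finset.univ : Finset (Fin (n+1))).filter (fun i' => cnt l j ≤ i'.val), c i' • X (j, i') ∈ LId (l.map (LF n)) := by
  obtain ⟨T, hT, hTl⟩ := cnt_eq l h j
  obtain ⟨c, hc⟩ := lagr T (i := i) (by omega)
  refine ⟨fun i' => - ∑ u ∈ T, c u * u^(i':ℕ), ?_⟩
  have : X (j, i) - ∑ i' ∈ (Finset.univ : Finset (Fin (n+1))).filter (fun i' => cnt l j ≤ i'.val), (- ∑ u ∈ T, c u * u^(i':ℕ)) • X (j, i')
      = ∑ u ∈ T, C (c u) * LF n (j, u) := by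
    simp only [LF, Finset.mul_sum]
    rw [Finset.sum_comm]
    rw [sub_eq_iff_eq_add,
      ← Finset.sum_filter_add_sum_filter_not (Finset.univ : Finset (Fin (n+1))) (fun i' => cnt l j ≤ i'.val),
      add_right_comm, ← Finset.sum_add_distrib, Finset.sum_eq_zero, zero_add]
    · rw [Finset.sum_eq_single i]
      · have := hc i (by omega)
        rw [if_pos rfl] at this
        simp only [← mul_assoc, ← C_mul]
        rw [← Finset.sum_mul, ← map_sum, this, C_1, one_mul]
      · intro b hb hbi
        have hb' : (b : ℕ) < T.card := by simpa [hT] using hb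
        have := hc b hb'
        rw [if_neg (fun h => hbi (Fin.ext h.symm))] at this
        simp only [← mul_assoc, ← C_mul]
        rw [← Finset.sum_mul, ← map_sum, this, C_0, zero_mul]
      · intro h
        exact absurd (Finset.mem_filter.2 ⟨Finset.mem_univ i, by omega⟩) h
    · intro b _
      simp only [← mul_assoc, ← C_mul]
      rw [← Finset.sum_mul, ← map_sum, smul_eq_C_mul, ← add_mul, ← C_add]
      simp
  rw [this]
  exact Ideal.sum_mem _ fun u hu =>
    Ideal.mul_mem_left _ _ (mem_LId (List.mem_map_of_mem (hTl u hu)))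

/-- normal-form monomials plus ideal -/
noncomputable def MM (J : Ideal (SS k n)) (ν : Fin k → ℕ) (e : Fin k → ℤ) : Submodule ℝ (SS k n) :=
  Submodule.span ℝ ((fun d => monomial d (1:ℝ)) '' DD ν e) ⊔ J.restrictScalars ℝ

lemma MM_good {J : Ideal (SS k n)} {ν : Fin k → ℕ} {e : Fin k → ℤ} {p : Sg k n}
    (hp : ν p.1 ≤ p.2) {v : SS k n} (hv : v ∈ MM J ν e) : X p * v ∈ MM J ν (e + Pi.single p.1 1) := by
  have : MM J ν e ≤ (MM J ν (e + Pi.single p.1 1)).comap (LinearMap.mulLeft ℝ (X p)) := by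
    refine sup_le ?_ ?_
    · rw [Submodule.span_le]
      rintro _ ⟨d, hd, rfl⟩
      refine Submodule.mem_sup_left (Submodule.subset_span ⟨Finsupp.single p 1 + d, ⟨?_, ?_⟩, ?_⟩)
      · rw [map_add, weight_single, hd.1, add_comm]
      · intro x hx
        rw [Finsupp.add_apply, hd.2 x hx, add_zero, Finsupp.single_eq_of_ne]
        rintro rfl
        omega
      · simp [X, monomial_mul]
    · intro u hu
      exact Submodule.mem_sup_right (Ideal.mul_mem_left J _ hu)
  exact this hv

lemma MM_X {l : List (Fin k × ℝ)} (h : (l.map Prod.snd).Nodup) {e : Fin k → ℤ} (p : Sg k n)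
    {v : SS k n} (hv : v ∈ MM (LId (l.map (LF n))) (cnt l) e) :
    X p * v ∈ MM (LId (l.map (LF n))) (cnt l) (e + Pi.single p.1 1) := by
  by_cases hp : cnt l p.1 ≤ p.2
  · exact MM_good hp hv
  · obtain ⟨c, hc⟩ := bad_var l h p.1 p.2 (by omega)
    have : X p * v = (X p - ∑ i' ∈ (Finset.univ : Finset (Fin (n+1))).filter (fun i' => cnt l p.1 ≤ i'.val), c i' • X (p.1, i')) * v +
        ∑ i' ∈ (Finset.univ : Finset (Fin (n+1))).filter (fun i' => cnt l p.1 ≤ i'.val), c i' • (X (p.1, i') * v) := by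
      rw [sub_mul, Finset.sum_mul]
      simp
    rw [this]
    refine Submodule.add_mem _ (Submodule.mem_sup_right (Ideal.mul_mem_right _ _ hc))
      (Submodule.sum_mem _ fun i' hi' => Submodule.smul_mem _ _ ?_)
    exact MM_good (p := (p.1, i')) (Finset.mem_filter.1 hi').2 hv

lemma MM_mon {l : List (Fin k × ℝ)} (h : (l.map Prod.snd).Nodup) (d : Sg k n →₀ ℕ) :
    ∀ (e : Fin k → ℤ) (v : SS k n) (_ : v ∈ MM (LId (l.map (LF n))) (cnt l) e),
    monomial d 1 * v ∈ MM (LId (l.map (LF n))) (cnt l) (e + Finsupp.weight wt d) := by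
  induction d using Finsupp.induction_linear with
  | zero => intro e v hv; simpa using hv
  | add f g hf hg =>
    intro e v hv
    have := hf _ _ (hg e v hv)
    rw [← mul_assoc, monomial_mul, one_mul, add_assoc, ← map_add, add_comm g f] at this
    exact this
  | single p a =>
    induction a with
    | zero => intro e v hv; simpa using hv
    | succ a ih =>
      intro e v hv
      have := MM_X h p (ih e v hv)
      have e1 : Finsupp.single p (a+1) = Finsupp.single p 1 + Finsupp.single p a := by
        rw [← Finsupp.single_add, add_comm]
      rw [add_assoc, ← weight_single, ← map_add, add_comm (Finsupp.single p a), ← e1] at this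
      rw [e1, ← one_mul (1:ℝ), ← monomial_mul, mul_assoc, ← e1]
      exact this

lemma HH_LF {l : List (Fin k × ℝ)} (h : (l.map Prod.snd).Nodup) (e : Fin k → ℤ) :
    (HH (LId (l.map (LF n))) e : ℤ) ≤ hh n (cnt l) e := by
  set J := LId (l.map (LF n))
  have h1 : RR e ≤ MM J (cnt l) e := by
    rw [RR_eq_span, Submodule.span_le]
    rintro _ ⟨d, rfl, rfl⟩
    have := MM_mon h d 0 1 (Submodule.mem_sup_left (Submodule.subset_span
      ⟨0, ⟨by simp, by simp⟩, by simp⟩))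
    simpa using this
  have hfd : FiniteDimensional ℝ (Submodule.span ℝ ((fun d => monomial d (1:ℝ)) '' (DD (cnt l) e : Set (Sg k n →₀ ℕ)))) :=
    FiniteDimensional.span_of_finite ℝ ((DD_finite _ _).image _)
  have h2 : (RR e).map (mkl J) ≤
      (Submodule.span ℝ ((fun d => monomial d (1:ℝ)) '' DD (cnt l) e)).map (mkl J) := by
    rintro _ ⟨u, hu, rfl⟩
    obtain ⟨a, ha, b, hb, rfl⟩ := Submodule.mem_sup.1 (h1 hu)
    refine ⟨a, ha, ?_⟩
    rw [map_add, mkl_eq_zero.2 hb, add_zero]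
  unfold HH hh
  refine Nat.cast_le.2 ((Submodule.finrank_mono h2).trans ((Submodule.finrank_map_le _ _).trans ?_))
  have := (DD_finite (n := n) (cnt l) e).fintype
  rw [Set.image_eq_range, Set.ncard_eq_toFinset_card', Set.toFinset_card]
  exact finrank_range_le_card _

end KRP


/-! ### Section 4: Hilbert functions of complete intersections -/
namespace KRP
open MvPolynomial Module
variable {k n : ℕ}

def dg : List (Fin k) → (Fin k → ℤ)
  | [] => 0
  | j :: l => dg l + Pi.single j 1

def tot : List (List (Fin k)) → (Fin k → ℤ)
  | [] => 0
  | δ :: l => tot l + dg δ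

lemma dg_nonneg : ∀ (l : List (Fin k)) (j : Fin k), 0 ≤ dg l j
  | [], _ => le_rfl
  | i :: l, j => by
    have := dg_nonneg l j
    have h2 : 0 ≤ (Pi.single i 1 : Fin k → ℤ) j := by
      by_cases h : j = i
      · subst h; simp
      · simp [h]
    simp only [dg, Pi.add_apply]; omega

lemma tot_nonneg : ∀ (l : List (List (Fin k))) (j : Fin k), 0 ≤ tot l j
  | [], _ => le_rfl
  | i :: l, j => by
    have := tot_nonneg l j
    have := dg_nonneg i j
    simp only [tot, Pi.add_apply]; omega

variable (n) in
noncomputable def Hilb : List (List (Fin k)) → (Fin k → ℕ) → (Fin k → ℤ) → ℤ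
  | [], ν, e => hh n ν e
  | δ :: ds, ν, e => Hilb ds ν e - Hilb ds ν (e - dg δ)

lemma Hilb_rec (ν : Fin k → ℕ) (j : Fin k) : ∀ (ds : List (List (Fin k))) (e : Fin k → ℤ)
    (_ : 2 + tot ds j ≤ e j),
    Hilb n ds (ν + Pi.single j 1) e = Hilb n ds ν e - Hilb n ds ν (e - Pi.single j 1)
  | [], e, h => hh_rec ν e j (by simpa [tot] using h)
  | δ :: ds, e, h => by
    have h0 := dg_nonneg δ j
    simp only [tot, Pi.add_apply] at h
    simp only [Hilb]
    rw [Hilb_rec ν j ds e (by omega), Hilb_rec ν j ds (e - dg δ) (by simp only [Pi.sub_apply]; omega),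
      sub_right_comm e (dg δ)]
    ring

def Big (ds : List (List (Fin k))) (e : Fin k → ℤ) : Prop := ∀ j, 2 + tot ds j ≤ e j

variable (n) in
noncomputable def SF (f : List (Fin k × ℝ)) : SS k n := (f.map (LF n)).prod

lemma SF_mem : ∀ f : List (Fin k × ℝ), SF n f ∈ RR (dg (f.map Prod.fst))
  | [] => isWeightedHomogeneous_one ℝ wt
  | x :: f => by
    have := (LF_mem (n := n) x).mul (SF_mem f)
    rw [add_comm] at this
    simpa [SF, dg, mem_RR] using this

lemma LId_append : ∀ (a b : List (SS k n)), LId (a ++ b) = LId a ⊔ LId b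
  | [], b => by simp [LId]
  | f :: a, b => by
    simp only [LId, List.cons_append, LId_append a b]
    rw [sup_right_comm]

lemma HomI_LId : ∀ (l : List (SS k n)) (_ : ∀ f ∈ l, ∃ δ, f ∈ RR δ), HomI (LId l)
  | [], _ => HomI_bot
  | f :: l, h => by
    obtain ⟨δ, hδ⟩ := h f (by simp)
    exact (HomI_LId l fun g hg => h g (by simp [hg])).sup hδ

lemma cnt_cons (x : Fin k × ℝ) (l : List (Fin k × ℝ)) : cnt (x :: l) = cnt l + Pi.single x.1 1 := by
  ext j
  by_cases h : x.1 = j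
  · subst h; simp [cnt]
  · simp [cnt, h]

noncomputable def JJ (l : List (Fin k × ℝ)) (fs : List (List (Fin k × ℝ))) : Ideal (SS k n) :=
  LId (fs.map (SF n)) ⊔ LId (l.map (LF n))

lemma HomI_JJ (l : List (Fin k × ℝ)) (fs : List (List (Fin k × ℝ))) : HomI (JJ (n := n) l fs) := by
  rw [JJ, ← LId_append]
  refine HomI_LId _ fun f hf => ?_
  rcases List.mem_append.1 hf with h | h
  · obtain ⟨x, _, rfl⟩ := List.mem_map.1 h
    exact ⟨_, SF_mem x⟩
  · obtain ⟨x, _, rfl⟩ := List.mem_map.1 h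
    exact ⟨_, LF_mem x⟩

lemma JJ_upper : ∀ (fs : List (List (Fin k × ℝ))) (l : List (Fin k × ℝ))
    (_ : ((l ++ fs.flatten).map Prod.snd).Nodup) (e : Fin k → ℤ)
    (_ : Big (fs.map (List.map Prod.fst)) e),
    (HH (JJ (n := n) l fs) e : ℤ) ≤ Hilb n (fs.map (List.map Prod.fst)) (cnt l) e
  | [], l, h, e, he => by
    simpa [JJ, LId, Hilb] using HH_LF (n := n) (l := l) (by simpa using h) e
  | f :: fs, l, h, e, he => by
    have ih := JJ_upper fs
    have inner : ∀ (f : List (Fin k × ℝ)) (e : Fin k → ℤ) (_ : ((l ++ (f :: fs).flatten).map Prod.snd).Nodup)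
        (_ : Big ((f :: fs).map (List.map Prod.fst)) e),
        (HH (JJ (n := n) l fs ⊔ Ideal.span {SF n f}) e : ℤ) ≤
          Hilb n (fs.map (List.map Prod.fst)) (cnt l) e -
          Hilb n (fs.map (List.map Prod.fst)) (cnt l) (e - dg (f.map Prod.fst)) := by
      intro f
      induction f with
      | nil =>
        intro e _ _
        have : JJ (n := n) l fs ⊔ Ideal.span {SF n []} = ⊤ := by simp [SF]
        rw [this, HH_top]
        simp [dg]
      | cons x g ihg =>
        intro e h he
        have h1 := HH_upper (HomI_JJ (n := n) l fs) (LF_mem x) (SF n g) e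
        have e1 : LF n x * SF n g = SF n (x :: g) := by simp [SF]
        have e2 : JJ (n := n) l fs ⊔ Ideal.span {LF n x} = JJ (x :: l) fs := by
          simp [JJ, LId, sup_assoc]
        rw [e1, e2] at h1
        have hx : ∀ j, 0 ≤ (Pi.single x.1 1 : Fin k → ℤ) j := by
          intro j
          have := dg_nonneg [x.1] j
          simpa [dg] using this
        have hgn := fun j => dg_nonneg (g.map Prod.fst) j
        have h2 := ih (x :: l) (by
          have hp : ((x :: (l ++ (g ++ fs.flatten))).map Prod.snd).Nodup := by
            refine (List.Perm.nodup_iff (List.Perm.map _ ?_)).1 h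
            simpa using List.perm_middle
          refine hp.sublist (List.Sublist.map _ ?_)
          simp) e (by
          intro j
          have := he j
          have := hx j
          have := hgn j
          simp only [List.map_cons, tot, dg, Pi.add_apply] at *
          omega)
        have h3 := ihg (e - Pi.single x.1 1) (by
          refine h.sublist (List.Sublist.map _ ?_)
          simp) (by
          intro j
          have := he j
          simp only [List.map_cons, tot, dg, Pi.add_apply, Pi.sub_apply] at *
          omega)
        rw [cnt_cons, Hilb_rec] at h2
        · simp only [List.map_cons, dg]
          rw [show e - Pi.single x.1 1 - dg (g.map Prod.fst) = e - (dg (g.map Prod.fst) + Pi.single x.1 1) by abel] at h3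
          have : (HH (JJ (n := n) l fs ⊔ Ideal.span {SF n (x :: g)}) e : ℤ) ≤ HH (JJ (n := n) (x :: l) fs) e
            + HH (JJ (n := n) l fs ⊔ Ideal.span {SF n g}) (e - Pi.single x.1 1) := by exact_mod_cast h1
          linarith
        · have := he x.1
          have := hx x.1
          have := hgn x.1
          simp only [List.map_cons, tot, dg, Pi.add_apply] at *
          omega
    have := inner f e h he
    have e3 : JJ (n := n) l fs ⊔ Ideal.span {SF n f} = JJ l (f :: fs) := by
      simp only [JJ, LId, List.map_cons]
      rw [sup_right_comm]
    rw [e3] at this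
    exact this

/-- the generating polynomial -/
noncomputable def GP (ds : List (List (Fin k))) : MvPolynomial (Fin k) ℤ :=
  (ds.map fun δ => (δ.map X).sum).prod

variable (k n) in
noncomputable def nn : Fin k →₀ ℕ := Finsupp.equivFunOnFinite.symm (fun _ => n)

lemma Hilb_value : ∀ (ds : List (List (Fin k))) (ν : Fin k → ℕ) (e : Fin k → ℤ)
    (_ : k * n ≤ ∑ j, ν j + ds.length) (_ : Big ds e),
    Hilb n ds ν e = coeff (nn k n) (monomial (Finsupp.equivFunOnFinite.symm ν) 1 * GP ds)
  | [], ν, e, h, he => by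
    simp only [Hilb, GP, List.map_nil, List.prod_nil, mul_one, coeff_monomial]
    simp only [List.length_nil, add_zero] at h
    by_cases hν : ∃ j, n < ν j
    · obtain ⟨j, hj⟩ := hν
      have := he j
      simp only [tot, Pi.zero_apply] at this
      rw [hh_zero hj (by omega), if_neg]
      intro h
      have := DFunLike.congr_fun h j
      simp [nn] at this
      omega
    · push Not at hν
      have h3 : ∀ j, ν j = n := by
        have h4 : ∑ j, ν j ≤ ∑ j : Fin k, n := Finset.sum_le_sum fun j _ => hν j
        have h5 : ∑ j : Fin k, n = k * n := by simp
        have h6 := (Finset.sum_eq_sum_iff_of_le fun j (_ : j ∈ Finset.univ) => hν j).1 (by omega)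
        exact fun j => h6 j (Finset.mem_univ j)
      rw [hh_one h3, if_pos]
      · rw [nn, (funext h3 : ν = fun _ => n)]
      · intro j
        have := he j
        simp only [tot, Pi.zero_apply] at this
        omega
  | δ :: ds, ν, e, h, he => by
    have inner : ∀ (δ : List (Fin k)) (e : Fin k → ℤ) (_ : Big (δ :: ds) e),
        Hilb n ds ν e - Hilb n ds ν (e - dg δ) =
        coeff (nn k n) (monomial (Finsupp.equivFunOnFinite.symm ν) 1 * ((δ.map X).sum * GP ds)) := by
      intro δ
      induction δ with
      | nil => intro e _; simp [dg]
      | cons j g ih =>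
        intro e he
        have hx : ∀ i, 0 ≤ (Pi.single j 1 : Fin k → ℤ) i := by
          intro i
          have := dg_nonneg [j] i
          simpa [dg] using this
        have hgn := fun i => dg_nonneg g i
        have h1 := ih (e - Pi.single j 1) (by
          intro i
          have := he i
          simp only [tot, dg, Pi.add_apply, Pi.sub_apply] at *
          omega)
        have hb : Big ds e := by
          intro i
          have := he i
          have := hx i
          have := hgn i
          simp only [tot, dg, Pi.add_apply] at *
          omega
        have h2 := Hilb_value ds (ν + Pi.single j 1) e (by
          simp only [Pi.add_apply, Finset.sum_add_distrib, Finset.sum_pi_single', Finset.mem_univ, if_true]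
          simp only [List.length_cons] at h
          omega) hb
        rw [Hilb_rec _ _ _ _ (hb j)] at h2
        have e1 : (monomial (Finsupp.equivFunOnFinite.symm (ν + Pi.single j 1)) (1:ℤ)) =
            monomial (Finsupp.equivFunOnFinite.symm ν) 1 * X j := by
          rw [X, monomial_mul, one_mul]
          have : Finsupp.equivFunOnFinite.symm (ν + Pi.single j 1) =
              Finsupp.equivFunOnFinite.symm ν + Finsupp.single j 1 := by
            ext i
            by_cases hi : i = j
            · subst hi; simp
            · simp [hi, Ne.symm hi]
          rw [this]
        rw [e1] at h2
        simp only [List.map_cons, List.sum_cons, dg, add_mul, mul_add, coeff_add]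
        rw [← mul_assoc (monomial _ _) (X j), ← h2, ← h1]
        rw [show e - Pi.single j 1 - dg g = e - (dg g + Pi.single j 1) by abel]
        ring
    have := inner δ e he
    simp only [Hilb, this, GP, List.map_cons, List.prod_cons]

end KRP


/-! ### Section 5: semicontinuity -/
namespace KRP
open MvPolynomial Module
variable {k n : ℕ}

abbrev Tr (k n : ℕ) := SS k n × SS k n × (Fin k → ℤ)

def TrOK (x : Tr k n) : Prop := x.1 ∈ RR x.2.2 ∧ x.2.1 ∈ RR x.2.2

noncomputable def Ts (s : ℝ) (x : Tr k n) : SS k n := x.1 + s • x.2.1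

lemma Ts_mem {x : Tr k n} (h : TrOK x) (s : ℝ) : Ts s x ∈ RR x.2.2 :=
  Submodule.add_mem _ h.1 (Submodule.smul_mem _ _ h.2)

lemma span_LId (s : ℝ) : ∀ (T : List (Tr k n)) (_ : ∀ x ∈ T, TrOK x) (e : Fin k → ℤ) (u : SS k n)
    (_ : u ∈ RR e) (_ : u ∈ LId (T.map (Ts s))),
    u ∈ Submodule.span ℝ {y | ∃ x ∈ T, ∃ m ∈ RR (e - x.2.2), y = m * Ts s x}
  | [], _, e, u, _, h => by
    have : u = 0 := h
    rw [this]; exact Submodule.zero_mem _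
  | x :: T, hT, e, u, hu, h => by
    have hx := hT x (by simp)
    have hJ : HomI (LId (T.map (Ts s))) := HomI_LId _ fun f hf => by
      obtain ⟨y, hy, rfl⟩ := List.mem_map.1 hf
      exact ⟨_, Ts_mem (hT y (by simp [hy])) s⟩
    obtain ⟨u', hu', h'⟩ := hJ.mem_sup (Ts_mem hx s) hu h
    have h1 : u - Ts s x * u' ∈ RR e := by
      refine Submodule.sub_mem _ hu ?_
      have := IsWeightedHomogeneous.mul (Ts_mem hx s) hu'
      rw [add_sub_cancel] at this
      exact this
    have h2 := span_LId s T (fun y hy => hT y (by simp [hy])) e _ h1 h'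
    have : u = (u - Ts s x * u') + u' * Ts s x := by ring
    rw [this]
    refine Submodule.add_mem _ (Submodule.span_mono ?_ h2) (Submodule.subset_span ⟨x, by simp, u', hu', rfl⟩)
    rintro y ⟨z, hz, m, hm, rfl⟩
    exact ⟨z, by simp [hz], m, hm, rfl⟩

lemma semicont (T : List (Tr k n)) (hT : ∀ x ∈ T, TrOK x) (e : Fin k → ℤ) :
    {s : ℝ | HH (LId (T.map (Ts 0))) e < HH (LId (T.map (Ts s))) e}.Finite := by
  let ι := {p : Tr k n × SS k n // p.1 ∈ T ∧ p.2 ∈ RR (e - p.1.2.2)}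
  let v : ι → SS k n := fun p => p.1.2 * p.1.1.1
  let w : ι → SS k n := fun p => p.1.2 * p.1.1.2.1
  have hvw : ∀ (s : ℝ) (p : ι), v p + s • w p ∈ RR e ⊓ LinearMap.ker (mkl (LId (T.map (Ts s)))) := by
    rintro s ⟨⟨x, m⟩, hx, hm⟩
    have e1 : v ⟨⟨x, m⟩, hx, hm⟩ + s • w ⟨⟨x, m⟩, hx, hm⟩ = m * Ts s x := by
      simp [v, w, Ts, mul_add]
    rw [e1]
    refine ⟨?_, ?_⟩
    · have := IsWeightedHomogeneous.mul hm (Ts_mem (hT x hx) s)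
      simp only [sub_add_cancel] at this
      exact this
    · exact mkl_eq_zero.2 (Ideal.mul_mem_left _ _ (mem_LId (List.mem_map_of_mem hx)))
  have fd : ∀ J : Ideal (SS k n), FiniteDimensional ℝ (RR e ⊓ LinearMap.ker (mkl J) : Submodule ℝ (SS k n)) :=
    fun J => Submodule.finiteDimensional_of_le inf_le_left
  obtain ⟨κ, a, ha, hspan, hli⟩ := exists_linearIndependent' ℝ v
  have hsub : Submodule.span ℝ (Set.range (v ∘ a)) ≤ RR e := by
    rw [hspan, Submodule.span_le]
    rintro _ ⟨p, rfl⟩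
    have := (hvw 0 p).1
    simpa using this
  have hfd : FiniteDimensional ℝ (Submodule.span ℝ (Set.range (v ∘ a))) := Submodule.finiteDimensional_of_le hsub
  have hκ : Finite κ := by
    have := (LinearIndependent.finite (R := ℝ) (linearIndependent_span hli))
    exact this
  have := Fintype.ofFinite κ
  have hcard : finrank ℝ (RR e ⊓ LinearMap.ker (mkl (LId (T.map (Ts 0)))) : Submodule ℝ (SS k n)) ≤ Fintype.card κ := by
    rw [← finrank_span_eq_card hli]
    refine Submodule.finrank_mono ?_
    rintro u ⟨hu, hk⟩
    have := span_LId 0 T hT e u hu (mkl_eq_zero.1 hk)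
    rw [hspan]
    refine Submodule.span_mono ?_ this
    rintro y ⟨x, hx, m, hm, rfl⟩
    exact ⟨⟨(x, m), hx, hm⟩, by simp [v, Ts]⟩
  refine (linind_perturb (v ∘ a) (w ∘ a) hli).subset ?_
  intro s hs hLI
  have h1 : Fintype.card κ ≤ finrank ℝ (RR e ⊓ LinearMap.ker (mkl (LId (T.map (Ts s)))) : Submodule ℝ (SS k n)) := by
    rw [← finrank_span_eq_card hLI]
    refine Submodule.finrank_mono ?_
    rw [Submodule.span_le]
    rintro _ ⟨i, rfl⟩
    exact hvw s (a i)
  have r0 := rank_null (RR e) (mkl (LId (T.map (Ts 0))))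
  have rs := rank_null (RR e) (mkl (LId (T.map (Ts s))))
  simp only [Set.mem_ofPred_eq, HH] at hs
  omega

/-- choose distinct nonzero parameters -/
lemma exists_params {α : Type*} : ∀ (G : List (List (Fin k) × α)) (c : ℝ),
    ∃ Q : List (List (Fin k × ℝ) × α), Q.map (fun x => (x.1.map Prod.fst, x.2)) = G ∧
      ((Q.map Prod.fst).flatten.map Prod.snd).Nodup ∧ ∀ x ∈ (Q.map Prod.fst).flatten, c < x.2
  | [], c => ⟨[], by simp⟩
  | (δ, g) :: G, c => by
    have h : ∀ (δ : List (Fin k)) (c : ℝ), ∃ (f : List (Fin k × ℝ)) (M : ℝ), f.map Prod.fst = δ ∧ (f.map Prod.snd).Nodup ∧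
        (∀ x ∈ f, c < x.2 ∧ x.2 ≤ M) ∧ c ≤ M := by
      intro δ
      induction δ with
      | nil => intro c; exact ⟨[], c, by simp⟩
      | cons j δ ih =>
        intro c
        obtain ⟨f, M, h1, h2, h3, h4⟩ := ih (c+1)
        refine ⟨(j, c+1) :: f, M, by simp [h1], ?_, ?_, by linarith⟩
        · rw [List.map_cons, List.nodup_cons]
          refine ⟨?_, h2⟩
          intro h
          obtain ⟨x, hx, e⟩ := List.mem_map.1 h
          have := (h3 x hx).1
          simp only at e
          linarith
        · intro x hx
          rcases List.mem_cons.1 hx with rfl | hx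
          · exact ⟨by simp, h4⟩
          · have := h3 x hx
            exact ⟨by linarith, this.2⟩
    obtain ⟨f, M, h1, h2, h3, h4⟩ := h δ c
    obtain ⟨Q, q1, q2, q3⟩ := exists_params G M
    refine ⟨(f, g) :: Q, by simp [q1, h1], ?_, ?_⟩
    · rw [List.map_cons, List.flatten_cons, List.map_append, List.nodup_append]
      refine ⟨h2, q2, ?_⟩
      intro a ha b hb
      obtain ⟨x, hx, rfl⟩ := List.mem_map.1 ha
      obtain ⟨y, hy, rfl⟩ := List.mem_map.1 hb
      have := (h3 x hx).2
      have := q3 y hy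
      intro h
      linarith
    · intro x hx
      rw [List.map_cons, List.flatten_cons, List.mem_append] at hx
      rcases hx with hx | hx
      · exact (h3 x hx).1
      · have := q3 x hx
        linarith

abbrev Qt (k n : ℕ) := List (Fin k × ℝ) × SS k n

variable (n) in
noncomputable def trip (x : Qt k n) : Tr k n := (SF n x.1, x.2, dg (x.1.map Prod.fst))

def QOK (x : Qt k n) : Prop := x.2 ∈ RR (dg (x.1.map Prod.fst))

lemma trip_ok {x : Qt k n} (h : QOK x) : TrOK (trip n x) := ⟨SF_mem _, h⟩

noncomputable def Qs (s : ℝ) (Q : List (Qt k n)) : List (SS k n) := (Q.map (trip n)).map (Ts s)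

def dQ (Q : List (Qt k n)) : List (List (Fin k)) := Q.map (fun x => x.1.map Prod.fst)

lemma Qs_zero (Q : List (Qt k n)) : Qs 0 Q = (Q.map Prod.fst).map (SF n) := by
  simp [Qs, Ts, trip, Function.comp_def]

lemma dQ_eq (Q : List (Qt k n)) : dQ Q = (Q.map Prod.fst).map (List.map Prod.fst) := by
  simp [dQ]

lemma LF_zero (j : Fin k) : LF n (j, 0) = X (j, 0) := by
  rw [LF, Finset.sum_eq_single 0]
  · simp
  · intro b _ hb
    have : (b : ℕ) ≠ 0 := fun h => hb (Fin.ext h)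
    simp [this]
  · simp

lemma generic_countable (Q : List (Qt k n)) (hQ : ∀ x ∈ Q, QOK x) : ∃ B : Set ℝ, B.Countable ∧
    ∀ s ∉ B, (∀ i e, HH (LId (Qs s (Q.drop i))) e ≤ HH (LId (Qs 0 (Q.drop i))) e) ∧
      ∀ (j : Fin k) e, HH (LId (Qs s Q) ⊔ Ideal.span {X (j, 0)}) e ≤ HH (LId (Qs 0 Q) ⊔ Ideal.span {X (j,0)}) e := by
  have hT : ∀ i, ∀ x ∈ (Q.drop i).map (trip n), TrOK x := by
    intro i x hx
    obtain ⟨y, hy, rfl⟩ := List.mem_map.1 hx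
    exact trip_ok (hQ y (List.mem_of_mem_drop hy))
  have hT2 : ∀ j : Fin k, ∀ x ∈ ((X (j,0), 0, Pi.single j 1) : Tr k n) :: Q.map (trip n), TrOK x := by
    intro j x hx
    rcases List.mem_cons.1 hx with rfl | hx
    · exact ⟨X_mem (j, 0), Submodule.zero_mem _⟩
    · exact hT 0 x (by simpa using hx)
  refine ⟨(⋃ (i : ℕ) (e : Fin k → ℤ), {s : ℝ | HH (LId (Qs 0 (Q.drop i))) e < HH (LId (Qs s (Q.drop i))) e}) ∪
    ⋃ (j : Fin k) (e : Fin k → ℤ), {s : ℝ | HH (LId (Qs 0 Q) ⊔ Ideal.span {X (j,0)}) e <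
      HH (LId (Qs s Q) ⊔ Ideal.span {X (j,0)}) e}, ?_, ?_⟩
  · refine Set.Countable.union ?_ ?_
    · exact Set.countable_iUnion fun i => Set.countable_iUnion fun e => (semicont _ (hT i) e).countable
    · refine Set.countable_iUnion fun j => Set.countable_iUnion fun e => ?_
      have := (semicont _ (hT2 j) e).countable
      simpa [LId, Ts, Qs] using this
  · intro s hs
    simp only [Set.mem_union, Set.mem_iUnion, Set.mem_ofPred_eq, not_or, not_exists, not_lt] at hs
    exact hs

lemma generic_dim (s : ℝ) : ∀ (Q : List (Qt k n)) (_ : ∀ x ∈ Q, QOK x)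
    (_ : ((Q.map Prod.fst).flatten.map Prod.snd).Nodup)
    (_ : ∀ i e, HH (LId (Qs s (Q.drop i))) e ≤ HH (LId (Qs 0 (Q.drop i))) e)
    (e : Fin k → ℤ) (_ : Big (dQ Q) e), (HH (LId (Qs s Q)) e : ℤ) = Hilb n (dQ Q) 0 e
  | [], _, _, _, e, _ => by simpa [Qs, LId, dQ, Hilb] using HH_bot e
  | x :: Q, hQ, hnd, hle, e, he => by
    have hd := fun j => dg_nonneg (x.1.map Prod.fst) j
    have ih := generic_dim s Q (fun y hy => hQ y (by simp [hy]))
      (hnd.sublist (List.Sublist.map _ (by simp)))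
      (fun i e => by simpa using hle (i+1) e)
    apply le_antisymm
    · have h1 := hle 0 e
      have h2 := JJ_upper (n := n) ((x :: Q).map Prod.fst) [] (by simpa using hnd) e (by rw [← dQ_eq]; exact he)
      rw [← dQ_eq] at h2
      have e1 : (JJ (n := n) [] ((x :: Q).map Prod.fst)) = LId (Qs 0 (x :: Q)) := by
        rw [Qs_zero, JJ]; simp [LId]
      rw [e1] at h2
      have e2 : cnt ([] : List (Fin k × ℝ)) = 0 := by ext j; simp [cnt]
      rw [e2] at h2
      rw [List.drop_zero] at h1
      exact le_trans (by exact_mod_cast h1) h2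
    · have hJ : HomI (LId (Qs s Q)) := HomI_LId _ fun f hf => by
        obtain ⟨y, hy, rfl⟩ := List.mem_map.1 hf
        obtain ⟨z, hz, rfl⟩ := List.mem_map.1 hy
        exact ⟨_, Ts_mem (trip_ok (hQ z (by simp [hz]))) s⟩
      have h1 := HH_lower hJ (Ts_mem (trip_ok (hQ x (by simp))) s) e
      have h2 := ih e (by
        intro j
        have := he j
        have := hd j
        simp only [dQ, List.map_cons, tot, Pi.add_apply] at *
        omega)
      have h3 := ih (e - dg (x.1.map Prod.fst)) (by
        intro j
        have := he j
        simp only [dQ, List.map_cons, tot, Pi.add_apply, Pi.sub_apply] at *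
        omega)
      have h4 : Hilb n (dQ (x :: Q)) 0 e = Hilb n (dQ Q) 0 e - Hilb n (dQ Q) 0 (e - dg (x.1.map Prod.fst)) := rfl
      rw [h4, ← h2, ← h3]
      have h5 : LId (Qs s (x :: Q)) = LId (Qs s Q) ⊔ Ideal.span {Ts s (trip n x)} := rfl
      rw [h5]
      simp only [trip] at h1 ⊢
      have : (HH (LId (Qs s Q)) e : ℤ) ≤ HH (LId (Qs s Q) ⊔ Ideal.span {Ts s (SF n x.1, x.2, dg (x.1.map Prod.fst))}) e
        + HH (LId (Qs s Q)) (e - dg (x.1.map Prod.fst)) := by exact_mod_cast h1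
      linarith

lemma GP_homog : ∀ ds : List (List (Fin k)), (GP ds).IsHomogeneous ds.length
  | [] => isHomogeneous_one _ _
  | δ :: ds => by
    have h1 : ∀ δ : List (Fin k), ((δ.map X).sum : MvPolynomial (Fin k) ℤ).IsHomogeneous 1 := by
      intro δ
      induction δ with
      | nil => exact isHomogeneous_zero _ _ _
      | cons j δ ih => exact (isHomogeneous_X _ j).add ih
    have := (h1 δ).mul (GP_homog ds)
    rw [List.length_cons, add_comm]
    exact this

theorem generic_main (G : List (List (Fin k) × SS k n)) (hG : ∀ x ∈ G, x.2 ∈ RR (dg x.1))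
    (hlen : G.length = k * n) :
    ∃ (Q : List (Qt k n)) (B : Set ℝ), B.Countable ∧ Q.map (fun x => (x.1.map Prod.fst, x.2)) = G ∧
    ∀ s ∉ B, ∀ e, Big (G.map Prod.fst) e →
      (HH (LId (Qs s Q)) e : ℤ) = coeff (nn k n) (GP (G.map Prod.fst)) ∧
      ∀ j : Fin k, HH (LId (Qs s Q) ⊔ Ideal.span {X (j,0)}) e = 0 := by
  obtain ⟨Q, h1, h2, h3⟩ := exists_params G 0
  have hQ : ∀ x ∈ Q, QOK x := by
    intro x hx
    have := hG (x.1.map Prod.fst, x.2) (by rw [← h1]; exact List.mem_map_of_mem hx)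
    exact this
  have hd : dQ Q = G.map Prod.fst := by
    rw [← h1]; simp [dQ]
  have hl : (dQ Q).length = k * n := by rw [hd, List.length_map, hlen]
  obtain ⟨B, hB, hB2⟩ := generic_countable Q hQ
  refine ⟨Q, B, hB, h1, fun s hs e he => ?_⟩
  obtain ⟨g1, g2⟩ := hB2 s hs
  rw [← hd] at he ⊢
  refine ⟨?_, fun j => ?_⟩
  · rw [generic_dim s Q hQ h2 g1 e he, Hilb_value _ _ _ (by omega) he]
    have : Finsupp.equivFunOnFinite.symm (0 : Fin k → ℕ) = 0 := by ext; simp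
    rw [this]
    simp
  · have u := JJ_upper (n := n) (Q.map Prod.fst) [(j, 0)] (by
      simp only [List.singleton_append, List.map_cons, List.nodup_cons]
      refine ⟨?_, h2⟩
      intro h
      obtain ⟨y, hy, e⟩ := List.mem_map.1 h
      have := h3 y hy
      linarith) e (by rw [← dQ_eq]; exact he)
    have e1 : (JJ (n := n) [(j,0)] (Q.map Prod.fst)) = LId (Qs 0 Q) ⊔ Ideal.span {X (j,0)} := by
      rw [Qs_zero, JJ]; simp [LId, LF_zero]
    rw [e1, ← dQ_eq, Hilb_value _ _ _ (by omega) he] at u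
    have hz : coeff (nn k n) (monomial (Finsupp.equivFunOnFinite.symm (cnt [(j, (0:ℝ))])) 1 * GP (dQ Q)) = 0 := by
      have hm := (isHomogeneous_monomial (R := ℤ) (n := 1) 1 (d := Finsupp.equivFunOnFinite.symm (cnt [(j, (0:ℝ))])) (by
        rw [Finsupp.degree_eq_sum]
        simp [cnt_cons, cnt, Pi.single_apply])).mul (GP_homog (dQ Q))
      refine hm.coeff_eq_zero ?_
      rw [Finsupp.degree_eq_sum]
      simp [nn, hl]
    rw [hz] at u
    have := g2 j e
    omega

end KRP


/-! ### Section 6: common eigenvectors and real zeros -/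
namespace KRP
open MvPolynomial Module
variable {k n : ℕ}

lemma odd_root (P : Polynomial ℝ) (hm : P.Monic) (ho : Odd P.natDegree) : ∃ x, P.IsRoot x := by
  have hd : 0 < P.natDegree := ho.pos
  have h1 : Filter.Tendsto (fun x => P.eval x) Filter.atTop Filter.atTop :=
    P.tendsto_atTop_of_leadingCoeff_nonneg (Polynomial.natDegree_pos_iff_degree_pos.1 hd)
      (by rw [hm.leadingCoeff]; norm_num)
  have h2 : Filter.Tendsto (fun x => (P.comp (-Polynomial.X)).eval x) Filter.atTop Filter.atBot := by
    refine Polynomial.tendsto_atBot_of_leadingCoeff_nonpos _ ?_ ?_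
    · rw [← Polynomial.natDegree_pos_iff_degree_pos, Polynomial.natDegree_comp]
      simpa using hd
    · rw [Polynomial.leadingCoeff_comp (by simp), hm.leadingCoeff]
      simp [ho.neg_one_pow]
  have h3 : Filter.Tendsto (fun x => P.eval x) Filter.atBot Filter.atBot := by
    have := h2.comp Filter.tendsto_neg_atBot_atTop
    refine this.congr fun x => ?_
    simp
  obtain ⟨x, hx⟩ := P.continuous.surjective h1 h3 0
  exact ⟨x, hx⟩

lemma odd_eigen {V : Type*} [AddCommGroup V] [Module ℝ V] [FiniteDimensional ℝ V] (T : V →ₗ[ℝ] V)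
    (h : Odd (finrank ℝ V)) : ∃ (c : ℝ) (v : V), v ≠ 0 ∧ T v = c • v := by
  obtain ⟨c, hc⟩ := odd_root T.charpoly T.charpoly_monic (by rw [LinearMap.charpoly_natDegree]; exact h)
  have := (Module.End.hasEigenvalue_iff_isRoot_charpoly T c).2 hc
  obtain ⟨v, hv⟩ := this.exists_hasEigenvector
  exact ⟨c, v, hv.2, hv.apply_eq_smul⟩

lemma common_eigen {V ι : Type*} [AddCommGroup V] [Module ℝ V] [FiniteDimensional ℝ V]
    (T : ι → V →ₗ[ℝ] V) (hc : ∀ a b v, T a (T b v) = T b (T a v)) :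
    ∀ (N : ℕ) (U : Submodule ℝ V) (_ : finrank ℝ U = N) (_ : Odd N) (_ : ∀ a, ∀ u ∈ U, T a u ∈ U),
      ∃ w ∈ U, w ≠ 0 ∧ ∀ a, ∃ c : ℝ, T a w = c • w := by
  intro N
  induction N using Nat.strong_induction_on with
  | _ N ih =>
    intro U hN hodd hinv
    by_cases hs : ∀ a, ∃ c : ℝ, ∀ u ∈ U, T a u = c • u
    · have : U ≠ ⊥ := by
        rintro rfl
        rw [finrank_bot] at hN
        subst hN
        simp at hodd
      obtain ⟨w, hw, hw0⟩ := Submodule.exists_mem_ne_zero_of_ne_bot this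
      exact ⟨w, hw, hw0, fun a => (hs a).imp fun c h => h w hw⟩
    · push Not at hs
      obtain ⟨a, ha⟩ := hs
      obtain ⟨c, v, hv0, hv⟩ := odd_eigen ((T a).restrict (hinv a)) (by rw [hN]; exact hodd)
      have hv' : T a v = c • (v : V) := by simpa using congrArg Subtype.val hv
      let D : V →ₗ[ℝ] V := T a - c • LinearMap.id
      have hD : ∀ u, D u = T a u - c • u := fun u => rfl
      have hDinv : ∀ b u, D (T b u) = T b (D u) := by
        intro b u
        rw [hD, hD, map_sub, map_smul, hc]
      have hrn := rank_null U D
      obtain ⟨u1, hu1, hu2⟩ := ha c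
      have hK : finrank ℝ (U ⊓ LinearMap.ker D : Submodule ℝ V) < N := by
        rw [← hN]
        refine Submodule.finrank_lt_finrank_of_lt (lt_of_le_of_ne inf_le_left ?_)
        intro h
        have : u1 ∈ U ⊓ LinearMap.ker D := by rw [h]; exact hu1
        apply hu2
        have h2 : u1 ∈ LinearMap.ker D := this.2
        rw [LinearMap.mem_ker, hD, sub_eq_zero] at h2
        exact h2
      have hK0 : 0 < finrank ℝ (U ⊓ LinearMap.ker D : Submodule ℝ V) := by
        rw [Module.finrank_pos_iff_exists_ne_zero]
        refine ⟨⟨v, v.2, ?_⟩, ?_⟩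
        · change D v = 0
          rw [hD, hv', sub_self]
        · intro h
          apply hv0
          ext
          exact congrArg (fun z : (U ⊓ LinearMap.ker D : Submodule ℝ V) => (z : V)) h
      by_cases hKo : Odd (finrank ℝ (U ⊓ LinearMap.ker D : Submodule ℝ V))
      · obtain ⟨w, hw, h⟩ := ih _ hK (U ⊓ LinearMap.ker D) rfl hKo (by
          rintro b u ⟨h1, h2⟩
          refine ⟨hinv b u h1, ?_⟩
          have h2' : D u = 0 := h2
          change D (T b u) = 0
          rw [hDinv, h2', map_zero])
        exact ⟨w, hw.1, h⟩
      · have hRo : Odd (finrank ℝ (U.map D)) := by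
          rw [← hN, ← hrn] at hodd
          rw [Nat.not_odd_iff_even] at hKo
          exact (Nat.odd_add'.1 (by rwa [add_comm] at hodd)).2 hKo
        obtain ⟨w, hw, h⟩ := ih _ (by omega) (U.map D) rfl hRo (by
          rintro b _ ⟨u, hu, rfl⟩
          exact ⟨T b u, hinv b u hu, hDinv b u⟩)
        obtain ⟨u, hu, rfl⟩ := hw
        refine ⟨D u, ?_, h⟩
        rw [hD]
        exact Submodule.sub_mem _ (hinv a u hu) (Submodule.smul_mem _ _ hu)

section zero
variable {J : Ideal (SS k n)} {e0 : Fin k → ℤ} {N : ℕ}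

lemma mul_mem_RR {a b : Fin k → ℤ} {f g : SS k n} (hf : f ∈ RR a) (hg : g ∈ RR b) : f * g ∈ RR (a + b) :=
  IsWeightedHomogeneous.mul hf hg

lemma le_shift {e : Fin k → ℤ} (he : e0 ≤ e) (j : Fin k) : e0 ≤ e + Pi.single j 1 := by
  refine he.trans ?_
  intro i
  have := dg_nonneg [j] i
  simp only [dg, zero_add] at this
  simp only [Pi.add_apply]
  omega

lemma surj_step (hJ : HomI J)
    (hz : ∀ e, e0 ≤ e → ∀ j : Fin k, HH (J ⊔ Ideal.span {X (j,0)}) e = 0)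
    {e : Fin k → ℤ} (he : e0 ≤ e) (j : Fin k) {u : SS k n} (hu : u ∈ RR (e + Pi.single j 1)) :
    ∃ u' ∈ RR e, u - X (j,0) * u' ∈ J := by
  have h0 := hz _ (le_shift he j) j
  have h1 : u ∈ J ⊔ Ideal.span {X (j,0)} := by
    unfold HH at h0
    rw [Submodule.finrank_eq_zero] at h0
    have : mkl (J ⊔ Ideal.span {X (j,0)}) u ∈ (RR (e + Pi.single j 1)).map (mkl (J ⊔ Ideal.span {X (j,0)})) := ⟨u, hu, rfl⟩
    rw [h0] at this
    exact mkl_eq_zero.1 this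
  obtain ⟨u', hu', h⟩ := hJ.mem_sup (X_mem (j, 0)) hu h1
  refine ⟨u', ?_, h⟩
  simpa using hu'

lemma inj_step (hJ : HomI J)
    (hdim : ∀ e, e0 ≤ e → HH J e = N)
    (hz : ∀ e, e0 ≤ e → ∀ j : Fin k, HH (J ⊔ Ideal.span {X (j,0)}) e = 0)
    {e : Fin k → ℤ} (he : e0 ≤ e) (j : Fin k) {u : SS k n} (hu : u ∈ RR e)
    (h : X (j,0) * u ∈ J) : u ∈ J := by
  let φ : SS k n →ₗ[ℝ] (SS k n ⧸ J) := mkl J ∘ₗ LinearMap.mulLeft ℝ (X (j,0))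
  have h1 : (RR e).map φ = (RR (e + Pi.single j 1)).map (mkl J) := by
    apply le_antisymm
    · rintro _ ⟨u, hu, rfl⟩
      refine ⟨X (j,0) * u, ?_, rfl⟩
      rw [add_comm]
      exact mul_mem_RR (X_mem (j,0)) hu
    · rintro _ ⟨u, hu, rfl⟩
      obtain ⟨u', hu', h⟩ := surj_step hJ hz he j hu
      refine ⟨u', hu', ?_⟩
      rw [← sub_eq_zero, ← neg_eq_zero, neg_sub, LinearMap.comp_apply, ← map_sub]
      exact mkl_eq_zero.2 h
  have r1 := rank_null (RR e) φ
  have r2 := rank_null (RR e) (mkl J)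
  have d1 := hdim e he
  have d2 := hdim _ (le_shift he j)
  unfold HH at d1 d2
  rw [h1, d2] at r1
  rw [d1] at r2
  have hfd : FiniteDimensional ℝ (RR e ⊓ LinearMap.ker φ : Submodule ℝ (SS k n)) :=
    Submodule.finiteDimensional_of_le inf_le_left
  have hle : RR e ⊓ LinearMap.ker (mkl J) ≤ RR e ⊓ LinearMap.ker φ := by
    rintro u ⟨hu, hk⟩
    exact ⟨hu, mkl_eq_zero.2 (Ideal.mul_mem_left _ _ (mkl_eq_zero.1 hk))⟩
  have heq := Submodule.eq_of_le_of_finrank_le hle (by omega)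
  have : u ∈ RR e ⊓ LinearMap.ker φ := ⟨hu, mkl_eq_zero.2 h⟩
  rw [← heq] at this
  exact mkl_eq_zero.1 this.2

/-- elements acting injectively -/
def injS (J : Ideal (SS k n)) (e0 : Fin k → ℤ) : Submonoid (SS k n) where
  carrier := {g | ∀ e, e0 ≤ e → ∀ u ∈ RR e, u ∉ J → ∃ e', e0 ≤ e' ∧ g * u ∈ RR e' ∧ g * u ∉ J}
  one_mem' := by
    intro e he u hu hn
    exact ⟨e, he, by simpa using hu, by simpa using hn⟩
  mul_mem' := by
    intro a b ha hb e he u hu hn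
    obtain ⟨e1, h1, h2, h3⟩ := hb e he u hu hn
    obtain ⟨e2, h4, h5, h6⟩ := ha e1 h1 _ h2 h3
    exact ⟨e2, h4, by rwa [mul_assoc], by rwa [mul_assoc]⟩

lemma X_injS (hJ : HomI J)
    (hdim : ∀ e, e0 ≤ e → HH J e = N)
    (hz : ∀ e, e0 ≤ e → ∀ j : Fin k, HH (J ⊔ Ideal.span {X (j,0)}) e = 0)
    (j : Fin k) : (X (j,0) : SS k n) ∈ injS J e0 := by
  intro e he u hu hn
  refine ⟨e + Pi.single j 1, le_shift he j, ?_, fun h => hn (inj_step hJ hdim hz he j hu h)⟩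
  rw [add_comm]
  exact mul_mem_RR (X_mem (j,0)) hu

lemma exists_op (hJ : HomI J)
    (hdim : ∀ e, e0 ≤ e → HH J e = N)
    (hz : ∀ e, e0 ≤ e → ∀ j : Fin k, HH (J ⊔ Ideal.span {X (j,0)}) e = 0)
    {e : Fin k → ℤ} (he : e0 ≤ e) (p : Sg k n) :
    ∃ T : ((RR e).map (mkl J)) →ₗ[ℝ] ((RR e).map (mkl J)), ∀ v,
      mkl J (X (p.1, 0)) * (T v : SS k n ⧸ J) = mkl J (X p) * v := by
  have hmap : ∀ i : Fin (n+1), ∀ v ∈ (RR e).map (mkl J), LinearMap.mulLeft ℝ (mkl J (X (p.1, i))) v ∈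
      (RR (e + Pi.single p.1 1)).map (mkl J) := by
    rintro i _ ⟨u, hu, rfl⟩
    refine ⟨X (p.1, i) * u, ?_, ?_⟩
    · rw [add_comm]
      exact mul_mem_RR (X_mem (p.1, i)) hu
    · exact map_mul (Ideal.Quotient.mkₐ ℝ J) _ _
  let M : Fin (n+1) → ((RR e).map (mkl J)) →ₗ[ℝ] ((RR (e + Pi.single p.1 1)).map (mkl J)) :=
    fun i => (LinearMap.mulLeft ℝ (mkl J (X (p.1, i)))).restrict (hmap i)
  have hM : ∀ i v, (M i v : SS k n ⧸ J) = mkl J (X (p.1, i)) * v := fun i v => rfl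
  have hinj : Function.Injective (M 0) := by
    rw [← LinearMap.ker_eq_bot, LinearMap.ker_eq_bot']
    rintro ⟨_, u, hu, rfl⟩ h
    have h' : mkl J (X (p.1,0) * u) = 0 := by
      have := congrArg Subtype.val h
      rw [hM] at this
      exact (map_mul (Ideal.Quotient.mkₐ ℝ J) _ _).trans this
    have := inj_step hJ hdim hz he p.1 hu (mkl_eq_zero.1 h')
    ext
    exact mkl_eq_zero.2 this
  let E := LinearEquiv.ofInjectiveOfFinrankEq (M 0) hinj
    ((hdim e he).trans (hdim _ (le_shift he p.1)).symm)
  refine ⟨E.symm.toLinearMap ∘ₗ M p.2, fun v => ?_⟩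
  rw [← hM 0, ← hM p.2 v]
  congr 1
  exact E.apply_symm_apply (M p.2 v)

theorem exists_zero (hJ : HomI J)
    (hdim : ∀ e, e0 ≤ e → HH J e = N)
    (hz : ∀ e, e0 ≤ e → ∀ j : Fin k, HH (J ⊔ Ideal.span {X (j,0)}) e = 0)
    (hN : Odd N) : ∃ c : Sg k n → ℝ, (∀ j, c (j, 0) = 1) ∧
    ∀ δ, ∀ f ∈ J, f ∈ RR δ → eval c f = 0 := by
  choose T hT using fun p => exists_op hJ hdim hz le_rfl p
  have hmm : ∀ a b : SS k n, mkl J (a * b) = mkl J a * mkl J b :=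
    fun a b => map_mul (Ideal.Quotient.mkₐ ℝ J) a b
  have hinj : ∀ g ∈ injS J e0, ∀ v ∈ (RR e0).map (mkl J), mkl J g * v = 0 → v = 0 := by
    rintro g hg _ ⟨u, hu, rfl⟩ h
    by_contra hne
    obtain ⟨e', _, _, h3⟩ := hg e0 le_rfl u hu (fun h' => hne (mkl_eq_zero.2 h'))
    apply h3
    rw [← mkl_eq_zero, hmm]
    exact h
  have hXS := fun j => X_injS hJ hdim hz j
  have hcomm : ∀ a b v, T a (T b v) = T b (T a v) := by
    intro a b v
    ext
    rw [← sub_eq_zero]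
    refine hinj (X (a.1,0) * X (b.1,0)) (mul_mem (hXS _) (hXS _)) _
      (Submodule.sub_mem _ (T a (T b v)).2 (T b (T a v)).2) ?_
    rw [hmm, mul_sub, sub_eq_zero]
    have h1 : mkl J (X (a.1, 0)) * mkl J (X (b.1, 0)) * (T a (T b v) : SS k n ⧸ J) =
        mkl J (X a) * mkl J (X b) * v := by
      calc _ = mkl J (X (b.1, 0)) * (mkl J (X (a.1, 0)) * (T a (T b v) : SS k n ⧸ J)) := by ring
        _ = mkl J (X a) * (mkl J (X (b.1, 0)) * (T b v : SS k n ⧸ J)) := by rw [hT]; ring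
        _ = _ := by rw [hT]; ring
    have h2 : mkl J (X (a.1, 0)) * mkl J (X (b.1, 0)) * (T b (T a v) : SS k n ⧸ J) =
        mkl J (X a) * mkl J (X b) * v := by
      calc _ = mkl J (X (a.1, 0)) * (mkl J (X (b.1, 0)) * (T b (T a v) : SS k n ⧸ J)) := by ring
        _ = mkl J (X b) * (mkl J (X (a.1, 0)) * (T a v : SS k n ⧸ J)) := by rw [hT]; ring
        _ = _ := by rw [hT]; ring
    rw [h1, h2]
  obtain ⟨w, _, hw0, hw⟩ := common_eigen T hcomm N ⊤ (by
    rw [finrank_top]; exact hdim e0 le_rfl) hN (fun _ _ _ => trivial)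
  choose c hc using hw
  have hXw : ∀ p, mkl J (X p) * (w : SS k n ⧸ J) = c p • (mkl J (X (p.1, 0)) * (w : SS k n ⧸ J)) := by
    intro p
    rw [← hT, hc, Submodule.coe_smul, mul_smul_comm]
  have hw0' : (w : SS k n ⧸ J) ≠ 0 := fun h => hw0 (Subtype.ext h)
  have hc0 : ∀ j, c (j, 0) = 1 := by
    intro j
    have h1 := hXw (j, 0)
    have h2 : (c (j,0) - 1) • (mkl J (X (j, 0)) * (w : SS k n ⧸ J)) = 0 := by
      rw [sub_smul, one_smul, ← h1, sub_self]
    rcases smul_eq_zero.1 h2 with h | h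
    · linarith
    · exact absurd (hinj _ (hXS j) _ w.2 h) hw0'
  refine ⟨c, hc0, ?_⟩
  let ψ : SS k n →ₐ[ℝ] SS k n := aeval (fun p : Sg k n => c p • (X (p.1, 0) : SS k n))
  have hψ : ∀ f : SS k n, mkl J f * (w : SS k n ⧸ J) = mkl J (ψ f) * w := by
    intro f
    induction f using MvPolynomial.induction_on with
    | C a => simp [ψ, algebraMap_eq]
    | add f g hf hg => rw [map_add, map_add, map_add, add_mul, add_mul, hf, hg]
    | mul_X f p hf =>
      rw [map_mul ψ, hmm, hmm, mul_assoc, hXw, mul_smul_comm, mul_left_comm, hf]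
      simp only [ψ, aeval_X, map_smul]
      rw [mul_smul_comm, smul_mul_assoc]
      ring_nf
  intro δ f hfJ hf
  have hev : ψ f = eval c f • ∏ j, X (j, 0) ^ (δ j).toNat := by
    conv_lhs => rw [f.as_sum]
    rw [map_sum, eval_eq, Finset.sum_smul]
    refine Finset.sum_congr rfl fun d hd => ?_
    have hwd := hf (mem_support_iff.1 hd)
    simp only [ψ, aeval_monomial]
    rw [Finsupp.prod_fintype _ _ (by simp)]
    simp only [smul_pow]
    rw [Finset.prod_smul, mul_smul, ← algebraMap_smul (SS k n) (coeff d f), smul_eq_mul]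
    congr 1
    rw [Finset.prod_subset (Finset.subset_univ d.support) (by
      intro x _ hx
      rw [Finsupp.notMem_support_iff.1 hx, pow_zero])]
    congr 1
    rw [Fintype.prod_prod_type]
    refine Finset.prod_congr rfl fun j _ => ?_
    refine (Finset.prod_pow_eq_pow_sum Finset.univ (fun i => d (j,i)) (X (j,0) : SS k n)).trans ?_
    congr 1
    rw [← hwd, weight_apply']
    simp only [← Nat.cast_sum, Int.toNat_natCast]
  have h1 := hψ f
  rw [mkl_eq_zero.2 hfJ, zero_mul, hev, map_smul, smul_mul_assoc] at h1
  rcases smul_eq_zero.1 h1.symm with h | h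
  · exact h
  · exact absurd (hinj _ (prod_mem fun j _ => pow_mem (hXS j) _) _ w.2 h) hw0'

end zero

end KRP


/-! ### Section 7: the polynomial theorem on products of spheres -/
namespace KRP
open MvPolynomial Module
variable {k n : ℕ}

lemma eval_scale {δ : Fin k → ℤ} {f : SS k n} (hf : f ∈ RR δ) (t : Fin k → ℝ) (c : Sg k n → ℝ) :
    eval (fun p => t p.1 * c p) f = (∏ j, t j ^ (δ j).toNat) * eval c f := by
  rw [eval_eq, eval_eq, Finset.mul_sum]
  refine Finset.sum_congr rfl fun d hd => ?_
  have hwd := hf (mem_support_iff.1 hd)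
  rw [Finset.prod_subset (Finset.subset_univ d.support) (by
      intro x _ hx
      rw [Finsupp.notMem_support_iff.1 hx, pow_zero]),
    Finset.prod_subset (Finset.subset_univ d.support) (by
      intro x _ hx
      rw [Finsupp.notMem_support_iff.1 hx, pow_zero])]
  simp only [mul_pow]
  rw [Finset.prod_mul_distrib]
  have : ∏ p : Sg k n, t p.1 ^ d p = ∏ j, t j ^ (δ j).toNat := by
    rw [Fintype.prod_prod_type]
    refine Finset.prod_congr rfl fun j _ => ?_
    refine (Finset.prod_pow_eq_pow_sum Finset.univ (fun i => d (j,i)) (t j)).trans ?_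
    congr 1
    rw [← hwd, weight_apply']
    simp only [← Nat.cast_sum, Int.toNat_natCast]
  rw [this]
  ring

variable (k n) in
/-- product of spheres -/
def KK : Set (Sg k n → ℝ) := {y | ∀ j, ∑ i, y (j,i)^2 = 1}

lemma KK_compact : IsCompact (KK k n) := by
  refine Metric.isCompact_of_isClosed_isBounded ?_ ?_
  · have : KK k n = ⋂ j, {y | ∑ i, y (j,i)^2 = 1} := by ext; simp [KK]
    rw [this]
    refine isClosed_iInter fun j => isClosed_eq (by fun_prop) continuous_const
  · refine (Metric.isBounded_closedBall (x := 0) (r := 1)).subset ?_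
    intro y hy
    rw [mem_closedBall_zero_iff, pi_norm_le_iff_of_nonneg zero_le_one]
    intro p
    have h1 := hy p.1
    have h2 : y (p.1, p.2)^2 ≤ ∑ i, y (p.1,i)^2 :=
      Finset.single_le_sum (f := fun i => y (p.1,i)^2) (fun i _ => sq_nonneg _) (Finset.mem_univ p.2)
    rw [h1] at h2
    rw [Real.norm_eq_abs]
    exact (sq_le_one_iff_abs_le_one _).1 h2

lemma KK_nonempty : (KK k n).Nonempty := by
  refine ⟨fun p => if p.2 = 0 then 1 else 0, fun j => ?_⟩
  simp

lemma list_sum_sq_eq_zero : ∀ (l : List ℝ) (_ : (l.map (fun x => x^2)).sum = 0), ∀ x ∈ l, x = 0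
  | [], _, x, hx => by simp at hx
  | y :: l, h, x, hx => by
    have h0 : 0 ≤ (l.map (fun x : ℝ => x^2)).sum := List.sum_nonneg (by
      intro a ha
      obtain ⟨b, _, rfl⟩ := List.mem_map.1 ha
      positivity)
    rw [List.map_cons, List.sum_cons] at h
    have h1 : y^2 = 0 := by nlinarith [sq_nonneg y]
    rcases List.mem_cons.1 hx with rfl | hx
    · exact pow_eq_zero_iff (two_ne_zero) |>.1 h1
    · exact list_sum_sq_eq_zero l (by linarith) x hx

theorem poly_zero (G : List (List (Fin k) × SS k n)) (hG : ∀ x ∈ G, x.2 ∈ RR (dg x.1))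
    (hlen : G.length = k * n) (hodd : Odd (coeff (nn k n) (GP (G.map Prod.fst)))) :
    ∃ y ∈ KK k n, ∀ x ∈ G, eval y x.2 = 0 := by
  obtain ⟨Q, B, hB, hQG, hmain⟩ := generic_main G hG hlen
  have hQ : ∀ x ∈ Q, QOK x := by
    intro x hx
    exact hG (x.1.map Prod.fst, x.2) (by rw [← hQG]; exact List.mem_map_of_mem hx)
  -- zeros for generic s
  have hs : ∀ s ∉ B, ∃ y ∈ KK k n, ∀ x ∈ Q, eval y (SF n x.1) + s * eval y x.2 = 0 := by
    intro s hs
    let e0 : Fin k → ℤ := fun j => 2 + tot (G.map Prod.fst) j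
    have hbig : ∀ e, e0 ≤ e → Big (G.map Prod.fst) e := fun e he j => he j
    have hok : ∀ x ∈ Q, Ts s (trip n x) ∈ RR (dg (x.1.map Prod.fst)) := fun x hx => Ts_mem (trip_ok (hQ x hx)) s
    have hJ : HomI (LId (Qs s Q)) := HomI_LId _ fun f hf => by
      obtain ⟨y, hy, rfl⟩ := List.mem_map.1 hf
      obtain ⟨z, hz, rfl⟩ := List.mem_map.1 hy
      exact ⟨_, hok z hz⟩
    have hd0 := (hmain s hs e0 (hbig e0 le_rfl)).1
    obtain ⟨c, hc1, hc2⟩ := exists_zero (J := LId (Qs s Q)) hJ (e0 := e0) (N := HH (LId (Qs s Q)) e0)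
      (fun e he => by
        have := (hmain s hs e (hbig e he)).1
        rw [← hd0] at this
        exact_mod_cast this)
      (fun e he j => (hmain s hs e (hbig e he)).2 j)
      (by rw [← hd0] at hodd; exact_mod_cast hodd)
    let t : Fin k → ℝ := fun j => (Real.sqrt (∑ i, c (j,i)^2))⁻¹
    refine ⟨fun p => t p.1 * c p, ?_, ?_⟩
    · intro j
      have h1 : 1 ≤ ∑ i, c (j,i)^2 := by
        have := Finset.single_le_sum (f := fun i => c (j,i)^2) (fun i _ => sq_nonneg _) (Finset.mem_univ 0)
        simpa [hc1] using this
      simp only [mul_pow]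
      rw [← Finset.mul_sum]
      simp only [t]
      rw [inv_pow, Real.sq_sqrt (by linarith), inv_mul_cancel₀ (by linarith)]
    · intro x hx
      have h1 := hc2 _ _ (mem_LId (List.mem_map_of_mem (f := Ts s) (List.mem_map_of_mem (f := trip n) hx))) (hok x hx)
      have h2 := eval_scale (hok x hx) t c
      rw [h1, mul_zero] at h2
      simpa [Ts, trip, smul_eval] using h2
  let h : (Sg k n → ℝ) → ℝ := fun y => ((Q.map fun x => eval y x.2).map (fun z => z^2)).sum
  let H : (Sg k n → ℝ) → ℝ := fun y => ((Q.map fun x => eval y (SF n x.1)).map (fun z => z^2)).sum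
  have hcont : ∀ F : Qt k n → SS k n, Continuous fun y : Sg k n → ℝ =>
      ((Q.map fun x => eval y (F x)).map (fun z => z^2)).sum := by
    intro F
    simp only [List.map_map]
    exact continuous_list_sum Q (fun x _ => (MvPolynomial.continuous_eval (F x)).pow 2)
  obtain ⟨y0, hy0, hmin⟩ := KK_compact.exists_isMinOn (KK_nonempty (k := k) (n := n)) (hcont (fun x => x.2)).continuousOn
  obtain ⟨y1, hy1, hmax⟩ := KK_compact.exists_isMaxOn (KK_nonempty (k := k) (n := n)) (hcont (fun x => SF n x.1)).continuousOn
  have h0 : h y0 = 0 := by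
    have hnn : 0 ≤ h y0 := List.sum_nonneg (by
      intro a ha
      obtain ⟨b, _, rfl⟩ := List.mem_map.1 ha
      positivity)
    by_contra hne
    have hpos : 0 < h y0 := lt_of_le_of_ne hnn (Ne.symm hne)
    have hd : Dense Bᶜ := hB.dense_compl ℝ
    obtain ⟨s, hsB, hs1⟩ := hd.exists_gt (max 1 (H y1 / h y0))
    obtain ⟨y, hy, hyz⟩ := hs s hsB
    have hs0 : 1 < s := lt_of_le_of_lt (le_max_left _ _) hs1
    have hs2 : H y1 / h y0 < s := lt_of_le_of_lt (le_max_right _ _) hs1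
    have e1 : H y = s^2 * h y := by
      simp only [H, h, List.map_map]
      rw [← List.sum_map_mul_left]
      congr 1
      refine List.map_congr_left fun x hx => ?_
      have := hyz x hx
      simp only [Function.comp]
      have e2 : eval y (SF n x.1) = - (s * eval y x.2) := by linarith
      rw [e2]; ring
    have a1 : h y0 ≤ h y := hmin hy
    have a2 : H y ≤ H y1 := hmax hy
    rw [div_lt_iff₀ hpos] at hs2
    have b1 : s^2 * h y0 ≤ s^2 * h y := mul_le_mul_of_nonneg_left a1 (sq_nonneg s)
    have b2 : s * h y0 ≤ s^2 * h y0 := mul_le_mul_of_nonneg_right (by nlinarith) hpos.le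
    linarith
  refine ⟨y0, hy0, fun x hx => ?_⟩
  rw [← hQG] at hx
  obtain ⟨z, hz, rfl⟩ := List.mem_map.1 hx
  exact list_sum_sq_eq_zero _ h0 _ (List.mem_map_of_mem (f := fun x => eval y0 x.2) hz)

end KRP


/-! ### Section 8: the continuous version -/
namespace KRP
open MvPolynomial Module
variable {k n : ℕ}

def sgn (b : Bool) : ℝ := if b then 1 else -1

lemma sgn_sq (b : Bool) : sgn b * sgn b = 1 := by cases b <;> simp [sgn]

def flp (s : Fin k → Bool) (y : Sg k n → ℝ) : Sg k n → ℝ := fun p => sgn (s p.1) * y p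

lemma flp_mem {s : Fin k → Bool} {y : Sg k n → ℝ} (hy : y ∈ KK k n) : flp s y ∈ KK k n := by
  intro j
  have := hy j
  simp only [flp, mul_pow, sq (sgn _), sgn_sq, one_mul]
  exact this

lemma approx (Φ : (Sg k n → ℝ) → ℝ) (hΦ : ContinuousOn Φ (KK k n)) (ε : ℝ) (hε : 0 < ε) :
    ∃ P : SS k n, ∀ y ∈ KK k n, |eval y P - Φ y| < ε := by
  have : CompactSpace (KK k n) := isCompact_iff_compactSpace.1 KK_compact
  let co : Sg k n → C(KK k n, ℝ) := fun p => ⟨fun y => y.1 p, (continuous_apply p).comp continuous_subtype_val⟩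
  let A : Subalgebra ℝ C(KK k n, ℝ) := (aeval (R := ℝ) co).range
  have hsep : A.SeparatesPoints := by
    intro x y hxy
    have : x.1 ≠ y.1 := fun h => hxy (Subtype.ext h)
    obtain ⟨p, hp⟩ := Function.ne_iff.1 this
    exact ⟨co p, ⟨co p, ⟨X p, by simp⟩, rfl⟩, hp⟩
  have hA := ContinuousMap.exists_mem_subalgebra_near_continuousMap_of_separatesPoints A hsep
    ⟨fun y : KK k n => Φ y.1, continuousOn_iff_continuous_domRestrict.1 hΦ⟩ ε hε
  obtain ⟨⟨g, ⟨P, rfl⟩⟩, hg⟩ := hA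
  refine ⟨P, fun y hy => ?_⟩
  rw [ContinuousMap.norm_lt_iff _ hε] at hg
  have h1 := hg ⟨y, hy⟩
  have h2 : ∀ P : SS k n, (aeval (R := ℝ) co P) ⟨y, hy⟩ = eval y P := by
    intro P
    induction P using MvPolynomial.induction_on with
    | C a => simp
    | add p q hp hq => simp [hp, hq]
    | mul_X p i hp => simp [hp, co]
  have h3 : |(aeval (R := ℝ) co P) ⟨y, hy⟩ - Φ y| < ε := h1
  rwa [h2] at h3

/-- parity condition -/
def good (α : Finset (Fin k)) (d : Sg k n →₀ ℕ) : Prop :=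
  ∀ j, Even ((∑ i, d (j,i)) + if j ∈ α then 1 else 0)

lemma avg_char (α : Finset (Fin k)) (d : Sg k n →₀ ℕ) [Decidable (good α d)] :
    ∑ s : Fin k → Bool, (∏ j ∈ α, sgn (s j)) * ∏ p, sgn (s p.1) ^ d p
      = if good α d then (2:ℝ)^k else 0 := by
  have h1 : ∀ s : Fin k → Bool, (∏ j ∈ α, sgn (s j)) * ∏ p, sgn (s p.1) ^ d p =
      ∏ j, sgn (s j) ^ ((∑ i, d (j,i)) + if j ∈ α then 1 else 0) := by
    intro s
    rw [Fintype.prod_prod_type]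
    simp only [pow_add, Finset.prod_mul_distrib, Finset.prod_pow_eq_pow_sum]
    rw [mul_comm]
    congr 1
    rw [← Finset.prod_subset (Finset.subset_univ α) (by intro x _ hx; simp [hx])]
    refine Finset.prod_congr rfl fun j hj => by simp [hj]
  simp only [h1]
  have h2 := Finset.prod_univ_sum (fun _ : Fin k => (Finset.univ : Finset Bool))
    (fun j b => sgn b ^ ((∑ i, d (j,i)) + if j ∈ α then 1 else 0))
  rw [Fintype.piFinset_univ] at h2
  rw [← h2]
  have st : sgn true = 1 := rfl
  have sf : sgn false = -1 := rfl
  simp only [Fintype.sum_bool, st, sf, one_pow]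
  split_ifs with hg
  · rw [Finset.prod_congr rfl (g := fun _ => (2:ℝ))]
    · simp
    · intro j _
      have := (hg j).neg_one_pow (α := ℝ)
      rw [this]; norm_num
  · simp only [good, not_forall] at hg
    obtain ⟨j, hj⟩ := hg
    refine Finset.prod_eq_zero (Finset.mem_univ j) ?_
    have := (Nat.not_even_iff_odd.1 hj).neg_one_pow (α := ℝ)
    rw [this]; norm_num

lemma eval_flp (s : Fin k → Bool) (y : Sg k n → ℝ) (P : SS k n) :
    eval (flp s y) P = ∑ d ∈ P.support, (coeff d P * ∏ p, y p ^ d p) * ∏ p, sgn (s p.1) ^ d p := by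
  rw [eval_eq']
  refine Finset.sum_congr rfl fun d _ => ?_
  simp only [flp, mul_pow, Finset.prod_mul_distrib]
  ring

noncomputable def NR (j : Fin k) : SS k n := ∑ i, X (j,i) ^ 2

lemma NR_mem (j : Fin k) : (NR j : SS k n) ∈ RR (Pi.single j 2) := by
  refine Submodule.sum_mem _ fun i _ => ?_
  have := (X_mem (n := n) (j, i))
  rw [mem_RR] at *
  have h := this.pow 2
  convert h using 1
  ext a
  simp [Pi.single_apply]

lemma NR_eval (j : Fin k) {y : Sg k n → ℝ} (hy : y ∈ KK k n) : eval y (NR j) = 1 := by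
  simpa [NR] using hy j

lemma homogenize (α : Finset (Fin k)) (P : SS k n) (hP : ∀ d ∈ P.support, good α d) :
    ∃ D : Fin k → ℕ, (∀ j, Even (D j + if j ∈ α then 1 else 0)) ∧
      ∃ Q : SS k n, Q ∈ RR (fun j => (D j : ℤ)) ∧ ∀ y ∈ KK k n, eval y Q = eval y P := by
  classical
  let w : (Sg k n →₀ ℕ) → Fin k → ℕ := fun d j => ∑ i, d (j,i)
  let N : ℕ := ∑ d ∈ P.support, ∑ j, w d j
  let D : Fin k → ℕ := fun j => 2 * N + if j ∈ α then 1 else 0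
  have hN : ∀ d ∈ P.support, ∀ j, w d j ≤ N := by
    intro d hd j
    calc w d j ≤ ∑ j, w d j := Finset.single_le_sum (f := fun j => w d j) (fun _ _ => Nat.zero_le _) (Finset.mem_univ j)
      _ ≤ N := Finset.single_le_sum (f := fun d => ∑ j, w d j) (fun _ _ => Nat.zero_le _) hd
  refine ⟨D, ?_, ∑ d ∈ P.support, monomial d (coeff d P) * ∏ j, NR j ^ ((D j - w d j)/2), ?_, ?_⟩
  · intro j
    simp only [D]
    split_ifs <;> simp [parity_simps]
  · refine Submodule.sum_mem _ fun d hd => ?_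
    rw [mem_RR]
    have h1 : IsWeightedHomogeneous wt (monomial d (coeff d P)) (fun j => (w d j : ℤ)) := by
      refine isWeightedHomogeneous_monomial _ _ _ ?_
      ext j
      rw [weight_apply']
      simp [w]
    have h2 : IsWeightedHomogeneous wt (∏ j, (NR j : SS k n) ^ ((D j - w d j)/2))
        (∑ j, ((D j - w d j)/2) • (Pi.single j 2 : Fin k → ℤ)) :=
      IsWeightedHomogeneous.prod _ _ _ fun j _ => (mem_RR.1 (NR_mem j)).pow _
    convert h1.mul h2 using 1
    ext j
    have h3 := hP d hd j
    have h4 := hN d hd j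
    have h6 : (∑ x, ((D x - w d x)/2) • (Pi.single x 2 : Fin k → ℤ)) j = (((D j - w d j)/2 : ℕ) : ℤ) * 2 := by
      rw [Finset.sum_apply, Finset.sum_eq_single j]
      · rw [Pi.smul_apply, Pi.single_eq_same, nsmul_eq_mul]
      · intro b _ hb
        rw [Pi.smul_apply, Pi.single_eq_of_ne hb.symm, smul_zero]
      · simp
    rw [Pi.add_apply, h6]
    have h5 : D j = w d j + ((D j - w d j)/2) * 2 := by
      obtain ⟨r, hr⟩ := h3
      change w d j + _ = _ at hr
      have : D j = 2 * N + if j ∈ α then 1 else 0 := rfl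
      split_ifs at hr this <;> omega
    exact_mod_cast h5
  · intro y hy
    rw [map_sum]
    conv_rhs => rw [P.as_sum, map_sum]
    refine Finset.sum_congr rfl fun d _ => ?_
    simp [map_prod, NR_eval _ hy]

lemma approx_hom (α : Finset (Fin k)) (Φ : (Sg k n → ℝ) → ℝ) (hΦ : ContinuousOn Φ (KK k n))
    (heq : ∀ (s : Fin k → Bool), ∀ y ∈ KK k n, Φ (flp s y) = (∏ j ∈ α, sgn (s j)) * Φ y)
    (ε : ℝ) (hε : 0 < ε) :
    ∃ D : Fin k → ℕ, (∀ j, Even (D j + if j ∈ α then 1 else 0)) ∧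
      ∃ Q : SS k n, Q ∈ RR (fun j => (D j : ℤ)) ∧ ∀ y ∈ KK k n, |eval y Q - Φ y| < ε := by
  classical
  obtain ⟨P, hP⟩ := approx Φ hΦ ε hε
  let P' : SS k n := ∑ d ∈ P.support.filter (good α), monomial d (coeff d P)
  have hP' : ∀ d ∈ P'.support, good α d := by
    intro d hd
    have := support_sum hd
    simp only [Finset.mem_biUnion, Finset.mem_filter] at this
    obtain ⟨e, ⟨_, he⟩, h2⟩ := this
    have := support_monomial_subset h2
    rw [Finset.mem_singleton] at this
    rwa [this]
  obtain ⟨D, hD, Q, hQ, hQe⟩ := homogenize α P' hP'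
  refine ⟨D, hD, Q, hQ, fun y hy => ?_⟩
  rw [hQe y hy]
  have hsq : ∀ s : Fin k → Bool, (∏ j ∈ α, sgn (s j)) * (∏ j ∈ α, sgn (s j)) = 1 := by
    intro s
    rw [← Finset.prod_mul_distrib]
    simp [sgn_sq]
  have key : (2:ℝ)^k * (eval y P' - Φ y) =
      ∑ s : Fin k → Bool, (∏ j ∈ α, sgn (s j)) * (eval (flp s y) P - Φ (flp s y)) := by
    simp only [mul_sub, Finset.sum_sub_distrib]
    congr 1
    · simp only [eval_flp, Finset.mul_sum]
      rw [Finset.sum_comm]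
      simp only [P', map_sum, Finset.sum_filter, Finset.mul_sum]
      refine Finset.sum_congr rfl fun d _ => ?_
      have := avg_char α d
      calc _ = (coeff d P * ∏ p, y p ^ d p) * (if good α d then (2:ℝ)^k else 0) := by
            split_ifs
            · rw [eval_monomial, Finsupp.prod_fintype _ _ (by simp)]; ring
            · simp
        _ = _ := by
            rw [← this, Finset.mul_sum]
            refine Finset.sum_congr rfl fun s _ => ?_
            ring
    · rw [Finset.sum_congr rfl (g := fun _ => Φ y)]
      · simp
      · intro s _
        rw [heq s y hy, ← mul_assoc, hsq, one_mul]
  have h2 : (2:ℝ)^k * |eval y P' - Φ y| < 2^k * ε := by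
    rw [← abs_of_pos (show (0:ℝ) < 2^k by positivity), ← abs_mul, abs_of_pos (show (0:ℝ) < 2^k by positivity), key]
    refine lt_of_le_of_lt (Finset.abs_sum_le_sum_abs _ _) ?_
    calc _ < ∑ s : Fin k → Bool, ε := by
          refine Finset.sum_lt_sum_of_nonempty Finset.univ_nonempty fun s _ => ?_
          have h1 : |∏ j ∈ α, sgn (s j)| = 1 := by
            rcases mul_self_eq_one_iff.1 (hsq s) with h | h <;> simp [h]
          rw [abs_mul, h1, one_mul]
          exact hP _ (flp_mem hy)
      _ = _ := by simp
  exact lt_of_mul_lt_mul_left h2 (by positivity)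

lemma dg_eq (l : List (Fin k)) : dg l = (l.map fun j => (Pi.single j 1 : Fin k → ℤ)).sum := by
  induction l with
  | nil => rfl
  | cons a l ih => simp only [dg, List.map_cons, List.sum_cons, ih]; rw [add_comm]

lemma exists_list (D : Fin k → ℕ) : ∃ l : List (Fin k), ∀ (M : Type) [AddCommMonoid M] (f : Fin k → M),
    (l.map f).sum = ∑ j, D j • f j := by
  refine ⟨(∑ j, D j • ({j} : Multiset (Fin k))).toList, fun M _ f => ?_⟩
  rw [← Multiset.sum_coe, ← Multiset.map_coe, Multiset.coe_toList]
  have := map_sum ((Multiset.sumAddMonoidHom (M := M)).comp (Multiset.mapAddMonoidHom f))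
    (fun j => D j • ({j} : Multiset (Fin k))) Finset.univ
  refine Eq.trans this (Finset.sum_congr rfl fun j _ => ?_)
  rw [map_nsmul]
  simp

theorem cont_zero {I : Type*} [Fintype I] (α : I → Finset (Fin k)) (hI : Fintype.card I = k * n)
    (hc : coeff (nn k n) (∏ i, ∑ j ∈ α i, (X j : MvPolynomial (Fin k) (ZMod 2))) ≠ 0)
    (Φ : I → (Sg k n → ℝ) → ℝ) (hΦ : ∀ i, ContinuousOn (Φ i) (KK k n))
    (heq : ∀ i (s : Fin k → Bool), ∀ y ∈ KK k n,
      Φ i (flp s y) = (∏ j ∈ α i, sgn (s j)) * Φ i y) :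
    ∃ y ∈ KK k n, ∀ i, Φ i y = 0 := by
  classical
  have hM : ContinuousOn (fun y => ∑ i, |Φ i y|) (KK k n) :=
    continuousOn_finsetSum _ fun i _ => (hΦ i).abs
  obtain ⟨y0, hy0, hmin⟩ := KK_compact.exists_isMinOn (KK_nonempty (k := k) (n := n)) hM
  by_cases h0 : ∑ i, |Φ i y0| = 0
  · refine ⟨y0, hy0, fun i => ?_⟩
    have := (Finset.sum_eq_zero_iff_of_nonneg (fun i _ => abs_nonneg _)).1 h0 i (Finset.mem_univ i)
    exact abs_eq_zero.1 this
  exfalso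
  have hpos : 0 < ∑ i, |Φ i y0| := lt_of_le_of_ne (Finset.sum_nonneg fun i _ => abs_nonneg _) (Ne.symm h0)
  set e := ∑ i, |Φ i y0| with he
  have hη : 0 < e / (Fintype.card I + 1) := by positivity
  choose D hD Q hQ hQe using fun i => approx_hom (α i) (Φ i) (hΦ i) (heq i) _ hη
  choose l hl using fun i => exists_list (D i)
  have hlD : ∀ i, dg (l i) = fun j => (D i j : ℤ) := by
    intro i
    rw [dg_eq, hl i]
    ext j
    simp [Pi.single_apply]
  obtain ⟨y, hy, hz⟩ := poly_zero (n := n) ((Finset.univ : Finset I).toList.map fun i => (l i, Q i))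
    (by
      intro x hx
      obtain ⟨i, _, rfl⟩ := List.mem_map.1 hx
      simp only [hlD]; exact hQ i)
    (by simp [hI])
    (by
      have h1 : MvPolynomial.map (Int.castRingHom (ZMod 2))
          (GP (((Finset.univ : Finset I).toList.map fun i => (l i, Q i)).map Prod.fst)) =
          ∏ i, ∑ j ∈ α i, (X j : MvPolynomial (Fin k) (ZMod 2)) := by
        simp only [GP, List.map_map]
        rw [map_list_prod, List.map_map, Finset.prod_map_toList]
        refine Finset.prod_congr rfl fun i _ => ?_
        simp only [Function.comp, hl]
        rw [map_sum, ← Finset.sum_subset (Finset.subset_univ (α i))]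
        · refine Finset.sum_congr rfl fun j hj => ?_
          have := hD i j
          simp only [hj, if_true] at this
          have h3 : Odd (D i j) := by
            rw [← Nat.not_even_iff_odd]; intro h; simp [parity_simps, h] at this
          have h4 : ((D i j : ℕ) : ZMod 2) = 1 := (ZMod.natCast_eq_one_iff_odd).2 h3
          rw [nsmul_eq_mul, map_mul, map_natCast, map_X]
          rw [← map_natCast (C : ZMod 2 →+* MvPolynomial (Fin k) (ZMod 2)), h4, map_one, one_mul]
        · intro j _ hj
          have := hD i j
          simp only [hj, if_false, add_zero] at this
          have h4 : ((D i j : ℕ) : ZMod 2) = 0 := (ZMod.natCast_eq_zero_iff_even).2 this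
          rw [nsmul_eq_mul, map_mul, map_natCast, map_X]
          rw [← map_natCast (C : ZMod 2 →+* MvPolynomial (Fin k) (ZMod 2)), h4, map_zero, zero_mul]
      rw [← h1, coeff_map] at hc
      rw [← Int.not_even_iff_odd]
      intro h
      exact hc ((ZMod.intCast_eq_zero_iff_even).2 h))
  have hlt : ∑ i, |Φ i y| ≤ ∑ i : I, e / (Fintype.card I + 1) := by
    refine Finset.sum_le_sum fun i _ => ?_
    have h1 := hz (l i, Q i) (List.mem_map.2 ⟨i, by simp, rfl⟩)
    have h2 := hQe i y hy
    simp only at h1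
    rw [h1, zero_sub, abs_neg] at h2
    exact h2.le
  have h3 : e ≤ ∑ i, |Φ i y| := hmin hy
  have h4 : ∑ i : I, e / (Fintype.card I + 1 : ℝ) < e := by
    simp only [Finset.sum_const, Finset.card_univ, nsmul_eq_mul]
    rw [mul_div_assoc', div_lt_iff₀ (by positivity)]
    nlinarith
  linarith

end KRP


/-! ### Section 9: the application -/
namespace KRP
open MvPolynomial Module
variable {k n : ℕ}

theorem cont_zero' {I : Type*} [Fintype I] (α : I → Finset (Fin k))
    (hc : coeff (nn k n) (∏ i, ∑ j ∈ α i, (X j : MvPolynomial (Fin k) (ZMod 2))) ≠ 0)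
    (Φ : I → (Sg k n → ℝ) → ℝ) (hΦ : ∀ i, ContinuousOn (Φ i) (KK k n))
    (heq : ∀ i (s : Fin k → Bool), ∀ y ∈ KK k n,
      Φ i (flp s y) = (∏ j ∈ α i, sgn (s j)) * Φ i y) :
    ∃ y ∈ KK k n, ∀ i, Φ i y = 0 := by
  refine cont_zero α ?_ hc Φ hΦ heq
  have h1 : IsHomogeneous (∏ i, ∑ j ∈ α i, (X j : MvPolynomial (Fin k) (ZMod 2))) (∑ _i : I, 1) :=
    IsHomogeneous.prod _ _ _ fun i _ => IsHomogeneous.sum _ _ _ fun j _ => isHomogeneous_X _ _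
  by_contra hne
  refine hc (h1.coeff_eq_zero ?_)
  intro h
  apply hne
  rw [Finsupp.degree_eq_sum] at h
  simpa [nn] using h.symm

/-- signed parts -/
def pt (b : Bool) (j : Fin k) (y : Sg k n → ℝ) : Fin (n+1) → ℝ := fun v => max (sgn b * y (j,v)) 0

lemma pt_nonneg (b : Bool) (j : Fin k) (y : Sg k n → ℝ) (v) : 0 ≤ pt b j y v := le_max_right _ _

lemma pt_cont (b : Bool) (j : Fin k) : Continuous (pt b j : (Sg k n → ℝ) → _) := by
  unfold pt
  fun_prop

lemma sgn_beq (a b : Bool) : sgn (a == b) = sgn b * sgn a := by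
  cases a <;> cases b <;> simp [sgn]

lemma pt_flp (b : Bool) (j : Fin k) (s : Fin k → Bool) (y : Sg k n → ℝ) :
    pt b j (flp s y) = pt (s j == b) j y := by
  funext v
  simp only [pt, flp, sgn_beq, mul_assoc]

lemma pt_sub (j : Fin k) (y : Sg k n → ℝ) (v) : pt true j y v - pt false j y v = y (j,v) := by
  simp only [pt, sgn]
  rcases le_total 0 (y (j,v)) with h | h <;> simp [h]

noncomputable def FF {d : ℕ} (f : (Fin (n + 1) → ℝ) → EuclideanSpace ℝ (Fin d)) (z : Fin (n+1) → ℝ) :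
    EuclideanSpace ℝ (Fin d) := (∑ v, z v) • f ((∑ v, z v)⁻¹ • z)

lemma simp_mem {z : Fin (n+1) → ℝ} (hz : ∀ v, 0 ≤ z v) (h : ∑ v, z v ≠ 0) :
    (∑ v, z v)⁻¹ • z ∈ stdSimplex ℝ (Fin (n+1)) := by
  refine ⟨fun v => mul_nonneg (inv_nonneg.2 (Finset.sum_nonneg fun v _ => hz v)) (hz v), ?_⟩
  simp only [Pi.smul_apply, smul_eq_mul]
  rw [← Finset.mul_sum, inv_mul_cancel₀ h]

lemma FF_cont {d : ℕ} (f : (Fin (n + 1) → ℝ) → EuclideanSpace ℝ (Fin d))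
    (hf : ContinuousOn f (stdSimplex ℝ (Fin (n + 1)))) :
    ContinuousOn (FF f) {z | ∀ v, 0 ≤ z v} := by
  have hs : Continuous fun z : Fin (n+1) → ℝ => ∑ v, z v := by fun_prop
  intro y hy
  by_cases h : ∑ v, y v = 0
  · obtain ⟨C, hC⟩ := (isCompact_stdSimplex ℝ (Fin (n+1))).exists_bound_of_continuousOn hf
    have h0 : FF f y = 0 := by simp [FF, h]
    unfold ContinuousWithinAt
    rw [h0]
    have ht : Filter.Tendsto (fun z : Fin (n+1) → ℝ => C * ∑ v, z v)
        (nhdsWithin y {z | ∀ v, 0 ≤ z v}) (nhds 0) := by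
      have hs' : Continuous fun z : Fin (n+1) → ℝ => C * ∑ v, z v := by fun_prop
      have := hs'.continuousWithinAt (s := {z | ∀ v, 0 ≤ z v}) (x := y)
      unfold ContinuousWithinAt at this
      simpa [h] using this
    refine squeeze_zero_norm' ?_ ht
    filter_upwards [self_mem_nhdsWithin] with z hz
    have hz0 : 0 ≤ ∑ v, z v := Finset.sum_nonneg fun v _ => hz v
    by_cases h' : ∑ v, z v = 0
    · simp [FF, h']
    · rw [FF, norm_smul, Real.norm_of_nonneg hz0, mul_comm]
      exact mul_le_mul_of_nonneg_right (hC _ (simp_mem hz h')) hz0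
  · have hU : IsOpen {z : Fin (n+1) → ℝ | ∑ v, z v ≠ 0} := isOpen_ne_fun hs continuous_const
    have hc : ContinuousOn (FF f) ({z | ∀ v, 0 ≤ z v} ∩ {z | ∑ v, z v ≠ 0}) := by
      refine hs.continuousOn.smul (hf.comp ?_ ?_)
      · refine ContinuousOn.smul (hs.continuousOn.inv₀ ?_) continuousOn_id
        intro z hz; exact hz.2
      · intro z hz
        exact simp_mem hz.1 hz.2
    exact (hc y ⟨hy, h⟩).mono_of_mem_nhdsWithin
      (Filter.inter_mem self_mem_nhdsWithin (mem_nhdsWithin_of_mem_nhds (hU.mem_nhds h)))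

noncomputable def aa {m : ℕ} (F : Finset (Finset (Fin (n + 1)))) (c : Finset (Fin (n+1)) → Fin m) (i : Fin m)
    (ε : Fin k → Bool) (y : Sg k n → ℝ) : ℝ :=
  ∑ A ∈ F.filter (fun A => c A = i), ∏ v ∈ A, ∏ j, pt (ε j) j y v

lemma aa_cont {m : ℕ} (F : Finset (Finset (Fin (n + 1)))) (c : Finset (Fin (n+1)) → Fin m) (i : Fin m)
    (ε : Fin k → Bool) : Continuous (aa F c i ε) := by
  unfold aa
  refine continuous_finsetSum _ fun A _ => continuous_finsetProd _ fun v _ => continuous_finsetProd _ fun j _ => ?_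
  exact (continuous_apply v).comp (pt_cont _ _)

lemma aa_flp {m : ℕ} (F : Finset (Finset (Fin (n + 1)))) (c : Finset (Fin (n+1)) → Fin m) (i : Fin m)
    (ε s : Fin k → Bool) (y : Sg k n → ℝ) : aa F c i ε (flp s y) = aa F c i (fun j => s j == ε j) y := by
  simp only [aa, pt_flp]

noncomputable def WW (a : (Fin k → Bool) → ℝ) (α : Finset (Fin k)) : ℝ :=
  ∑ ε, (∏ j ∈ α, sgn (ε j)) * a ε

lemma WW_shift (a : (Fin k → Bool) → ℝ) (α : Finset (Fin k)) (s : Fin k → Bool) :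
    WW (fun ε => a (fun j => s j == ε j)) α = (∏ j ∈ α, sgn (s j)) * WW a α := by
  have hinv : Function.Involutive (fun (ε : Fin k → Bool) j => s j == ε j) := by
    intro ε; funext j
    simp only
    cases s j <;> cases ε j <;> rfl
  unfold WW
  rw [Finset.mul_sum]
  refine Fintype.sum_equiv hinv.toPerm _ _ fun ε => ?_
  simp only [Function.Involutive.coe_toPerm, sgn_beq, Finset.prod_mul_distrib]
  have hsq : (∏ j ∈ α, sgn (s j)) * (∏ j ∈ α, sgn (s j)) = 1 := by
    rw [← Finset.prod_mul_distrib]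
    simp [sgn_sq]
  linear_combination (-(∏ j ∈ α, sgn (ε j)) * a (fun j => s j == ε j)) * hsq

lemma WW_const (a : (Fin k → Bool) → ℝ) (h : ∀ α, α ≠ ∅ → WW a α = 0) (ε : Fin k → Bool) :
    2^k * a ε = WW a ∅ := by
  have h1 : ∑ α, (∏ j ∈ α, sgn (ε j)) * WW a α = WW a ∅ := by
    rw [Finset.sum_eq_single ∅]
    · simp
    · intro α _ hα; rw [h α hα, mul_zero]
    · simp
  rw [← h1]
  simp only [WW, Finset.mul_sum]
  rw [Finset.sum_comm]
  have h2 : ∀ ε', ∑ α, (∏ j ∈ α, sgn (ε j)) * ((∏ j ∈ α, sgn (ε' j)) * a ε') =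
      (∏ j, (1 + sgn (ε j) * sgn (ε' j))) * a ε' := by
    intro ε'
    rw [Finset.prod_one_add, Finset.powerset_univ, Finset.sum_mul]
    refine Finset.sum_congr rfl fun α _ => ?_
    rw [Finset.prod_mul_distrib]; ring
  simp only [h2]
  rw [Finset.sum_eq_single ε]
  · congr 1
    simp only [sgn_sq]
    norm_num
  · intro ε' _ hne
    obtain ⟨j, hj⟩ := Function.ne_iff.1 hne
    rw [Finset.prod_eq_zero (Finset.mem_univ j), zero_mul]
    revert hj
    cases ε j <;> cases ε' j <;> simp [sgn]
  · simp

/-- Main analytic step. -/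
theorem exists_point (m d : ℕ) (b : Fin k →₀ ℕ) (hb : ∀ j, b j + (d+1) ≤ n)
    (hPP : coeff b (PP (X : Fin k → AA k) ^ m) ≠ 0)
    (F : Finset (Finset (Fin (n + 1)))) (c : Finset (Fin (n+1)) → Fin m)
    (f : (Fin (n + 1) → ℝ) → EuclideanSpace ℝ (Fin d))
    (hf : ContinuousOn f (stdSimplex ℝ (Fin (n + 1)))) :
    ∃ y ∈ KK k n, (∀ j, ∑ v, y (j,v) = 0) ∧ (∀ j, FF f (pt true j y) = FF f (pt false j y)) ∧
      ∀ i (α : Finset (Fin k)), α ≠ ∅ → WW (fun ε => aa F c i ε y) α = 0 := by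
  let I := Fin k ⊕ (Fin k × Fin d) ⊕ (Fin m × {α : Finset (Fin k) // α ≠ ∅}) ⊕
    (Σ j : Fin k, Fin (n - (d+1) - b j))
  let α : I → Finset (Fin k) := Sum.elim (fun j => {j}) (Sum.elim (fun x => {x.1})
    (Sum.elim (fun x => x.2.1) (fun x => {x.1})))
  let Φ : I → (Sg k n → ℝ) → ℝ := Sum.elim (fun j y => ∑ v, y (j,v))
    (Sum.elim (fun x y => FF f (pt true x.1 y) x.2 - FF f (pt false x.1 y) x.2)
    (Sum.elim (fun x y => WW (fun ε => aa F c x.1 ε y) x.2.1) (fun x y => y (x.1, 0))))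
  have hc : coeff (nn k n) (∏ i, ∑ j ∈ α i, (X j : MvPolynomial (Fin k) (ZMod 2))) ≠ 0 := by
    have h1 : ∏ i, ∑ j ∈ α i, (X j : MvPolynomial (Fin k) (ZMod 2)) =
        monomial (nn k n - b) 1 * PP (X : Fin k → AA k) ^ m := by
      simp only [I, Fintype.prod_sum_type, α, Sum.elim_inl, Sum.elim_inr, Finset.sum_singleton,
        Fintype.prod_prod_type, Fintype.prod_sigma, Finset.prod_const, Finset.card_univ, Fintype.card_fin]
      have h2 : ∏ x : {α : Finset (Fin k) // α ≠ ∅}, ∑ j ∈ x.1, (X j : AA k) = PP X := by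
        unfold PP
        rw [Finset.prod_ite]
        simp only [Finset.prod_const_one, one_mul]
        exact (Finset.prod_subtype (p := fun α : Finset (Fin k) => α ≠ ∅) _ (by simp)
          (fun α => ∑ j ∈ α, (X j : AA k))).symm
      have h3 : (monomial (nn k n - b) 1 : AA k) = ∏ j, X j ^ (n - b j) := by
        rw [monomial_eq, Finsupp.prod_fintype _ _ (by simp)]
        simp [nn]
      change _ * (_ * ((∏ x : {α : Finset (Fin k) // α ≠ ∅}, ∑ j ∈ x.1, (X j : AA k)) ^ m * _)) = _
      rw [h2, h3]
      have h4 : ∀ j, (X j : AA k) ^ (n - b j) = X j * (X j ^ d * X j ^ (n - (d+1) - b j)) := by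
        intro j
        rw [← pow_add, ← pow_succ']
        congr 1
        have := hb j
        omega
      simp only [h4, Finset.prod_mul_distrib]
      ring
    rw [h1]
    have h5 : nn k n = (nn k n - b) + b := by
      ext j
      have := hb j
      simp [nn]
      omega
    rw [h5, add_tsub_cancel_right, coeff_monomial_mul, one_mul]
    exact hPP
  have hcont : ∀ i, ContinuousOn (Φ i) (KK k n) := by
    have hF : ∀ b j, Continuous fun y : Sg k n → ℝ => FF f (pt b j y) := by
      intro b j
      rw [← continuousOn_univ]
      exact (FF_cont f hf).comp (pt_cont b j).continuousOn (fun y _ => pt_nonneg b j y)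
    rintro (j | x | x | x)
    · refine Continuous.continuousOn ?_
      simp only [Φ, Sum.elim_inl]; fun_prop
    · refine Continuous.continuousOn ?_
      simp only [Φ, Sum.elim_inl, Sum.elim_inr]
      have hp : Continuous fun z : EuclideanSpace ℝ (Fin d) => z x.2 := by fun_prop
      exact (hp.comp (hF true x.1)).sub (hp.comp (hF false x.1))
    · refine Continuous.continuousOn ?_
      simp only [Φ, Sum.elim_inl, Sum.elim_inr, WW]
      exact continuous_finsetSum _ fun ε _ => continuous_const.mul (aa_cont F c _ ε)
    · refine Continuous.continuousOn ?_
      simp only [Φ, Sum.elim_inr]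
      fun_prop
  have heq : ∀ i (s : Fin k → Bool), ∀ y ∈ KK k n,
      Φ i (flp s y) = (∏ j ∈ α i, sgn (s j)) * Φ i y := by
    rintro (j | x | x | x) s y -
    · simp [Φ, α, flp, Finset.mul_sum]
    · simp only [Φ, α, Sum.elim_inl, Sum.elim_inr, pt_flp, Finset.prod_singleton]
      cases s x.1 <;> simp [sgn]
    · simp only [Φ, α, Sum.elim_inl, Sum.elim_inr, aa_flp]
      exact WW_shift (fun ε => aa F c x.1 ε y) _ _
    · simp [Φ, α, flp]
  obtain ⟨y, hy, hz⟩ := cont_zero' α hc Φ hcont heq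
  refine ⟨y, hy, fun j => hz (Sum.inl j), fun j => ?_, fun i α hα => hz (Sum.inr (Sum.inr (Sum.inl (i, ⟨α, hα⟩))))⟩
  ext t
  exact sub_eq_zero.1 (hz (Sum.inr (Sum.inl (j, t))))

lemma pt_pos_true {j : Fin k} {y : Sg k n → ℝ} {v} : pt true j y v ≠ 0 ↔ 0 < y (j,v) := by
  simp [pt, sgn]

lemma pt_pos_false {j : Fin k} {y : Sg k n → ℝ} {v} : pt false j y v ≠ 0 ↔ y (j,v) < 0 := by
  simp [pt, sgn]

end KRP

open KRP

theorem k_radon_pairs_upper_bound (m k d p q n : ℕ) (hm : 1 ≤ m) (hk : 1 ≤ k)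
    (hd : 1 ≤ d) (hmpq : m = 2 ^ p + q) (hq : q < 2 ^ p)
    (hn : d + (2 ^ (k + p - 1) + q) + 1 ≤ n)
    (F : Finset (Finset (Fin (n + 1)))) (hne : ∀ A ∈ F, A.Nonempty)
    (hχ : KneserChromaticLe F (2 ^ k) m)
    (f : (Fin (n + 1) → ℝ) → EuclideanSpace ℝ (Fin d))
    (hf : ContinuousOn f (stdSimplex ℝ (Fin (n + 1)))) :
    ∃ σp σm : Fin k → Finset (Fin (n + 1)),
      (∀ j, IsRadonPair f (σp j) (σm j)) ∧
      ∀ ε : Fin k → Bool, ∀ A ∈ F,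
        ¬A ⊆ Finset.univ.inf (fun j => if ε j then σp j else σm j) := by
  obtain ⟨c, hc⟩ := hχ
  obtain ⟨b, hb, hPP⟩ : ∃ b : Fin k →₀ ℕ, (∀ j, b j + (d+1) ≤ n) ∧
      MvPolynomial.coeff b (PP (MvPolynomial.X : Fin k → AA k) ^ m) ≠ 0 := by
    obtain ⟨k, rfl⟩ : ∃ k', k = k' + 1 := ⟨k - 1, by omega⟩
    obtain ⟨b, hb, hPP⟩ := PP_monomial k p q hq
    refine ⟨b, fun j => ?_, by rw [hmpq]; exact hPP⟩
    have := hb j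
    have e : k + 1 + p - 1 = k + p := by omega
    rw [e] at hn
    omega
  obtain ⟨y, hy, hsum, hFF, hW⟩ := exists_point m d b hb hPP F c f hf
  refine ⟨fun j => Finset.univ.filter fun v => 0 < y (j,v),
    fun j => Finset.univ.filter fun v => y (j,v) < 0, fun j => ⟨?_, ?_⟩, ?_⟩
  · rw [Finset.disjoint_filter]
    intro v _ h; exact h.le.not_gt
  · have hS : ∑ v, pt true j y v = ∑ v, pt false j y v := by
      rw [← sub_eq_zero, ← Finset.sum_sub_distrib]
      simp only [pt_sub]
      exact hsum j
    have hS0 : ∑ v, pt true j y v ≠ 0 := by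
      intro h
      have h1 := (Finset.sum_eq_zero_iff_of_nonneg (fun v _ => pt_nonneg true j y v)).1 h
      have h2 := (Finset.sum_eq_zero_iff_of_nonneg (fun v _ => pt_nonneg false j y v)).1 (hS ▸ h)
      have h3 := hy j
      have h4 : ∀ v, y (j,v) = 0 := fun v => by
        rw [← pt_sub j y v, h1 v (Finset.mem_univ v), h2 v (Finset.mem_univ v), sub_zero]
      simp [h4] at h3
    have hS1 : ∑ v, pt false j y v ≠ 0 := hS ▸ hS0
    have h5 := hFF j
    unfold FF at h5
    rw [← hS] at h5
    have h6 := smul_right_injective _ hS0 h5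
    refine ⟨f ((∑ v, pt true j y v)⁻¹ • pt true j y), ⟨_, ⟨simp_mem (pt_nonneg true j y) hS0, ?_⟩, rfl⟩,
      ⟨(∑ v, pt true j y v)⁻¹ • pt false j y, ⟨?_, ?_⟩, h6.symm⟩⟩
    · intro v hv
      have : pt true j y v = 0 := by
        by_contra h; exact hv (by simpa using pt_pos_true.1 h)
      simp [this]
    · rw [hS]; exact simp_mem (pt_nonneg false j y) hS1
    · intro v hv
      have : pt false j y v = 0 := by
        by_contra h; exact hv (by simpa using pt_pos_false.1 h)
      simp [this]
  · intro ε A hA hsub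
    have hsub' : ∀ v ∈ A, ∀ j, pt (ε j) j y v ≠ 0 := by
      intro v hv j
      have h1 : v ∈ (if ε j then Finset.univ.filter (fun v => 0 < y (j,v))
          else Finset.univ.filter (fun v => y (j,v) < 0)) :=
        Finset.inf_le (f := fun j => if ε j then Finset.univ.filter (fun v => 0 < y (j,v))
          else Finset.univ.filter (fun v => y (j,v) < 0)) (Finset.mem_univ j) (hsub hv)
      cases he : ε j with
      | true => rw [he] at h1; exact pt_pos_true.2 (by simpa using h1)
      | false => rw [he] at h1; exact pt_pos_false.2 (by simpa using h1)
    have hnn : ∀ ε' : Fin k → Bool, ∀ B : Finset (Fin (n+1)), 0 ≤ ∏ v ∈ B, ∏ j, pt (ε' j) j y v :=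
      fun ε' B => Finset.prod_nonneg fun v _ => Finset.prod_nonneg fun j _ => pt_nonneg _ _ _ _
    have ha : aa F c (c A) ε y ≠ 0 := by
      intro h
      have h1 := (Finset.sum_eq_zero_iff_of_nonneg (fun B _ => hnn ε B)).1 h A (by simp [hA])
      exact Finset.prod_ne_zero_iff.2 (fun v hv => Finset.prod_ne_zero_iff.2 fun j _ => hsub' v hv j) h1
    have hconst := WW_const (fun ε => aa F c (c A) ε y) (hW (c A))
    have ha' : ∀ ε', aa F c (c A) ε' y ≠ 0 := by
      intro ε' h
      have h1 := hconst ε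
      have h2 := hconst ε'
      simp only [h, mul_zero] at h2
      simp only [← h2] at h1
      exact ha ((mul_eq_zero.1 h1).resolve_left (by positivity))
    have hB : ∀ ε' : Fin k → Bool, ∃ B ∈ F, c B = c A ∧ ∀ v ∈ B, ∀ j, pt (ε' j) j y v ≠ 0 := by
      intro ε'
      obtain ⟨B, hB, h1⟩ := Finset.exists_ne_zero_of_sum_ne_zero (ha' ε')
      rw [Finset.mem_filter] at hB
      refine ⟨B, hB.1, hB.2, fun v hv j => ?_⟩
      exact Finset.prod_ne_zero_iff.1 (Finset.prod_ne_zero_iff.1 h1 v hv) j (Finset.mem_univ j)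
    choose B hBF hBc hBp using hB
    have hdis : ∀ e e' : Fin k → Bool, e ≠ e' → Disjoint (B e) (B e') := by
      intro e e' hee
      obtain ⟨j, hj⟩ := Function.ne_iff.1 hee
      rw [Finset.disjoint_left]
      intro v h1 h2
      have h3 := hBp e v h1 j
      have h4 := hBp e' v h2 j
      cases he : e j <;> cases he' : e' j <;> rw [he] at h3 hj <;> rw [he'] at h4 hj
      · exact hj rfl
      · exact lt_asymm (pt_pos_false.1 h3) (pt_pos_true.1 h4)
      · exact lt_asymm (pt_pos_false.1 h4) (pt_pos_true.1 h3)
      · exact hj rfl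
    have hinj : Function.Injective B := by
      intro e e' h
      by_contra hee
      have h1 := hdis e e' hee
      rw [h, disjoint_self] at h1
      exact (hne _ (hBF e')).ne_empty h1
    have hcard := hc (Finset.univ.image B) (by
        intro x hx
        obtain ⟨e, _, rfl⟩ := Finset.mem_image.1 hx
        exact hBF e)
      (by
        intro x hx z hz hxz
        obtain ⟨e, _, rfl⟩ := Finset.mem_image.1 hx
        obtain ⟨e', _, rfl⟩ := Finset.mem_image.1 hz
        exact hdis e e' fun h => hxz (h ▸ rfl))
      (by
        intro x hx z hz
        obtain ⟨e, _, rfl⟩ := Finset.mem_image.1 hx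
        obtain ⟨e', _, rfl⟩ := Finset.mem_image.1 hz
        rw [hBc, hBc])
    rw [Finset.card_image_of_injective _ hinj] at hcard
    simp at hcard
end
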